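/- Let P_0 be a probability distribution supported on [-S,S] with second moment ρ = E[X²] for X∼P_0. For each n, let X_1,…,X_n be i.i.d. P_0 and Z_ij∼N(0,1) i.i.d. for 1≤i≤j≤n (with Z_ji=Z_ij), define the Hamiltonian H(x;X,Z) = Σ_{i≤j}( x_i²x_j²/(2n) - x_ix_jX_iX_j/n - x_ix_jZ_ij/√n ), the partition function Z_n = ∫∏_i dP_0(x_i) e^{-H(x;X,Z)}, and the free energy f_n^ws = -(1/n) E ln Z_n. Then lim_{n→∞} f_n^ws = inf_{r∈[0,ρ]} sup_{q∈[0,ρ]} f^pot(q,r), where f^pot(q,r) = qr/2 - q²/4 - E ln ∫dP_0(x) e^{-( r x²/2 - r xX - √r xZ )}, with X∼P_0 and Z∼N(0,1) independent. -/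

import Mathlib

open Finset MeasureTheory ProbabilityTheory

/-- The standard Gaussian measure `N(0,1)` on `ℝ`. -/
noncomputable def stdGauss : Measure ℝ := gaussianReal 0 1

instance : IsProbabilityMeasure stdGauss :=
  inferInstanceAs (IsProbabilityMeasure (gaussianReal 0 1))

/-- Hamiltonian of the Wigner spike model:
`H(x; X, Z) = Σ_{i≤j}( x_i²x_j²/(2n) - x_ix_jX_iX_j/n - x_ix_jZ_ij/√n )`. -/
noncomputable def Hws (n : ℕ) (X : Fin n → ℝ) (Z : Fin n × Fin n → ℝ)
    (x : Fin n → ℝ) : ℝ :=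
  ∑ i : Fin n, ∑ j ∈ Finset.univ.filter (fun j => i ≤ j),
    (x i ^ 2 * x j ^ 2 / (2 * n) - x i * x j * X i * X j / n
      - x i * x j * Z (i, j) / Real.sqrt n)

/-- Partition function `Z_n(X, Z) = ∫ ∏_i dP_0(x_i) e^{-H(x;X,Z)}`. -/
noncomputable def Zws (P0 : Measure ℝ) (n : ℕ) (X : Fin n → ℝ)
    (Z : Fin n × Fin n → ℝ) : ℝ :=
  ∫ x : Fin n → ℝ, Real.exp (-Hws n X Z x) ∂(Measure.pi fun _ : Fin n => P0)

/-- Free energy of the Wigner spike model: `f_n^ws = -(1/n) E ln Z_n(X, Z)`. -/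
noncomputable def fws (P0 : Measure ℝ) (n : ℕ) : ℝ :=
  -(1 / n) * ∫ X : Fin n → ℝ,
      (∫ Z : Fin n × Fin n → ℝ, Real.log (Zws P0 n X Z)
        ∂(Measure.pi fun _ : Fin n × Fin n => stdGauss))
    ∂(Measure.pi fun _ : Fin n => P0)

/-- The replica-symmetric potential of the Wigner spike model:
`f^pot(q,r) = qr/2 - q²/4 - E ln ∫ dP_0(x) e^{-( r x²/2 - r xX - √r xZ )}`. -/
noncomputable def fpotWS (P0 : Measure ℝ) (q r : ℝ) : ℝ :=
  q * r / 2 - q ^ 2 / 4 - ∫ X,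
      (∫ z, Real.log (∫ x, Real.exp (-(r * x ^ 2 / 2 - r * x * X - Real.sqrt r * x * z)) ∂P0)
        ∂stdGauss) ∂P0

section GaussianTools

lemma measurePreserving_update_pi {K : Type*} [Fintype K] [DecidableEq K] (ν : K → Measure ℝ)
    [∀ k, IsProbabilityMeasure (ν k)] (k : K) :
    MeasurePreserving (fun p : (K → ℝ) × ℝ => Function.update p.1 k p.2)
      ((Measure.pi ν).prod (ν k)) (Measure.pi ν) := by
  have hm : Measurable (fun p : (K → ℝ) × ℝ => Function.update p.1 k p.2) :=
    measurable_update'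
  refine ⟨hm, (Measure.pi_eq fun s hs => ?_).symm⟩
  rw [Measure.map_apply hm (MeasurableSet.univ_pi hs)]
  have : (fun p : (K → ℝ) × ℝ => Function.update p.1 k p.2) ⁻¹' (Set.univ.pi s)
      = (Set.univ.pi (Function.update s k Set.univ)) ×ˢ (s k) := by
    ext ⟨g, r⟩
    simp only [Set.mem_preimage, Set.mem_pi, Set.mem_univ, true_imp_iff, Set.mem_prod]
    constructor
    · intro h
      refine ⟨fun j => ?_, by simpa using h k⟩
      rcases eq_or_ne j k with rfl | hj
      · simp
      · simpa [hj] using h j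
    · rintro ⟨h1, h2⟩ j
      rcases eq_or_ne j k with rfl | hj
      · simpa using h2
      · simpa [hj] using h1 j
  rw [this, Measure.prod_prod, Measure.pi_pi]
  rw [← Finset.prod_erase_mul _ _ (Finset.mem_univ k),
    ← Finset.prod_erase_mul _ (fun i => ν i (s i)) (Finset.mem_univ k)]
  simp only [Function.update_self, measure_univ, mul_one]
  congr 1
  refine Finset.prod_congr rfl fun j hj => ?_
  rw [Function.update_of_ne (Finset.ne_of_mem_erase hj)]

lemma integral_stdGauss_eq (f : ℝ → ℝ) :
    ∫ s, f s ∂stdGauss = ∫ s, gaussianPDFReal 0 1 s * f s := by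
  rw [stdGauss, integral_gaussianReal_eq_integral_smul (by norm_num)]
  simp

lemma memLp_id_stdGauss (p : NNReal) : MemLp (fun x : ℝ => x) p stdGauss :=
  memLp_id_gaussianReal p

lemma integrable_id_stdGauss : Integrable (fun x : ℝ => x) stdGauss :=
  (memLp_id_stdGauss 1).integrable (by norm_num)

lemma integrable_exp_mul_stdGauss (t : ℝ) : Integrable (fun x : ℝ => Real.exp (t * x)) stdGauss :=
  integrable_exp_mul_gaussianReal t

lemma hasDerivAt_gaussianPDFReal_std (s : ℝ) :
    HasDerivAt (gaussianPDFReal 0 1) (-s * gaussianPDFReal 0 1 s) s := by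
  have h : gaussianPDFReal 0 1 = fun x => (√(2 * Real.pi * (1 : NNReal)))⁻¹ *
      Real.exp (- (x - 0) ^ 2 / (2 * (1 : NNReal))) := gaussianPDFReal_def 0 1
  rw [h]
  have h1 : HasDerivAt (fun x : ℝ => - (x - 0) ^ 2 / (2 * ((1 : NNReal) : ℝ))) (-s) s := by
    have := (((hasDerivAt_id s).sub_const 0).pow 2).neg.div_const (2 * ((1 : NNReal) : ℝ))
    refine this.congr_deriv ?_
    simp
    ring
  refine (h1.exp.const_mul _).congr_deriv ?_
  ring

lemma integrable_stdGauss_iff {f : ℝ → ℝ} :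
    Integrable f stdGauss ↔ Integrable (fun s => gaussianPDFReal 0 1 s * f s) := by
  rw [stdGauss, gaussianReal_of_var_ne_zero _ (by norm_num),
    integrable_withDensity_iff_integrable_smul' (measurable_gaussianPDF _ _)
      (Filter.Eventually.of_forall fun _ => gaussianPDF_lt_top)]
  simp [toReal_gaussianPDF]

lemma stdGauss_integration_by_parts {F F' : ℝ → ℝ} {C : ℝ} (hF : ∀ x, HasDerivAt F (F' x) x)
    (hb : ∀ x, |F x| ≤ C) (hb' : ∀ x, |F' x| ≤ C) :
    ∫ s, s * F s ∂stdGauss = ∫ s, F' s ∂stdGauss := by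
  have hFm : Measurable F := (continuous_iff_continuousAt.2 fun x => (hF x).continuousAt).measurable
  have hF'm : Measurable F' := by
    rw [show F' = deriv F from funext fun x => (hF x).deriv.symm]
    exact measurable_deriv F
  have i1 : Integrable F' stdGauss :=
    Integrable.of_bound hF'm.aestronglyMeasurable C (Filter.Eventually.of_forall hb')
  have i2 : Integrable F stdGauss :=
    Integrable.of_bound hFm.aestronglyMeasurable C (Filter.Eventually.of_forall hb)
  have i3 : Integrable (fun s => s * F s) stdGauss := by
    refine (integrable_id_stdGauss.norm.const_mul C).mono'
      (measurable_id.mul hFm).aestronglyMeasurable (Filter.Eventually.of_forall fun s => ?_)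
    rw [norm_mul, mul_comm]
    exact mul_le_mul_of_nonneg_right (hb s) (norm_nonneg _)
  rw [integral_stdGauss_eq, integral_stdGauss_eq]
  have := integral_mul_deriv_eq_deriv_mul_of_integrable (u := gaussianPDFReal 0 1) (v := F)
    (u' := fun s => -s * gaussianPDFReal 0 1 s) (v' := F')
    (fun x _ => hasDerivAt_gaussianPDFReal_std x) (fun x _ => hF x)
    (integrable_stdGauss_iff.1 i1)
    ((integrable_stdGauss_iff.1 i3).neg.congr (Filter.Eventually.of_forall fun s => by
      simp; ring))
    (integrable_stdGauss_iff.1 i2)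
  rw [this, ← integral_neg]
  congr 1
  ext s
  ring

lemma stdGauss_pi_integration_by_parts {K : Type*} [Fintype K] [DecidableEq K]
    {f f' : (K → ℝ) → ℝ} {C : ℝ} (k : K)
    (hf : ∀ g, HasDerivAt (fun s => f (Function.update g k s)) (f' g) (g k))
    (hfm : Measurable f) (hfm' : Measurable f') (hb : ∀ g, |f g| ≤ C) (hb' : ∀ g, |f' g| ≤ C) :
    ∫ g, g k * f g ∂(Measure.pi fun _ : K => stdGauss)
      = ∫ g, f' g ∂(Measure.pi fun _ : K => stdGauss) := by
  have mp := measurePreserving_update_pi (fun _ : K => stdGauss) k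
  have mpe := measurePreserving_eval (fun _ : K => stdGauss) k
  have i0 : Integrable (fun g : K → ℝ => g k) (Measure.pi fun _ : K => stdGauss) :=
    mpe.integrable_comp_of_integrable integrable_id_stdGauss
  have i1 : Integrable (fun g => g k * f g) (Measure.pi fun _ : K => stdGauss) := by
    refine (i0.norm.const_mul C).mono'
      ((measurable_pi_apply k).mul hfm).aestronglyMeasurable
      (Filter.Eventually.of_forall fun s => ?_)
    rw [norm_mul, mul_comm]
    exact mul_le_mul_of_nonneg_right (hb s) (norm_nonneg _)
  have i2 : Integrable f' (Measure.pi fun _ : K => stdGauss) :=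
    Integrable.of_bound hfm'.aestronglyMeasurable C (Filter.Eventually.of_forall hb')
  conv_lhs => rw [← mp.map_eq]
  conv_rhs => rw [← mp.map_eq]
  have hm : Measurable (fun g : K → ℝ => g k * f g) := (measurable_pi_apply k).mul hfm
  have j1 : Integrable (fun p : (K → ℝ) × ℝ => Function.update p.1 k p.2 k *
      f (Function.update p.1 k p.2)) ((Measure.pi fun _ : K => stdGauss).prod stdGauss) :=
    mp.integrable_comp_of_integrable i1
  have j2 : Integrable (fun p : (K → ℝ) × ℝ => f' (Function.update p.1 k p.2))
      ((Measure.pi fun _ : K => stdGauss).prod stdGauss) :=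
    mp.integrable_comp_of_integrable i2
  rw [integral_map mp.measurable.aemeasurable hm.aestronglyMeasurable,
    integral_map mp.measurable.aemeasurable hfm'.aestronglyMeasurable,
    integral_prod _ j1, integral_prod _ j2]
  congr 1
  ext g
  simp only [Function.update_self]
  refine stdGauss_integration_by_parts (fun x => ?_) (fun x => hb _) (fun x => hb' _)
  simpa using hf (Function.update g k x)

lemma stdGauss_map_add (b : ℝ) : stdGauss.map (fun s => s + b)
    = stdGauss.withDensity (fun s => ENNReal.ofReal (Real.exp (b * s - b ^ 2 / 2))) := by
  rw [stdGauss, gaussianReal_map_add_const, gaussianReal_of_var_ne_zero _ (by norm_num),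
    gaussianReal_of_var_ne_zero _ (by norm_num),
    ← withDensity_mul _ (measurable_gaussianPDF _ _) (by fun_prop)]
  congr 1
  ext s
  simp only [gaussianPDF, Pi.mul_apply]
  rw [← ENNReal.ofReal_mul (gaussianPDFReal_nonneg _ _ _)]
  congr 1
  simp only [gaussianPDFReal]
  rw [mul_assoc (_)⁻¹, ← Real.exp_add]
  congr 2
  simp
  ring

lemma integrable_exp_shift (b : ℝ) :
    Integrable (fun s : ℝ => Real.exp (b * s - b ^ 2 / 2)) stdGauss := by
  simp_rw [Real.exp_sub]
  exact (integrable_exp_mul_stdGauss b).div_const _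

lemma stdGauss_pi_map_add {K : Type*} [Fintype K] (b : K → ℝ) :
    (Measure.pi fun _ : K => stdGauss).map (fun g => g + b)
    = (Measure.pi fun _ : K => stdGauss).withDensity
      (fun g => ENNReal.ofReal (Real.exp (∑ k, (b k * g k - b k ^ 2 / 2)))) := by
  have h1 : (Measure.pi fun _ : K => stdGauss).map (fun g => g + b)
      = Measure.pi (fun k => stdGauss.map (fun s => s + b k)) := by
    have : ∀ k, IsProbabilityMeasure (stdGauss.map (fun s => s + b k)) := fun k =>
      Measure.isProbabilityMeasure_map (by fun_prop)
    exact Measure.pi_map_pi (f := fun k s => s + b k) (fun k => by fun_prop)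
  have : ∀ k, IsProbabilityMeasure (stdGauss.map (fun s => s + b k)) := fun k =>
    Measure.isProbabilityMeasure_map (by fun_prop)
  rw [h1]
  refine Measure.pi_eq fun s hs => ?_
  rw [withDensity_apply _ (MeasurableSet.univ_pi hs), Measure.restrict_pi_pi]
  have e : ∀ g : K → ℝ, Real.exp (∑ k, (b k * g k - b k ^ 2 / 2))
      = ∏ k, Real.exp (b k * g k - b k ^ 2 / 2) := fun g => Real.exp_sum _ _
  simp_rw [e]
  rw [← ofReal_integral_eq_lintegral_ofReal, integral_fintype_prod_eq_prod
    (f := fun k s => Real.exp (b k * s - b k ^ 2 / 2)), ENNReal.ofReal_prod_of_nonneg]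
  · refine Finset.prod_congr rfl fun k _ => ?_
    rw [stdGauss_map_add, withDensity_apply _ (hs k), ofReal_integral_eq_lintegral_ofReal]
    · exact (integrable_exp_shift _).restrict
    · exact Filter.Eventually.of_forall fun _ => (Real.exp_pos _).le
  · intro k _
    exact integral_nonneg fun _ => (Real.exp_pos _).le
  · exact Integrable.fintype_prod (f := fun k s => Real.exp (b k * s - b k ^ 2 / 2))
      fun k => (integrable_exp_shift _).restrict
  · exact Filter.Eventually.of_forall fun _ => Finset.prod_nonneg fun _ _ => (Real.exp_pos _).le

lemma integral_stdGauss_pi_add {K : Type*} [Fintype K] (b : K → ℝ) (G : (K → ℝ) → ℝ) :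
    ∫ g, G (g + b) ∂(Measure.pi fun _ : K => stdGauss)
      = ∫ g, Real.exp (∑ k, (b k * g k - b k ^ 2 / 2)) * G g
        ∂(Measure.pi fun _ : K => stdGauss) := by
  have h := integral_map_equiv (MeasurableEquiv.addRight b)
    (μ := Measure.pi fun _ : K => stdGauss) G
  have h2 : Measure.map (MeasurableEquiv.addRight b) (Measure.pi fun _ : K => stdGauss)
    = (Measure.pi fun _ : K => stdGauss).map (fun g => g + b) := rfl
  rw [h2, stdGauss_pi_map_add, integral_withDensity_eq_integral_toReal_smul] at h
  · simp only [MeasurableEquiv.coe_addRight] at h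
    rw [← h]
    congr 1
    ext g
    rw [ENNReal.toReal_ofReal (Real.exp_pos _).le, smul_eq_mul]
  · fun_prop
  · exact Filter.Eventually.of_forall fun _ => ENNReal.ofReal_lt_top

lemma integrable_exp_abs_stdGauss (c : ℝ) :
    Integrable (fun x : ℝ => Real.exp (c * |x|)) stdGauss := by
  refine ((integrable_exp_mul_stdGauss c).add (integrable_exp_mul_stdGauss (-c))).mono'
    (by fun_prop) (Filter.Eventually.of_forall fun x => ?_)
  rw [Real.norm_of_nonneg (Real.exp_pos _).le, Pi.add_apply]
  rcases abs_cases x with ⟨h, _⟩ | ⟨h, _⟩ <;> rw [h]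
  · linarith [Real.exp_pos (-c * x)]
  · rw [show c * -x = -c * x by ring]
    linarith [Real.exp_pos (c * x)]

lemma integrable_exp_sum_abs_stdGauss {K : Type*} [Fintype K] (c : ℝ) :
    Integrable (fun g : K → ℝ => Real.exp (c * ∑ k, |g k|)) (Measure.pi fun _ : K => stdGauss) := by
  have e : ∀ g : K → ℝ, Real.exp (c * ∑ k, |g k|) = ∏ k, Real.exp (c * |g k|) := fun g => by
    rw [Finset.mul_sum, Real.exp_sum]
  simp_rw [e]
  exact Integrable.fintype_prod (f := fun _ s => Real.exp (c * |s|))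
    fun k => integrable_exp_abs_stdGauss c

lemma stdGauss_map_neg : stdGauss.map (fun s => -s) = stdGauss := by
  rw [stdGauss, gaussianReal_map_neg, neg_zero]

lemma integral_stdGauss_pi_neg {K : Type*} [Fintype K] (G : (K → ℝ) → ℝ) :
    ∫ g, G (-g) ∂(Measure.pi fun _ : K => stdGauss)
      = ∫ g, G g ∂(Measure.pi fun _ : K => stdGauss) := by
  have h := integral_map_equiv (MeasurableEquiv.neg (K → ℝ))
    (μ := Measure.pi fun _ : K => stdGauss) G
  have h1 : Measure.map (MeasurableEquiv.neg (K → ℝ)) (Measure.pi fun _ : K => stdGauss)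
      = Measure.pi fun _ : K => stdGauss := by
    have : ∀ k : K, IsProbabilityMeasure (stdGauss.map (fun s => -s)) := fun k =>
      Measure.isProbabilityMeasure_map (by fun_prop)
    have h2 := Measure.pi_map_pi (μ := fun _ : K => stdGauss) (f := fun k s => -s)
      (fun k => by fun_prop)
    simp_rw [stdGauss_map_neg] at h2
    exact h2
  rw [h1] at h
  rw [h]
  rfl

end GaussianTools

section LogIntegralExp

variable {E : Type*} [MeasurableSpace E] {μ : Measure E} [IsFiniteMeasure μ]

lemma integrable_exp_of_bound {u : E → ℝ} {M : ℝ} (hu : Measurable u) (hb : ∀ᵐ x ∂μ, |u x| ≤ M) :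
    Integrable (fun x => Real.exp (u x)) μ :=
  Integrable.of_bound (by fun_prop) (Real.exp M) (hb.mono fun x hx => by
    rw [Real.norm_of_nonneg (Real.exp_pos _).le]
    exact Real.exp_le_exp.2 (le_of_abs_le hx))

lemma integrable_mul_exp_of_bound {u f : E → ℝ} {M F : ℝ} (hu : Measurable u)
    (hb : ∀ᵐ x ∂μ, |u x| ≤ M) (hf : Measurable f) (hfb : ∀ᵐ x ∂μ, |f x| ≤ F) :
    Integrable (fun x => f x * Real.exp (u x)) μ :=
  (integrable_exp_of_bound hu hb).bdd_mul hf.aestronglyMeasurable hfb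

lemma integral_exp_pos_of_bound {u : E → ℝ} {M : ℝ} (hμ : μ ≠ 0) (hu : Measurable u)
    (hb : ∀ᵐ x ∂μ, |u x| ≤ M) : 0 < ∫ x, Real.exp (u x) ∂μ := by
  have : NeZero μ := ⟨hμ⟩
  exact integral_exp_pos (integrable_exp_of_bound hu hb)

lemma log_integral_exp_le_add {u v : E → ℝ} {M N δ : ℝ} (hμ : μ ≠ 0) (hu : Measurable u)
    (hv : Measurable v) (hbu : ∀ᵐ x ∂μ, |u x| ≤ M) (hbv : ∀ᵐ x ∂μ, |v x| ≤ N)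
    (h : ∀ᵐ x ∂μ, u x ≤ v x + δ) :
    Real.log (∫ x, Real.exp (u x) ∂μ) ≤ Real.log (∫ x, Real.exp (v x) ∂μ) + δ := by
  have pu := integral_exp_pos_of_bound hμ hu hbu
  have pv := integral_exp_pos_of_bound hμ hv hbv
  rw [← Real.log_exp δ, ← Real.log_mul pv.ne' (Real.exp_pos _).ne']
  refine Real.log_le_log pu ?_
  rw [← integral_mul_const]
  refine integral_mono_ae (integrable_exp_of_bound hu hbu)
    ((integrable_exp_of_bound hv hbv).mul_const _) (h.mono fun x hx => ?_)
  simp only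
  rw [← Real.exp_add]
  exact Real.exp_le_exp.2 hx

lemma abs_log_integral_exp_sub_le {u v : E → ℝ} {M N δ : ℝ} (hμ : μ ≠ 0) (hu : Measurable u)
    (hv : Measurable v) (hbu : ∀ᵐ x ∂μ, |u x| ≤ M) (hbv : ∀ᵐ x ∂μ, |v x| ≤ N)
    (h : ∀ᵐ x ∂μ, |u x - v x| ≤ δ) :
    |Real.log (∫ x, Real.exp (u x) ∂μ) - Real.log (∫ x, Real.exp (v x) ∂μ)| ≤ δ := by
  have h1 := log_integral_exp_le_add (δ := δ) hμ hu hv hbu hbv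
    (h.mono fun x hx => by linarith [le_of_abs_le hx])
  have h2 := log_integral_exp_le_add (δ := δ) hμ hv hu hbv hbu
    (h.mono fun x hx => by linarith [neg_le_of_abs_le hx])
  rw [abs_le]
  constructor <;> linarith

lemma hasDerivAt_integral_mul_exp {u u' : ℝ → E → ℝ} {f : E → ℝ} {t₀ M F : ℝ}
    (hf : Measurable f) (hfb : ∀ᵐ x ∂μ, |f x| ≤ F) (hu : ∀ t, Measurable (u t))
    (hu' : Measurable (u' t₀))
    (hb : ∀ᵐ x ∂μ, ∀ t ∈ Metric.ball t₀ 1, |u t x| ≤ M ∧ |u' t x| ≤ M)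
    (hd : ∀ x t, HasDerivAt (fun t => u t x) (u' t x) t) :
    HasDerivAt (fun t => ∫ x, f x * Real.exp (u t x) ∂μ)
      (∫ x, f x * u' t₀ x * Real.exp (u t₀ x) ∂μ) t₀ := by
  have hball : Metric.ball t₀ 1 ∈ nhds t₀ := Metric.ball_mem_nhds _ one_pos
  have hmem : t₀ ∈ Metric.ball t₀ 1 := Metric.mem_ball_self one_pos
  refine (hasDerivAt_integral_of_dominated_loc_of_deriv_le (bound := fun _ => F * M * Real.exp M)
    (F := fun t x => f x * Real.exp (u t x)) (F' := fun t x => f x * u' t x * Real.exp (u t x))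
    hball ?_ ?_ ?_ ?_ (integrable_const _) ?_).2
  · exact Filter.Eventually.of_forall fun t => by have := hu t; fun_prop
  · exact integrable_mul_exp_of_bound (hu _) (hb.mono fun x hx => (hx t₀ hmem).1) hf hfb
  · have := hu t₀
    fun_prop
  · filter_upwards [hb, hfb] with x hx hfx t ht
    rw [norm_mul, norm_mul, Real.norm_of_nonneg (Real.exp_pos _).le]
    have h1 := hx t ht
    have hF : 0 ≤ F := (abs_nonneg _).trans hfx
    have hM : 0 ≤ M := (abs_nonneg _).trans h1.1
    exact mul_le_mul (mul_le_mul hfx h1.2 (abs_nonneg _) hF)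
      (Real.exp_le_exp.2 (le_of_abs_le h1.1)) (Real.exp_pos _).le (by positivity)
  · filter_upwards with x t _
    refine (((hd x t).exp).const_mul (f x)).congr_deriv ?_
    ring

end LogIntegralExp

section GaussianModel

variable {K E : Type*} [Fintype K] [MeasurableSpace E]

/-- Exponent of a planted Gaussian model with couplings `h k`, amplitudes `a k`,
planted values `p k` and noise `g k`. -/
noncomputable def modelExponent (h : K → E → ℝ) (a p g : K → ℝ) (x : E) : ℝ :=
  ∑ k, (a k * g k * h k x + a k ^ 2 * (p k * h k x - h k x ^ 2 / 2))

/-- Partition function of the planted Gaussian model. -/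
noncomputable def modelPartition (μ : Measure E) (h : K → E → ℝ) (a p g : K → ℝ) : ℝ :=
  ∫ x, Real.exp (modelExponent h a p g x) ∂μ

/-- Gibbs average of the observable `f` in the planted Gaussian model. -/
noncomputable def gibbs (μ : Measure E) (h : K → E → ℝ) (a p g : K → ℝ) (f : E → ℝ) : ℝ :=
  (∫ x, f x * Real.exp (modelExponent h a p g x) ∂μ) / modelPartition μ h a p g

/-- Noise average of the log-partition function of the planted Gaussian model. -/
noncomputable def modelFreeEnergy (μ : Measure E) (h : K → E → ℝ) (a p : K → ℝ) : ℝ :=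
  ∫ g, Real.log (modelPartition μ h a p g) ∂(Measure.pi fun _ : K => stdGauss)

variable {μ : Measure E} [IsFiniteMeasure μ] {h : K → E → ℝ} {C : ℝ}

lemma measurable_modelExponent (hm : ∀ k, Measurable (h k)) (a p g : K → ℝ) :
    Measurable (modelExponent h a p g) := by
  unfold modelExponent
  fun_prop

lemma measurable_modelExponent_uncurry {Ω : Type*} [MeasurableSpace Ω]
    (hm : ∀ k, Measurable (h k)) (a : K → ℝ) {p : Ω → K → ℝ} {g : Ω → K → ℝ} (hp : Measurable p)
    (hg : Measurable g) :
    Measurable (fun q : Ω × E => modelExponent h a (p q.1) (g q.1) q.2) := by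
  unfold modelExponent
  have h1 : ∀ k, Measurable fun ω => p ω k := fun k => measurable_pi_iff.1 hp k
  have h2 : ∀ k, Measurable fun ω => g ω k := fun k => measurable_pi_iff.1 hg k
  refine Finset.measurable_sum _ fun k _ => ?_
  have h3 : Measurable fun q : Ω × E => p q.1 k := (h1 k).comp measurable_fst
  have h4 : Measurable fun q : Ω × E => g q.1 k := (h2 k).comp measurable_fst
  have h5 : Measurable fun q : Ω × E => h k q.2 := (hm k).comp measurable_snd
  fun_prop

lemma measurable_modelPartition {Ω : Type*} [MeasurableSpace Ω]
    (hm : ∀ k, Measurable (h k)) (a : K → ℝ) {p : Ω → K → ℝ} {g : Ω → K → ℝ} (hp : Measurable p)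
    (hg : Measurable g) : Measurable (fun ω => modelPartition μ h a (p ω) (g ω)) := by
  have h1 : Measurable (fun q : Ω × E => Real.exp (modelExponent h a (p q.1) (g q.1) q.2)) :=
    (measurable_modelExponent_uncurry hm a hp hg).exp
  exact (h1.stronglyMeasurable.integral_prod_right' (ν := μ)).measurable

lemma measurable_gibbs {Ω : Type*} [MeasurableSpace Ω]
    (hm : ∀ k, Measurable (h k)) (a : K → ℝ) {p : Ω → K → ℝ} {g : Ω → K → ℝ} (hp : Measurable p)
    (hg : Measurable g) {f : E → ℝ} (hf : Measurable f) :
    Measurable (fun ω => gibbs μ h a (p ω) (g ω) f) := by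
  have h1 : Measurable (fun q : Ω × E =>
      f q.2 * Real.exp (modelExponent h a (p q.1) (g q.1) q.2)) :=
    (hf.comp measurable_snd).mul (measurable_modelExponent_uncurry hm a hp hg).exp
  exact (h1.stronglyMeasurable.integral_prod_right' (ν := μ)).measurable.div
    (measurable_modelPartition hm a hp hg)

omit [MeasurableSpace E] in
lemma abs_modelExponent_le {x : E} (hx : ∀ k, |h k x| ≤ C) (a p g : K → ℝ) :
    |modelExponent h a p g x|
      ≤ ∑ k, (|a k| * |g k| * C + |a k| ^ 2 * (|p k| * C + C ^ 2 / 2)) := by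
  refine (Finset.abs_sum_le_sum_abs _ _).trans (Finset.sum_le_sum fun k _ => ?_)
  refine (abs_add_le _ _).trans ?_
  have h1 := hx k
  have h0 : 0 ≤ C := (abs_nonneg _).trans h1
  rw [abs_mul, abs_mul, abs_mul, abs_pow]
  have h2 : |p k * h k x - h k x ^ 2 / 2| ≤ |p k| * C + C ^ 2 / 2 := by
    refine (abs_sub _ _).trans ?_
    rw [abs_mul, abs_div, abs_pow, abs_two]
    gcongr
  gcongr

omit [IsFiniteMeasure μ] in
lemma modelExponent_bound (hC : ∀ᵐ x ∂μ, ∀ k, |h k x| ≤ C) (a p g : K → ℝ) :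
    ∀ᵐ x ∂μ, |modelExponent h a p g x|
      ≤ ∑ k, (|a k| * |g k| * C + |a k| ^ 2 * (|p k| * C + C ^ 2 / 2)) :=
  hC.mono fun _ hx => abs_modelExponent_le hx a p g

lemma modelPartition_pos (hμ : μ ≠ 0) (hm : ∀ k, Measurable (h k))
    (hC : ∀ᵐ x ∂μ, ∀ k, |h k x| ≤ C) (a p g : K → ℝ) : 0 < modelPartition μ h a p g :=
  integral_exp_pos_of_bound hμ (measurable_modelExponent hm a p g) (modelExponent_bound hC a p g)

lemma integrable_mul_exp_modelExponent (hm : ∀ k, Measurable (h k))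
    (hC : ∀ᵐ x ∂μ, ∀ k, |h k x| ≤ C) (a p g : K → ℝ) {f : E → ℝ} {F : ℝ} (hf : Measurable f)
    (hfb : ∀ᵐ x ∂μ, |f x| ≤ F) :
    Integrable (fun x => f x * Real.exp (modelExponent h a p g x)) μ :=
  integrable_mul_exp_of_bound (measurable_modelExponent hm a p g) (modelExponent_bound hC a p g)
    hf hfb

lemma abs_gibbs_le (hμ : μ ≠ 0) (hm : ∀ k, Measurable (h k))
    (hC : ∀ᵐ x ∂μ, ∀ k, |h k x| ≤ C) (a p g : K → ℝ) {f : E → ℝ} {F : ℝ}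
    (hfb : ∀ᵐ x ∂μ, |f x| ≤ F) : |gibbs μ h a p g f| ≤ F := by
  have hp := modelPartition_pos hμ hm hC a p g
  rw [gibbs, abs_div, abs_of_pos hp, div_le_iff₀ hp, modelPartition, ← integral_const_mul]
  refine (abs_integral_le_integral_abs).trans ?_
  refine integral_mono_of_nonneg (Filter.Eventually.of_forall fun _ => abs_nonneg _)
    ((integrable_exp_of_bound (measurable_modelExponent hm a p g)
      (modelExponent_bound hC a p g)).const_mul F) (hfb.mono fun x hx => ?_)
  simp only [abs_mul, abs_of_pos (Real.exp_pos _)]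
  gcongr

lemma gibbs_mono (hμ : μ ≠ 0) (hm : ∀ k, Measurable (h k))
    (hC : ∀ᵐ x ∂μ, ∀ k, |h k x| ≤ C) (a p g : K → ℝ) {f f' : E → ℝ} {F F' : ℝ}
    (hf : Measurable f) (hf' : Measurable f')
    (hfb : ∀ᵐ x ∂μ, |f x| ≤ F) (hfb' : ∀ᵐ x ∂μ, |f' x| ≤ F') (hle : ∀ᵐ x ∂μ, f x ≤ f' x) :
    gibbs μ h a p g f ≤ gibbs μ h a p g f' := by
  have hp := modelPartition_pos hμ hm hC a p g
  refine div_le_div_of_nonneg_right ?_ hp.le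
  refine integral_mono_ae (integrable_mul_exp_modelExponent hm hC a p g hf hfb)
    (integrable_mul_exp_modelExponent hm hC a p g hf' hfb') (hle.mono fun x hx => ?_)
  exact mul_le_mul_of_nonneg_right hx (Real.exp_pos _).le

lemma gibbs_const (hμ : μ ≠ 0) (hm : ∀ k, Measurable (h k))
    (hC : ∀ᵐ x ∂μ, ∀ k, |h k x| ≤ C) (a p g : K → ℝ) (c : ℝ) :
    gibbs μ h a p g (fun _ => c) = c := by
  rw [gibbs, integral_const_mul]
  exact mul_div_cancel_right₀ _ (modelPartition_pos hμ hm hC a p g).ne'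

omit [IsFiniteMeasure μ] in
lemma gibbs_const_mul (a p g : K → ℝ) (c : ℝ) (f : E → ℝ) :
    gibbs μ h a p g (fun x => c * f x) = c * gibbs μ h a p g f := by
  simp_rw [gibbs, mul_assoc, integral_const_mul, mul_div_assoc]

lemma gibbs_sum {ι : Type*} (s : Finset ι) (hm : ∀ k, Measurable (h k))
    (hC : ∀ᵐ x ∂μ, ∀ k, |h k x| ≤ C) (a p g : K → ℝ) {f : ι → E → ℝ} {F : ι → ℝ}
    (hf : ∀ i, Measurable (f i)) (hfb : ∀ i, ∀ᵐ x ∂μ, |f i x| ≤ F i) :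
    gibbs μ h a p g (fun x => ∑ i ∈ s, f i x) = ∑ i ∈ s, gibbs μ h a p g (f i) := by
  simp_rw [gibbs, Finset.sum_mul]
  rw [integral_finsetSum _ fun i _ => integrable_mul_exp_modelExponent hm hC a p g (hf i) (hfb i),
    Finset.sum_div]

lemma gibbs_add (hm : ∀ k, Measurable (h k))
    (hC : ∀ᵐ x ∂μ, ∀ k, |h k x| ≤ C) (a p g : K → ℝ) {f f' : E → ℝ} {F F' : ℝ}
    (hf : Measurable f) (hf' : Measurable f')
    (hfb : ∀ᵐ x ∂μ, |f x| ≤ F) (hfb' : ∀ᵐ x ∂μ, |f' x| ≤ F') :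
    gibbs μ h a p g (fun x => f x + f' x) = gibbs μ h a p g f + gibbs μ h a p g f' := by
  simp_rw [gibbs, add_mul]
  rw [integral_add (integrable_mul_exp_modelExponent hm hC a p g hf hfb)
    (integrable_mul_exp_modelExponent hm hC a p g hf' hfb'), add_div]

lemma sq_gibbs_le (hμ : μ ≠ 0) (hm : ∀ k, Measurable (h k))
    (hC : ∀ᵐ x ∂μ, ∀ k, |h k x| ≤ C) (a p g : K → ℝ) {f : E → ℝ} {F : ℝ}
    (hf : Measurable f) (hfb : ∀ᵐ x ∂μ, |f x| ≤ F) :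
    gibbs μ h a p g f ^ 2 ≤ gibbs μ h a p g (fun x => f x ^ 2) := by
  set m := gibbs μ h a p g f with hmdef
  have hsq : ∀ᵐ x ∂μ, |f x ^ 2| ≤ F ^ 2 := hfb.mono fun x hx => by
    rw [abs_pow]; gcongr
  have h1 : gibbs μ h a p g (fun x => (2 * m) * f x + (-m ^ 2)) ≤
      gibbs μ h a p g (fun x => f x ^ 2) := by
    refine gibbs_mono (F := |2 * m| * F + |-m ^ 2|) hμ hm hC a p g (by fun_prop) (by fun_prop)
      (hfb.mono fun x hx => ?_) hsq (Filter.Eventually.of_forall fun x => ?_)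
    · refine (abs_add_le _ _).trans ?_
      rw [abs_mul]
      gcongr
    · nlinarith [sq_nonneg (f x - m)]
  rw [gibbs_add (F := |2 * m| * F) (F' := |-m ^ 2|) hm hC a p g (by fun_prop) (by fun_prop)
    (hfb.mono fun x hx => by rw [abs_mul]; gcongr) (by simp),
    gibbs_const hμ hm hC, gibbs_const_mul, ← hmdef] at h1
  nlinarith

end GaussianModel

section Interpolation

variable {K E : Type*} [Fintype K] [MeasurableSpace E]
variable {μ : Measure E} [IsFiniteMeasure μ] {h : K → E → ℝ} {C : ℝ}

omit [MeasurableSpace E] in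
lemma hasDerivAt_modelExponent_update [DecidableEq K] (a p g : K → ℝ) (k : K) (x : E) (s : ℝ) :
    HasDerivAt (fun s => modelExponent h a p (Function.update g k s) x) (a k * h k x) s := by
  have : ∀ s, modelExponent h a p (Function.update g k s) x
      = modelExponent h a p (Function.update g k 0) x + s * (a k * h k x) := fun s => by
    unfold modelExponent
    rw [← Finset.sum_erase_add _ _ (Finset.mem_univ k),
      ← Finset.sum_erase_add (s := Finset.univ) (a := k)
        (f := fun j => a j * Function.update g k 0 j * h j x
          + a j ^ 2 * (p j * h j x - h j x ^ 2 / 2)) (Finset.mem_univ k)]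
    have : ∀ j ∈ Finset.univ.erase k, a j * Function.update g k s j * h j x
          + a j ^ 2 * (p j * h j x - h j x ^ 2 / 2) = a j * Function.update g k 0 j * h j x
          + a j ^ 2 * (p j * h j x - h j x ^ 2 / 2) := fun j hj => by
      rw [Function.update_of_ne (Finset.ne_of_mem_erase hj),
        Function.update_of_ne (Finset.ne_of_mem_erase hj)]
    rw [Finset.sum_congr rfl this]
    simp only [Function.update_self]
    ring
  rw [funext this]
  simpa using ((hasDerivAt_id s).mul_const (a k * h k x)).const_add
    (modelExponent h a p (Function.update g k 0) x)

lemma hasDerivAt_integral_mul_exp_update [DecidableEq K] (hm : ∀ k, Measurable (h k))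
    (hC : ∀ᵐ x ∂μ, ∀ k, |h k x| ≤ C) (a p g : K → ℝ) (k : K) {f : E → ℝ} {F : ℝ}
    (hf : Measurable f) (hfb : ∀ᵐ x ∂μ, |f x| ≤ F) :
    HasDerivAt (fun s => ∫ x, f x * Real.exp (modelExponent h a p (Function.update g k s) x) ∂μ)
      (a k * ∫ x, f x * h k x * Real.exp (modelExponent h a p g x) ∂μ) (g k) := by
  set B : ℝ := ∑ j, (|a j| * (|g j| + 1) * C + |a j| ^ 2 * (|p j| * C + C ^ 2 / 2)) with hB
  have key := hasDerivAt_integral_mul_exp (μ := μ) (t₀ := g k) (M := max B (|a k| * C))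
    (u := fun s x => modelExponent h a p (Function.update g k s) x)
    (u' := fun _ x => a k * h k x) hf hfb (fun s => measurable_modelExponent hm _ _ _)
    (by have := hm k; fun_prop)
    (hC.mono fun x hx s hs => ⟨?_, ?_⟩) (fun x s => hasDerivAt_modelExponent_update _ _ _ _ _ _)
  · refine key.congr_deriv ?_
    rw [← integral_const_mul]
    congr 1
    ext x
    rw [Function.update_eq_self]
    ring
  · refine le_max_of_le_left ((abs_modelExponent_le hx _ _ _).trans ?_)
    have hC0 : 0 ≤ C := (abs_nonneg _).trans (hx k)
    refine Finset.sum_le_sum fun j _ => ?_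
    have : |Function.update g k s j| ≤ |g j| + 1 := by
      rcases eq_or_ne j k with rfl | hj
      · rw [Function.update_self]
        rw [Metric.mem_ball, Real.dist_eq] at hs
        have := abs_sub_abs_le_abs_sub s (g j)
        linarith
      · rw [Function.update_of_ne hj]
        linarith
    gcongr
  · refine le_max_of_le_right ?_
    rw [abs_mul]
    exact mul_le_mul_of_nonneg_left (hx k) (abs_nonneg _)

lemma hasDerivAt_gibbs_update [DecidableEq K] (hμ : μ ≠ 0) (hm : ∀ k, Measurable (h k))
    (hC : ∀ᵐ x ∂μ, ∀ k, |h k x| ≤ C) (a p g : K → ℝ) (k : K) :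
    HasDerivAt (fun s => gibbs μ h a p (Function.update g k s) (h k))
      (a k * (gibbs μ h a p g (fun x => h k x ^ 2) - gibbs μ h a p g (h k) ^ 2)) (g k) := by
  have h1 := hasDerivAt_integral_mul_exp_update hm hC a p g k (hm k) (hC.mono fun x hx => hx k)
  have h2 := hasDerivAt_integral_mul_exp_update (F := 1) hm hC a p g k
    (f := fun _ => 1) measurable_const (by simp)
  have hp := modelPartition_pos hμ hm hC a p g
  simp only [one_mul] at h2
  refine (h1.div h2 ?_).congr_deriv ?_
  · rw [Function.update_eq_self]
    exact hp.ne'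
  · simp only [Function.update_eq_self, gibbs, modelPartition] at hp ⊢
    field_simp

lemma integral_mul_gibbs (hμ : μ ≠ 0) (hm : ∀ k, Measurable (h k))
    (hC : ∀ᵐ x ∂μ, ∀ k, |h k x| ≤ C) (a p : K → ℝ) (k : K) :
    ∫ g, g k * gibbs μ h a p g (h k) ∂(Measure.pi fun _ : K => stdGauss)
      = ∫ g, a k * (gibbs μ h a p g (fun x => h k x ^ 2) - gibbs μ h a p g (h k) ^ 2)
        ∂(Measure.pi fun _ : K => stdGauss) := by
  classical
  have hsq : ∀ᵐ x ∂μ, |h k x ^ 2| ≤ C ^ 2 := hC.mono fun x hx => by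
    rw [abs_pow]; exact pow_le_pow_left₀ (abs_nonneg _) (hx k) 2
  have hb1 : ∀ g, |gibbs μ h a p g (h k)| ≤ C := fun g =>
    abs_gibbs_le hμ hm hC a p g (hC.mono fun x hx => hx k)
  have hb2 : ∀ g, |gibbs μ h a p g (fun x => h k x ^ 2)| ≤ C ^ 2 := fun g =>
    abs_gibbs_le hμ hm hC a p g hsq
  refine stdGauss_pi_integration_by_parts (C := max C (|a k| * (C ^ 2 + C ^ 2))) k
    (fun g => hasDerivAt_gibbs_update hμ hm hC a p g k)
    (measurable_gibbs hm a measurable_const measurable_id (hm k))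
    (((measurable_gibbs hm a measurable_const measurable_id ((hm k).pow_const 2)).sub
      ((measurable_gibbs hm a measurable_const measurable_id (hm k)).pow_const 2)).const_mul _)
    (fun g => le_max_of_le_left (hb1 g)) (fun g => le_max_of_le_right ?_)
  rw [abs_mul]
  refine mul_le_mul_of_nonneg_left ((abs_sub _ _).trans (add_le_add (hb2 g) ?_)) (abs_nonneg _)
  rw [abs_pow]
  exact pow_le_pow_left₀ (abs_nonneg _) (hb1 g) 2

lemma abs_log_modelPartition_le (hμ : μ ≠ 0) (hm : ∀ k, Measurable (h k))
    (hC : ∀ᵐ x ∂μ, ∀ k, |h k x| ≤ C) (a p g : K → ℝ) :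
    |Real.log (modelPartition μ h a p g)| ≤ |Real.log (μ.real Set.univ)|
      + ∑ k, (|a k| * |g k| * C + |a k| ^ 2 * (|p k| * C + C ^ 2 / 2)) := by
  have := abs_log_integral_exp_sub_le (u := modelExponent h a p g) (v := fun _ => 0) (N := 0)
    hμ (measurable_modelExponent hm a p g) measurable_const (modelExponent_bound hC a p g)
    (by simp) (by simpa using modelExponent_bound hC a p g)
  simp only [Real.exp_zero, integral_const, smul_eq_mul, mul_one] at this
  have h2 := abs_sub_abs_le_abs_sub (Real.log (modelPartition μ h a p g))
    (Real.log (μ.real Set.univ))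
  have h3 := h2.trans this
  simp only [sq_abs]
  linarith

lemma integrable_log_bound (L : ℝ) (a p : K → ℝ) :
    Integrable (fun g : K → ℝ => L
      + ∑ k, (|a k| * |g k| * C + |a k| ^ 2 * (|p k| * C + C ^ 2 / 2)))
      (Measure.pi fun _ : K => stdGauss) := by
  refine (integrable_const _).add (integrable_finsetSum _ fun k _ => ?_)
  have := ((measurePreserving_eval (fun _ : K => stdGauss) k).integrable_comp_of_integrable
      integrable_id_stdGauss).abs
  exact ((this.const_mul _).mul_const _).add (integrable_const _)

lemma integrable_log_modelPartition (hμ : μ ≠ 0) (hm : ∀ k, Measurable (h k))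
    (hC : ∀ᵐ x ∂μ, ∀ k, |h k x| ≤ C) (a p : K → ℝ) :
    Integrable (fun g => Real.log (modelPartition μ h a p g))
      (Measure.pi fun _ : K => stdGauss) :=
  (integrable_log_bound (C := C) |Real.log (μ.real Set.univ)| a p).mono'
    (measurable_modelPartition hm a measurable_const measurable_id).log.aestronglyMeasurable
    (Filter.Eventually.of_forall fun g => abs_log_modelPartition_le hμ hm hC a p g)

omit [MeasurableSpace E] in
lemma hasDerivAt_modelExponent_path {a a' : ℝ → K → ℝ}
    (ha : ∀ t k, HasDerivAt (fun t => a t k) (a' t k) t) (p g : K → ℝ) (x : E) (t : ℝ) :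
    HasDerivAt (fun t => modelExponent h (a t) p g x)
      (∑ k, (a' t k * g k * h k x + 2 * (a t k * a' t k) * (p k * h k x - h k x ^ 2 / 2))) t := by
  unfold modelExponent
  refine HasDerivAt.fun_sum fun k _ => ?_
  refine ((((ha t k).mul_const _).mul_const _).add (((ha t k).pow 2).mul_const _)).congr_deriv ?_
  ring

/-- Pathwise derivative of the log-partition function along a path of amplitudes. -/
noncomputable def pathDerivative (μ : Measure E) (h : K → E → ℝ) (a a' p g : K → ℝ) : ℝ :=
  ∑ k, (a' k * (g k * gibbs μ h a p g (h k))
    + 2 * (a k * a' k) * (p k * gibbs μ h a p g (h k) - gibbs μ h a p g (fun x => h k x ^ 2) / 2))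

lemma hasDerivAt_log_modelPartition (hμ : μ ≠ 0) (hm : ∀ k, Measurable (h k))
    (hC : ∀ᵐ x ∂μ, ∀ k, |h k x| ≤ C) {a a' : ℝ → K → ℝ} {A t₀ : ℝ}
    (ha : ∀ t k, HasDerivAt (fun t => a t k) (a' t k) t)
    (hA : ∀ t ∈ Metric.ball t₀ 1, ∀ k, |a t k| ≤ A ∧ |a' t k| ≤ A) (p g : K → ℝ) :
    HasDerivAt (fun t => Real.log (modelPartition μ h (a t) p g))
      (pathDerivative μ h (a t₀) (a' t₀) p g) t₀ := by
  set B : ℝ := ∑ k, (A * |g k| * C + 2 * A ^ 2 * (|p k| * C + C ^ 2 / 2)) with hB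
  have hsq : ∀ k, ∀ᵐ x ∂μ, |h k x ^ 2| ≤ C ^ 2 := fun k => hC.mono fun x hx => by
    rw [abs_pow]; exact pow_le_pow_left₀ (abs_nonneg _) (hx k) 2
  have hb1 : ∀ k, ∀ᵐ x ∂μ, |h k x| ≤ C := fun k => hC.mono fun x hx => hx k
  have key := hasDerivAt_integral_mul_exp (μ := μ) (t₀ := t₀) (M := B) (F := 1)
    (f := fun _ => 1) (u := fun t x => modelExponent h (a t) p g x)
    (u' := fun t x => ∑ k, (a' t k * g k * h k x
      + 2 * (a t k * a' t k) * (p k * h k x - h k x ^ 2 / 2)))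
    measurable_const (by simp) (fun s => measurable_modelExponent hm _ _ _)
    (by fun_prop) (hC.mono fun x hx s hs => ?_)
    (fun x s => hasDerivAt_modelExponent_path ha p g x s)
  · simp only [one_mul] at key
    have hp := modelPartition_pos hμ hm hC (a t₀) p g
    refine (key.log hp.ne').congr_deriv ?_
    have e : gibbs μ h (a t₀) p g (fun x => ∑ k, (a' t₀ k * g k * h k x
      + 2 * (a t₀ k * a' t₀ k) * (p k * h k x - h k x ^ 2 / 2)))
      = pathDerivative μ h (a t₀) (a' t₀) p g := by
      rw [gibbs_sum (f := fun k x => a' t₀ k * g k * h k x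
        + 2 * (a t₀ k * a' t₀ k) * (p k * h k x - h k x ^ 2 / 2)) (F := fun k => |a' t₀ k * g k| * C
        + |2 * (a t₀ k * a' t₀ k)| * (|p k| * C + C ^ 2 / 2)) _ hm hC]
      · refine Finset.sum_congr rfl fun k _ => ?_
        have e1 : (fun x => a' t₀ k * g k * h k x
            + 2 * (a t₀ k * a' t₀ k) * (p k * h k x - h k x ^ 2 / 2))
          = fun x => (a' t₀ k * g k + 2 * (a t₀ k * a' t₀ k) * p k) * h k x
            + (-(a t₀ k * a' t₀ k)) * h k x ^ 2 := by
          ext x; ring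
        rw [e1, gibbs_add (f := fun x => (a' t₀ k * g k + 2 * (a t₀ k * a' t₀ k) * p k) * h k x)
          (f' := fun x => (-(a t₀ k * a' t₀ k)) * h k x ^ 2) (F := |a' t₀ k * g k + 2 * (a t₀ k * a' t₀ k) * p k| * C)
          (F' := |-(a t₀ k * a' t₀ k)| * C ^ 2) hm hC, gibbs_const_mul, gibbs_const_mul]
        · ring
        · fun_prop
        · fun_prop
        · filter_upwards [hb1 k] with x hx
          rw [abs_mul]; gcongr
        · filter_upwards [hsq k] with x hx
          rw [abs_mul]; gcongr
      · intro k; fun_prop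
      · intro k
        filter_upwards [hb1 k, hsq k] with x hx hx2
        refine (abs_add_le _ _).trans ?_
        rw [abs_mul, abs_mul (2 * (a t₀ k * a' t₀ k))]
        have : |p k * h k x - h k x ^ 2 / 2| ≤ |p k| * C + C ^ 2 / 2 := by
          refine (abs_sub _ _).trans ?_
          rw [abs_mul, abs_div, abs_two]
          gcongr
        gcongr
    rw [← e]
    rfl
  · have hA' := hA s hs
    have bound : ∀ k, |a' s k * g k * h k x
        + 2 * (a s k * a' s k) * (p k * h k x - h k x ^ 2 / 2)|
        ≤ A * |g k| * C + 2 * A ^ 2 * (|p k| * C + C ^ 2 / 2) := fun k => by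
      have hC0 : 0 ≤ C := (abs_nonneg _).trans (hx k)
      have hA0 : 0 ≤ A := (abs_nonneg _).trans (hA' k).1
      have h1 := hx k
      obtain ⟨h2, h3⟩ := hA' k
      refine (abs_add_le _ _).trans ?_
      rw [abs_mul, abs_mul, abs_mul, abs_mul, abs_mul (a s k), abs_two, pow_two A]
      have : |p k * h k x - h k x ^ 2 / 2| ≤ |p k| * C + C ^ 2 / 2 := by
        refine (abs_sub _ _).trans ?_
        rw [abs_mul, abs_div, abs_two, abs_pow]
        gcongr
      gcongr
    refine ⟨(abs_modelExponent_le hx _ _ _).trans (Finset.sum_le_sum fun k _ => ?_),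
      (Finset.abs_sum_le_sum_abs _ _).trans (Finset.sum_le_sum fun k _ => bound k)⟩
    have hC0 : 0 ≤ C := (abs_nonneg _).trans (hx k)
    have hA0 : 0 ≤ A := (abs_nonneg _).trans (hA' k).1
    have h2 := (hA' k).1
    have : |a s k| ^ 2 ≤ 2 * A ^ 2 := by
      have : |a s k| ^ 2 ≤ A ^ 2 := by gcongr
      nlinarith [sq_nonneg A]
    gcongr

end Interpolation

section FreeEnergyDerivative

variable {K E : Type*} [Fintype K] [MeasurableSpace E]
variable {μ : Measure E} [IsFiniteMeasure μ] {h : K → E → ℝ} {C : ℝ}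

/-- Derivative of the noise-averaged log-partition function along a path of amplitudes. -/
noncomputable def freeEnergyDerivative (μ : Measure E) (h : K → E → ℝ) (a a' p : K → ℝ) : ℝ :=
  ∫ g, ∑ k, a k * a' k * (2 * p k * gibbs μ h a p g (h k) - gibbs μ h a p g (h k) ^ 2)
    ∂(Measure.pi fun _ : K => stdGauss)

omit [IsFiniteMeasure μ] in
lemma ae_abs_sq_le {f : E → ℝ} (hf : ∀ᵐ x ∂μ, |f x| ≤ C) : ∀ᵐ x ∂μ, |f x ^ 2| ≤ C ^ 2 :=
  hf.mono fun x hx => by rw [abs_pow]; exact pow_le_pow_left₀ (abs_nonneg _) hx 2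

lemma abs_pathDerivative_le (hμ : μ ≠ 0) (hm : ∀ k, Measurable (h k))
    (hC : ∀ᵐ x ∂μ, ∀ k, |h k x| ≤ C) {a a' : K → ℝ} {A : ℝ}
    (hA : ∀ k, |a k| ≤ A ∧ |a' k| ≤ A) (p g : K → ℝ) :
    |pathDerivative μ h a a' p g|
      ≤ ∑ k, (A * (|g k| * C) + 2 * (A * A) * (|p k| * C + C ^ 2 / 2)) := by
  refine (Finset.abs_sum_le_sum_abs _ _).trans (Finset.sum_le_sum fun k _ => ?_)
  have hk : ∀ᵐ x ∂μ, |h k x| ≤ C := hC.mono fun x hx => hx k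
  have b1 := abs_gibbs_le hμ hm hC a p g hk
  have b2 := abs_gibbs_le hμ hm hC a p g (ae_abs_sq_le hk)
  obtain ⟨h2, h3⟩ := hA k
  have hA0 : 0 ≤ A := (abs_nonneg _).trans h2
  refine (abs_add_le _ _).trans ?_
  rw [abs_mul, abs_mul, abs_mul, abs_mul, abs_mul (a k), abs_two]
  have : |p k * gibbs μ h a p g (h k) - gibbs μ h a p g (fun x => h k x ^ 2) / 2|
      ≤ |p k| * C + C ^ 2 / 2 := by
    refine (abs_sub _ _).trans ?_
    rw [abs_mul, abs_div, abs_two]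
    gcongr
  gcongr

lemma integrable_eval_mul_of_bound (k : K) {f : (K → ℝ) → ℝ} (hf : Measurable f) {B : ℝ}
    (hB : ∀ g, |f g| ≤ B) :
    Integrable (fun g => g k * f g) (Measure.pi fun _ : K => stdGauss) :=
  ((measurePreserving_eval (fun _ : K => stdGauss) k).integrable_comp_of_integrable
    integrable_id_stdGauss).mul_bdd (c := B) hf.aestronglyMeasurable
      (Filter.Eventually.of_forall hB)

lemma integrable_pi_of_bound {f : (K → ℝ) → ℝ} (hf : Measurable f) {B : ℝ}
    (hB : ∀ g, |f g| ≤ B) : Integrable f (Measure.pi fun _ : K => stdGauss) :=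
  Integrable.of_bound hf.aestronglyMeasurable B (Filter.Eventually.of_forall hB)

lemma integral_pathDerivative (hμ : μ ≠ 0) (hm : ∀ k, Measurable (h k))
    (hC : ∀ᵐ x ∂μ, ∀ k, |h k x| ≤ C) (a a' p : K → ℝ) :
    ∫ g, pathDerivative μ h a a' p g ∂(Measure.pi fun _ : K => stdGauss)
      = freeEnergyDerivative μ h a a' p := by
  have hk : ∀ k, ∀ᵐ x ∂μ, |h k x| ≤ C := fun k => hC.mono fun x hx => hx k
  have m1 : ∀ k, Measurable fun g => gibbs μ h a p g (h k) := fun k =>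
    measurable_gibbs hm a measurable_const measurable_id (hm k)
  have m2 : ∀ k, Measurable fun g => gibbs μ h a p g (fun x => h k x ^ 2) := fun k =>
    measurable_gibbs hm a measurable_const measurable_id ((hm k).pow_const 2)
  have b1 : ∀ k g, |gibbs μ h a p g (h k)| ≤ C := fun k g => abs_gibbs_le hμ hm hC a p g (hk k)
  have b2 : ∀ k g, |gibbs μ h a p g (fun x => h k x ^ 2)| ≤ C ^ 2 := fun k g =>
    abs_gibbs_le hμ hm hC a p g (ae_abs_sq_le (hk k))
  have i1 : ∀ k, Integrable (fun g => gibbs μ h a p g (h k)) (Measure.pi fun _ : K => stdGauss) :=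
    fun k => integrable_pi_of_bound (m1 k) (b1 k)
  have i2 : ∀ k, Integrable (fun g => gibbs μ h a p g (fun x => h k x ^ 2))
      (Measure.pi fun _ : K => stdGauss) := fun k => integrable_pi_of_bound (m2 k) (b2 k)
  have i3 : ∀ k, Integrable (fun g => gibbs μ h a p g (h k) ^ 2)
      (Measure.pi fun _ : K => stdGauss) := fun k =>
    integrable_pi_of_bound (B := C ^ 2) ((m1 k).pow_const 2) fun g => by
      rw [abs_pow]; exact pow_le_pow_left₀ (abs_nonneg _) (b1 k g) 2
  have i4 : ∀ k, Integrable (fun g => g k * gibbs μ h a p g (h k))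
      (Measure.pi fun _ : K => stdGauss) := fun k => integrable_eval_mul_of_bound k (m1 k) (b1 k)
  unfold pathDerivative freeEnergyDerivative
  have i5 : ∀ k, Integrable (fun g => 2 * (a k * a' k) *
      (p k * gibbs μ h a p g (h k) - gibbs μ h a p g (fun x => h k x ^ 2) / 2))
      (Measure.pi fun _ : K => stdGauss) := fun k =>
    (((i1 k).const_mul _).sub ((i2 k).div_const 2)).const_mul _
  have i6 : ∀ k, Integrable (fun g => a' k * (g k * gibbs μ h a p g (h k)) + 2 * (a k * a' k) *
      (p k * gibbs μ h a p g (h k) - gibbs μ h a p g (fun x => h k x ^ 2) / 2))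
      (Measure.pi fun _ : K => stdGauss) := fun k => ((i4 k).const_mul (a' k)).add (i5 k)
  have i7 : ∀ k, Integrable (fun g => a k * a' k *
      (2 * p k * gibbs μ h a p g (h k) - gibbs μ h a p g (h k) ^ 2))
      (Measure.pi fun _ : K => stdGauss) := fun k =>
    (((i1 k).const_mul (2 * p k)).sub (i3 k)).const_mul _
  rw [integral_finsetSum _ fun k _ => i6 k, integral_finsetSum _ fun k _ => i7 k]
  refine Finset.sum_congr rfl fun k _ => ?_
  rw [integral_add ((i4 k).const_mul (a' k)) (i5 k), integral_const_mul,
    integral_mul_gibbs hμ hm hC, ← integral_const_mul,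
    ← integral_add (f := fun g => a' k * (a k * (gibbs μ h a p g (fun x => h k x ^ 2)
      - gibbs μ h a p g (h k) ^ 2)))
      (((((i2 k).sub (i3 k))).const_mul (a k)).const_mul (a' k)) (i5 k)]
  refine integral_congr_ae (Filter.Eventually.of_forall fun g => ?_)
  simp only
  ring

lemma hasDerivAt_modelFreeEnergy (hμ : μ ≠ 0) (hm : ∀ k, Measurable (h k))
    (hC : ∀ᵐ x ∂μ, ∀ k, |h k x| ≤ C) {a a' : ℝ → K → ℝ} {A : ℝ}
    (ha : ∀ t k, HasDerivAt (fun t => a t k) (a' t k) t) (t₀ : ℝ)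
    (hA : ∀ t ∈ Metric.ball t₀ 2, ∀ k, |a t k| ≤ A ∧ |a' t k| ≤ A) (p : K → ℝ) :
    HasDerivAt (fun t => modelFreeEnergy μ h (a t) p)
      (freeEnergyDerivative μ h (a t₀) (a' t₀) p) t₀ := by
  have hball : ∀ t ∈ Metric.ball t₀ 1, ∀ s ∈ Metric.ball t 1, ∀ k, |a s k| ≤ A ∧ |a' s k| ≤ A := by
    intro t ht s hs
    refine hA s ?_
    rw [Metric.mem_ball] at *
    linarith [dist_triangle s t t₀]
  rw [← integral_pathDerivative hμ hm hC]
  have m1 : ∀ t, Measurable fun g => pathDerivative μ h (a t) (a' t) p g := fun t => by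
    unfold pathDerivative
    refine Finset.measurable_sum _ fun k _ => ?_
    have := measurable_gibbs (μ := μ) hm (a t) (p := fun _ => p) (g := fun g => g) measurable_const
      measurable_id (hm k)
    have h2 := measurable_gibbs (μ := μ) hm (a t) (p := fun _ => p) (g := fun g => g)
      measurable_const measurable_id ((hm k).pow_const 2)
    fun_prop
  refine (hasDerivAt_integral_of_dominated_loc_of_deriv_le
    (bound := fun g => ∑ k, (A * (|g k| * C) + 2 * (A * A) * (|p k| * C + C ^ 2 / 2)))
    (F := fun t g => Real.log (modelPartition μ h (a t) p g))
    (F' := fun t g => pathDerivative μ h (a t) (a' t) p g)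
    (Metric.ball_mem_nhds t₀ one_pos) ?_ ?_ ?_ ?_ ?_ ?_).2
  · exact Filter.Eventually.of_forall fun t =>
      (measurable_modelPartition hm (a t) measurable_const
        measurable_id).log.aestronglyMeasurable
  · exact integrable_log_modelPartition hμ hm hC _ _
  · exact (m1 t₀).aestronglyMeasurable
  · exact Filter.Eventually.of_forall fun g t ht =>
      abs_pathDerivative_le hμ hm hC (hball t ht t (Metric.mem_ball_self one_pos)) p g
  · refine integrable_finsetSum _ fun k _ => ?_
    have := ((measurePreserving_eval (fun _ : K => stdGauss) k).integrable_comp_of_integrable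
      integrable_id_stdGauss).abs
    exact ((this.mul_const _).const_mul _).add (integrable_const _)
  · exact Filter.Eventually.of_forall fun g t ht =>
      hasDerivAt_log_modelPartition hμ hm hC ha (hball t ht) p g

lemma abs_freeEnergyDerivative_le (hμ : μ ≠ 0) (hm : ∀ k, Measurable (h k))
    (hC : ∀ᵐ x ∂μ, ∀ k, |h k x| ≤ C) {a a' : K → ℝ} {A : ℝ}
    (hA : ∀ k, |a k| ≤ A ∧ |a' k| ≤ A) {p : K → ℝ} {P : ℝ} (hp : ∀ k, |p k| ≤ P) :
    |freeEnergyDerivative μ h a a' p| ≤ ∑ _k : K, A * A * (2 * P * C + C ^ 2) := by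
  have key : ∀ g, ‖∑ k, a k * a' k * (2 * p k * gibbs μ h a p g (h k) - gibbs μ h a p g (h k) ^ 2)‖
      ≤ ∑ _k : K, A * A * (2 * P * C + C ^ 2) := fun g => by
    refine (norm_sum_le _ _).trans (Finset.sum_le_sum fun k _ => ?_)
    have b1 := abs_gibbs_le hμ hm hC a p g (hC.mono fun x hx => hx k)
    obtain ⟨h2, h3⟩ := hA k
    have h4 := hp k
    have hA0 : 0 ≤ A := (abs_nonneg _).trans h2
    have hP0 : 0 ≤ P := (abs_nonneg _).trans h4
    rw [Real.norm_eq_abs, abs_mul, abs_mul]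
    have : |2 * p k * gibbs μ h a p g (h k) - gibbs μ h a p g (h k) ^ 2|
        ≤ 2 * P * C + C ^ 2 := by
      refine (abs_sub _ _).trans ?_
      rw [abs_mul, abs_mul, abs_two, abs_pow]
      gcongr
    gcongr
  have := norm_integral_le_of_norm_le_const (μ := Measure.pi fun _ : K => stdGauss)
    (Filter.Eventually.of_forall key)
  rw [freeEnergyDerivative]
  simpa using this

variable {Ω : Type*} [MeasurableSpace Ω] {ν : Measure Ω} [IsProbabilityMeasure ν]

lemma measurable_modelFreeEnergy (hm : ∀ k, Measurable (h k)) (a : K → ℝ)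
    {p : Ω → K → ℝ} (hp : Measurable p) : Measurable fun ω => modelFreeEnergy μ h a (p ω) :=
  ((measurable_modelPartition (μ := μ) (Ω := Ω × (K → ℝ)) hm a (hp.comp measurable_fst)
    measurable_snd).log.stronglyMeasurable.integral_prod_right'
      (ν := Measure.pi fun _ : K => stdGauss)).measurable

lemma measurable_freeEnergyDerivative (hm : ∀ k, Measurable (h k)) (a a' : K → ℝ)
    {p : Ω → K → ℝ} (hp : Measurable p) :
    Measurable fun ω => freeEnergyDerivative μ h a a' (p ω) := by
  have : Measurable fun q : Ω × (K → ℝ) => ∑ k, a k * a' k *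
      (2 * p q.1 k * gibbs μ h a (p q.1) q.2 (h k) - gibbs μ h a (p q.1) q.2 (h k) ^ 2) := by
    refine Finset.measurable_sum _ fun k _ => ?_
    have h1 := measurable_gibbs (μ := μ) (Ω := Ω × (K → ℝ)) hm a (hp.comp measurable_fst)
      measurable_snd (hm k)
    have h2 : Measurable fun q : Ω × (K → ℝ) => p q.1 k :=
      (measurable_pi_iff.1 hp k).comp measurable_fst
    exact ((h2.const_mul 2).mul h1 |>.sub (h1.pow_const 2)).const_mul _
  exact (this.stronglyMeasurable.integral_prod_right'
    (ν := Measure.pi fun _ : K => stdGauss)).measurable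

lemma abs_modelFreeEnergy_le (hμ : μ ≠ 0) (hm : ∀ k, Measurable (h k))
    (hC : ∀ᵐ x ∂μ, ∀ k, |h k x| ≤ C) (hC0 : 0 ≤ C) (a : K → ℝ) {P : ℝ} {p : K → ℝ}
    (hp : ∀ k, |p k| ≤ P) :
    |modelFreeEnergy μ h a p| ≤ ∫ g, (|Real.log (μ.real Set.univ)|
      + ∑ k, (|a k| * |g k| * C + |a k| ^ 2 * (|P| * C + C ^ 2 / 2)))
        ∂(Measure.pi fun _ : K => stdGauss) := by
  refine (abs_integral_le_integral_abs).trans (integral_mono_of_nonneg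
    (Filter.Eventually.of_forall fun _ => abs_nonneg _) (integrable_log_bound _ a fun _ => P)
    (Filter.Eventually.of_forall fun g => (abs_log_modelPartition_le hμ hm hC a p g).trans ?_))
  have : ∀ k, |p k| ≤ |P| := fun k => (hp k).trans (le_abs_self P)
  simp only
  generalize |P| = Q at this
  gcongr
  exact this _

lemma integrable_modelFreeEnergy (hμ : μ ≠ 0) (hm : ∀ k, Measurable (h k))
    (hC : ∀ᵐ x ∂μ, ∀ k, |h k x| ≤ C) (hC0 : 0 ≤ C) (a : K → ℝ) {p : Ω → K → ℝ}
    (hp : Measurable p) {P : ℝ} (hpb : ∀ᵐ ω ∂ν, ∀ k, |p ω k| ≤ P) :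
    Integrable (fun ω => modelFreeEnergy μ h a (p ω)) ν :=
  Integrable.of_bound (measurable_modelFreeEnergy hm a hp).aestronglyMeasurable _
    (hpb.mono fun _ hω => abs_modelFreeEnergy_le hμ hm hC hC0 a hω)

lemma hasDerivAt_integral_modelFreeEnergy (hμ : μ ≠ 0) (hm : ∀ k, Measurable (h k))
    (hC : ∀ᵐ x ∂μ, ∀ k, |h k x| ≤ C) (hC0 : 0 ≤ C) {a a' : ℝ → K → ℝ} {A : ℝ}
    (ha : ∀ t k, HasDerivAt (fun t => a t k) (a' t k) t) (t₀ : ℝ)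
    (hA : ∀ t ∈ Metric.ball t₀ 3, ∀ k, |a t k| ≤ A ∧ |a' t k| ≤ A)
    {p : Ω → K → ℝ} (hp : Measurable p) {P : ℝ} (hpb : ∀ᵐ ω ∂ν, ∀ k, |p ω k| ≤ P) :
    HasDerivAt (fun t => ∫ ω, modelFreeEnergy μ h (a t) (p ω) ∂ν)
      (∫ ω, freeEnergyDerivative μ h (a t₀) (a' t₀) (p ω) ∂ν) t₀ := by
  have hball : ∀ t ∈ Metric.ball t₀ 1, ∀ s ∈ Metric.ball t 2, ∀ k, |a s k| ≤ A ∧ |a' s k| ≤ A := by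
    intro t ht s hs
    refine hA s ?_
    rw [Metric.mem_ball] at *
    linarith [dist_triangle s t t₀]
  refine (hasDerivAt_integral_of_dominated_loc_of_deriv_le
    (bound := fun _ => ∑ _k : K, A * A * (2 * P * C + C ^ 2))
    (F := fun t ω => modelFreeEnergy μ h (a t) (p ω))
    (F' := fun t ω => freeEnergyDerivative μ h (a t) (a' t) (p ω))
    (Metric.ball_mem_nhds t₀ one_pos) ?_ ?_ ?_ ?_ (integrable_const _) ?_).2
  · exact Filter.Eventually.of_forall fun t =>
      (measurable_modelFreeEnergy hm _ hp).aestronglyMeasurable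
  · exact integrable_modelFreeEnergy hμ hm hC hC0 _ hp hpb
  · exact (measurable_freeEnergyDerivative hm _ _ hp).aestronglyMeasurable
  · exact hpb.mono fun ω hω t ht => abs_freeEnergyDerivative_le hμ hm hC
      (hball t ht t (Metric.mem_ball_self two_pos)) hω
  · exact Filter.Eventually.of_forall fun ω t ht =>
      hasDerivAt_modelFreeEnergy hμ hm hC ha t (hball t ht) (p ω)

end FreeEnergyDerivative

section Nishimori

variable {K E : Type*} [Fintype K] [MeasurableSpace E]
variable {μ : Measure E} {h : K → E → ℝ} {C : ℝ}

omit [MeasurableSpace E] in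
lemma modelExponent_eq_shift (a p g : K → ℝ) (x : E) :
    modelExponent h a p g x = modelExponent h a 0 (g + fun k => a k * p k) x := by
  unfold modelExponent
  refine Finset.sum_congr rfl fun k _ => ?_
  simp only [Pi.add_apply, Pi.zero_apply]
  ring

lemma modelPartition_eq_shift (a p g : K → ℝ) :
    modelPartition μ h a p g = modelPartition μ h a 0 (g + fun k => a k * p k) := by
  simp_rw [modelPartition, modelExponent_eq_shift a p g]

lemma gibbs_eq_shift (a p g : K → ℝ) (f : E → ℝ) :
    gibbs μ h a p g f = gibbs μ h a 0 (g + fun k => a k * p k) f := by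
  simp_rw [gibbs, modelPartition_eq_shift a p g, modelExponent_eq_shift a p g]

omit [MeasurableSpace E] in
lemma abs_modelExponent_zero_le (hC0 : 0 ≤ C) (a g : K → ℝ) {x : E} (hx : ∀ k, |h k x| ≤ C) :
    |modelExponent h a 0 g x| ≤ ((∑ k, |a k|) * C) * (∑ k, |g k|) + ∑ k, |a k| ^ 2 * (C ^ 2 / 2) := by
  refine (abs_modelExponent_le hx a 0 g).trans ?_
  rw [Finset.sum_add_distrib]
  simp only [Pi.zero_apply, abs_zero, zero_mul, zero_add]
  gcongr
  rw [mul_right_comm, Finset.sum_mul, Finset.sum_mul]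
  refine Finset.sum_le_sum fun k _ => ?_
  gcongr
  exact Finset.single_le_sum (f := fun k => |g k|) (fun _ _ => abs_nonneg _) (Finset.mem_univ k)

variable [IsProbabilityMeasure μ]

lemma integral_planted_shift (hm : ∀ k, Measurable (h k))
    (hC : ∀ᵐ x ∂μ, ∀ k, |h k x| ≤ C) (hC0 : 0 ≤ C) (a : K → ℝ) {w : E → ℝ} (hw : Measurable w)
    {W : ℝ} (hwb : ∀ᵐ x ∂μ, |w x| ≤ W) {f : (K → ℝ) → ℝ} (hf : Measurable f) {B c : ℝ}
    (hfb : ∀ g, |f g| ≤ B * Real.exp (c * ∑ k, |g k|)) :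
    ∫ X, w X * (∫ g, f (g + fun k => a k * h k X) ∂(Measure.pi fun _ : K => stdGauss)) ∂μ
      = ∫ g, f g * (∫ X, w X * Real.exp (modelExponent h a 0 g X) ∂μ)
        ∂(Measure.pi fun _ : K => stdGauss) := by
  have e1 : ∀ X, w X * (∫ g, f (g + fun k => a k * h k X) ∂(Measure.pi fun _ : K => stdGauss))
      = ∫ g, f g * (w X * Real.exp (modelExponent h a 0 g X))
        ∂(Measure.pi fun _ : K => stdGauss) := fun X => by
    rw [integral_stdGauss_pi_add (fun k => a k * h k X) f, ← integral_const_mul]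
    refine integral_congr_ae (Filter.Eventually.of_forall fun g => ?_)
    have : (∑ k, (a k * h k X * g k - (a k * h k X) ^ 2 / 2)) = modelExponent h a 0 g X := by
      unfold modelExponent
      refine Finset.sum_congr rfl fun k _ => ?_
      simp only [Pi.zero_apply]
      ring
    simp only [this]
    ring
  simp_rw [e1]
  rw [integral_integral_swap]
  · simp_rw [integral_const_mul]
  · set d := (∑ k, |a k|) * C
    set D := ∑ k, |a k| ^ 2 * (C ^ 2 / 2)
    have hint : Integrable (fun q : E × (K → ℝ) =>
        B * W * Real.exp D * Real.exp ((c + d) * ∑ k, |q.2 k|))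
        (μ.prod (Measure.pi fun _ : K => stdGauss)) :=
      ((integrable_exp_sum_abs_stdGauss (K := K) (c + d)).comp_snd μ).const_mul _
    have hM : Measurable fun q : E × (K → ℝ) => modelExponent h a 0 q.2 q.1 := by
      have := measurable_modelExponent_uncurry (Ω := K → ℝ) hm a (p := fun _ => 0)
        measurable_const measurable_id
      exact this.comp measurable_swap
    refine hint.mono' ?_ ?_
    · exact ((hf.comp measurable_snd).mul
        ((hw.comp measurable_fst).mul hM.exp)).aestronglyMeasurable
    · have : ∀ᵐ q ∂(μ.prod (Measure.pi fun _ : K => stdGauss)),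
          |w q.1| ≤ W ∧ ∀ k, |h k q.1| ≤ C :=
        Measure.quasiMeasurePreserving_fst.ae (hwb.and hC)
      filter_upwards [this] with q hq
      simp only [Function.uncurry, norm_mul, Real.norm_eq_abs, Real.abs_exp]
      have h1 := le_of_abs_le (abs_modelExponent_zero_le hC0 a q.2 hq.2)
      have hB : 0 ≤ B := by
        have := (abs_nonneg _).trans (hfb 0)
        simpa using this
      have hW : 0 ≤ W := (abs_nonneg _).trans hq.1
      calc |f q.2| * (|w q.1| * Real.exp (modelExponent h a 0 q.2 q.1))
          ≤ (B * Real.exp (c * ∑ k, |q.2 k|)) * (W * Real.exp (d * ∑ k, |q.2 k| + D)) := by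
            have := hfb q.2
            have := hq.1
            gcongr
        _ = _ := by
            rw [add_mul, Real.exp_add, Real.exp_add]
            ring

lemma mul_exp_eq_gibbs_mul (hm : ∀ k, Measurable (h k))
    (hC : ∀ᵐ x ∂μ, ∀ k, |h k x| ≤ C) (a g : K → ℝ) (f : E → ℝ) :
    ∫ x, f x * Real.exp (modelExponent h a 0 g x) ∂μ
      = gibbs μ h a 0 g f * modelPartition μ h a 0 g := by
  rw [gibbs, div_mul_cancel₀ _ (modelPartition_pos (NeZero.ne μ) hm hC a 0 g).ne']

/-- Nishimori identity: the overlap with the planted signal has the law of the overlap of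
two replicas. -/
lemma nishimori (hm : ∀ k, Measurable (h k)) (hC : ∀ᵐ x ∂μ, ∀ k, |h k x| ≤ C) (hC0 : 0 ≤ C)
    (a : K → ℝ) {f : E → ℝ} (hf : Measurable f) {F : ℝ} (hfb : ∀ᵐ x ∂μ, |f x| ≤ F) :
    ∫ X, f X * (∫ g, gibbs μ h a (fun k => h k X) g f ∂(Measure.pi fun _ : K => stdGauss)) ∂μ
      = ∫ X, (∫ g, gibbs μ h a (fun k => h k X) g f ^ 2 ∂(Measure.pi fun _ : K => stdGauss)) ∂μ := by
  have hμ : μ ≠ 0 := NeZero.ne μ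
  have hb : ∀ g, |gibbs μ h a 0 g f| ≤ F := fun g => abs_gibbs_le hμ hm hC a 0 g hfb
  have hmeas : Measurable fun g => gibbs μ h a 0 g f :=
    measurable_gibbs hm a measurable_const measurable_id hf
  have h1 := integral_planted_shift hm hC hC0 a hf hfb hmeas (B := F) (c := 0) (by simpa using hb)
  have h2 := integral_planted_shift hm hC hC0 a (w := fun _ => 1) (W := 1) measurable_const
    (by simp) (hmeas.pow_const 2) (B := F ^ 2) (c := 0) (fun g => by
      rw [abs_pow]; simpa using pow_le_pow_left₀ (abs_nonneg _) (hb g) 2)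
  simp only [one_mul] at h2
  simp_rw [gibbs_eq_shift (μ := μ) (h := h) a (fun k => h k _)]
  rw [h1, h2]
  refine integral_congr_ae (Filter.Eventually.of_forall fun g => ?_)
  simp only
  rw [mul_exp_eq_gibbs_mul hm hC]
  simp only [modelPartition]
  ring

lemma abs_log_modelPartition_zero_le (hm : ∀ k, Measurable (h k))
    (hC : ∀ᵐ x ∂μ, ∀ k, |h k x| ≤ C) (hC0 : 0 ≤ C) (a g : K → ℝ) :
    |Real.log (modelPartition μ h a 0 g)|
      ≤ ((∑ k, |a k|) * C) * (∑ k, |g k|) + ∑ k, |a k| ^ 2 * (C ^ 2 / 2) := by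
  have := abs_log_integral_exp_sub_le (μ := μ) (u := modelExponent h a 0 g) (v := fun _ => 0)
    (N := 0) (NeZero.ne μ) (measurable_modelExponent hm a 0 g) measurable_const
    (hC.mono fun x hx => abs_modelExponent_zero_le hC0 a g hx) (by simp)
    (by simpa using hC.mono fun x hx => abs_modelExponent_zero_le hC0 a g hx)
  simpa [modelPartition] using this

/-- Flipping the sign of the planted signal decreases the mean log-partition function. -/
lemma integral_modelFreeEnergy_neg_le (hm : ∀ k, Measurable (h k))
    (hC : ∀ᵐ x ∂μ, ∀ k, |h k x| ≤ C) (hC0 : 0 ≤ C) (a : K → ℝ) :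
    ∫ X, modelFreeEnergy μ h a (fun k => -h k X) ∂μ
      ≤ ∫ X, modelFreeEnergy μ h a (fun k => h k X) ∂μ := by
  have hμ : μ ≠ 0 := NeZero.ne μ
  set M : (K → ℝ) → ℝ := fun g => modelPartition μ h a 0 g with hMdef
  have hMm : Measurable M := measurable_modelPartition hm a measurable_const measurable_id
  have hMpos : ∀ g, 0 < M g := fun g => modelPartition_pos hμ hm hC a 0 g
  set d := (∑ k, |a k|) * C
  set D := ∑ k, |a k| ^ 2 * (C ^ 2 / 2)
  have hlog : ∀ g, |Real.log (M g)| ≤ d * (∑ k, |g k|) + D := fun g =>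
    abs_log_modelPartition_zero_le hm hC hC0 a g
  have hlogexp : ∀ g, |Real.log (M g)| ≤ Real.exp D * Real.exp (d * ∑ k, |g k|) := fun g => by
    rw [← Real.exp_add, add_comm]
    have := Real.add_one_le_exp (d * (∑ k, |g k|) + D)
    linarith [hlog g]
  have hneg : ∀ g : K → ℝ, ∑ k, |(-g) k| = ∑ k, |g k| := fun g => by simp
  have hMle : ∀ g, M g ≤ Real.exp D * Real.exp (d * ∑ k, |g k|) := fun g => by
    rw [← Real.exp_log (hMpos g), ← Real.exp_add]
    exact Real.exp_le_exp.2 (by linarith [le_of_abs_le (hlog g)])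
  have key : ∀ f : (K → ℝ) → ℝ, Measurable f →
      (∀ g, |f g| ≤ Real.exp D * Real.exp (d * ∑ k, |g k|)) →
      ∫ X, (∫ g, f (g + fun k => a k * h k X) ∂(Measure.pi fun _ : K => stdGauss)) ∂μ
        = ∫ g, f g * M g ∂(Measure.pi fun _ : K => stdGauss) := fun f hf hfb => by
    have := integral_planted_shift hm hC hC0 a (w := fun _ => 1) (W := 1) measurable_const
      (by simp) hf hfb
    simp only [one_mul] at this
    exact this
  have e1 : ∫ X, modelFreeEnergy μ h a (fun k => h k X) ∂μ
      = ∫ g, Real.log (M g) * M g ∂(Measure.pi fun _ : K => stdGauss) := by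
    rw [← key _ hMm.log hlogexp]
    simp_rw [modelFreeEnergy, modelPartition_eq_shift (μ := μ) (h := h) a (fun k => h k _)]
    rfl
  have e2 : ∫ X, modelFreeEnergy μ h a (fun k => -h k X) ∂μ
      = ∫ g, Real.log (M (-g)) * M g ∂(Measure.pi fun _ : K => stdGauss) := by
    rw [← key (fun g => Real.log (M (-g))) (hMm.comp measurable_neg).log
      (fun g => (hlogexp (-g)).trans_eq (by rw [hneg]))]
    refine integral_congr_ae (Filter.Eventually.of_forall fun X => ?_)
    simp only [modelFreeEnergy]
    rw [← integral_stdGauss_pi_neg]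
    refine integral_congr_ae (Filter.Eventually.of_forall fun g => ?_)
    simp only
    rw [modelPartition_eq_shift]
    congr 2
    ext k
    simp only [Pi.add_apply, Pi.neg_apply]
    ring
  have hexp := integrable_exp_sum_abs_stdGauss (K := K) d
  have hexp2 := integrable_exp_sum_abs_stdGauss (K := K) (d + d)
  have i1 : Integrable M (Measure.pi fun _ : K => stdGauss) :=
    (hexp.const_mul (Real.exp D)).mono' hMm.aestronglyMeasurable
      (Filter.Eventually.of_forall fun g => by
        rw [Real.norm_of_nonneg (hMpos g).le]; exact hMle g)
  have i2 : Integrable (fun g => M (-g)) (Measure.pi fun _ : K => stdGauss) :=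
    (hexp.const_mul (Real.exp D)).mono' (hMm.comp measurable_neg).aestronglyMeasurable
      (Filter.Eventually.of_forall fun g => by
        rw [Real.norm_of_nonneg (hMpos _).le]; exact (hMle _).trans_eq (by rw [hneg]))
  have i34 : ∀ f : (K → ℝ) → ℝ, Measurable f →
      (∀ g, |f g| ≤ Real.exp D * Real.exp (d * ∑ k, |g k|)) →
      Integrable (fun g => f g * M g) (Measure.pi fun _ : K => stdGauss) := fun f hf hfb => by
    refine (hexp2.const_mul (Real.exp D * Real.exp D)).mono' (hf.mul hMm).aestronglyMeasurable
      (Filter.Eventually.of_forall fun g => ?_)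
    rw [norm_mul, Real.norm_of_nonneg (hMpos g).le, Real.norm_eq_abs, add_mul, Real.exp_add]
    calc |f g| * M g ≤ (Real.exp D * Real.exp (d * ∑ k, |g k|))
          * (Real.exp D * Real.exp (d * ∑ k, |g k|)) :=
          mul_le_mul (hfb g) (hMle g) (hMpos g).le (by positivity)
      _ = _ := by ring
  have i3 := i34 _ hMm.log hlogexp
  have i4 := i34 (fun g => Real.log (M (-g))) (hMm.comp measurable_neg).log
      (fun g => (hlogexp (-g)).trans_eq (by rw [hneg]))
  rw [e1, e2]
  have hle : ∫ g, Real.log (M (-g)) * M g ∂(Measure.pi fun _ : K => stdGauss)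
      ≤ ∫ g, (Real.log (M g) * M g + (M (-g) - M g)) ∂(Measure.pi fun _ : K => stdGauss) := by
    refine integral_mono i4 (i3.add (i2.sub i1)) fun g => ?_
    simp only
    have h1 := Real.log_le_sub_one_of_pos (div_pos (hMpos (-g)) (hMpos g))
    rw [Real.log_div (hMpos _).ne' (hMpos _).ne'] at h1
    have h2 := mul_le_mul_of_nonneg_right h1 (hMpos g).le
    have h3 : (M (-g) / M g - 1) * M g = M (-g) - M g := by
      have := (hMpos g).ne'
      field_simp
    rw [h3] at h2
    linarith
  have i5 : Integrable (fun g => M (-g) - M g) (Measure.pi fun _ : K => stdGauss) := i2.sub i1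
  rw [integral_add i3 i5, integral_sub i2 i1, integral_stdGauss_pi_neg M] at hle
  linarith

end Nishimori

section EfronStein

lemma integral_sub_sq_eq {E : Type*} [MeasurableSpace E] {μ : Measure E} [IsProbabilityMeasure μ]
    {g : E → ℝ} (hg : MemLp g 2 μ) (m : ℝ) :
    ∫ x, (g x - m) ^ 2 ∂μ = ∫ x, (g x - ∫ y, g y ∂μ) ^ 2 ∂μ + ((∫ y, g y ∂μ) - m) ^ 2 := by
  have i1 : Integrable g μ := hg.integrable (by norm_num)
  have i2 : Integrable (fun x => g x ^ 2) μ := hg.integrable_sq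
  have key : ∀ c : ℝ, ∫ x, (g x - c) ^ 2 ∂μ
      = ∫ x, g x ^ 2 ∂μ - 2 * c * (∫ x, g x ∂μ) + c ^ 2 := fun c => by
    have e : ∀ x, (g x - c) ^ 2 = g x ^ 2 - 2 * c * g x + c ^ 2 := fun x => by ring
    have i3 : Integrable (fun x => g x ^ 2 - 2 * c * g x) μ := i2.sub (i1.const_mul _)
    simp_rw [e]
    rw [integral_add i3 (integrable_const _), integral_sub i2 (i1.const_mul _),
      integral_const_mul]
    simp
  rw [key, key]
  ring

lemma integral_abs_sub_le_sqrt {E : Type*} [MeasurableSpace E] {μ : Measure E}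
    [IsProbabilityMeasure μ] {g : E → ℝ} (hg : MemLp g 2 μ) (m : ℝ) {v : ℝ}
    (hv : ∫ x, (g x - m) ^ 2 ∂μ ≤ v) : ∫ x, |g x - m| ∂μ ≤ Real.sqrt v := by
  have h1 : MemLp (fun x => |g x - m|) 2 μ := (hg.sub (memLp_const m)).abs
  have h2 := integral_sub_sq_eq h1 0
  simp only [sub_zero, sq_abs] at h2
  refine Real.le_sqrt_of_sq_le ?_
  have h3 : 0 ≤ ∫ x, (|g x - m| - ∫ y, |g y - m| ∂μ) ^ 2 ∂μ := integral_nonneg fun _ => sq_nonneg _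
  linarith

variable {K : Type*} [Fintype K]

lemma continuous_of_sum_abs_bound {f : (K → ℝ) → ℝ} {c : ℝ}
    (hf : ∀ z z', |f z - f z'| ≤ c * ∑ k, |z k - z' k|) : Continuous f := by
  refine continuous_iff_continuousAt.2 fun z => ?_
  rw [ContinuousAt, tendsto_iff_norm_sub_tendsto_zero]
  have h : Filter.Tendsto (fun z' : K → ℝ => c * ∑ k, |z' k - z k|) (nhds z) (nhds 0) := by
    have : Continuous fun z' : K → ℝ => c * ∑ k, |z' k - z k| := by fun_prop
    simpa using this.tendsto z
  exact squeeze_zero (fun _ => norm_nonneg _) (fun z' => hf z' z) h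

variable {ν : Measure ℝ} [IsProbabilityMeasure ν]

lemma memLp_of_sum_abs_bound (hν : MemLp (fun s : ℝ => s) 2 ν) {f : (K → ℝ) → ℝ} {c : ℝ}
    (hf : ∀ z z', |f z - f z'| ≤ c * ∑ k, |z k - z' k|) :
    MemLp f 2 (Measure.pi fun _ : K => ν) := by
  have h1 : MemLp (fun z : K → ℝ => |f 0| + c * ∑ k, |z k|) 2 (Measure.pi fun _ : K => ν) := by
    have h2 : ∀ k : K, MemLp (fun z : K → ℝ => |z k|) 2 (Measure.pi fun _ : K => ν) := fun k =>
      (hν.comp_measurePreserving (measurePreserving_eval (fun _ : K => ν) k)).abs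
    have h3 : MemLp (fun z : K → ℝ => ∑ k, |z k|) 2 (Measure.pi fun _ : K => ν) :=
      memLp_finsetSum _ fun k _ => h2 k
    have h4 : MemLp (fun z : K → ℝ => c * ∑ k, |z k|) 2 (Measure.pi fun _ : K => ν) :=
      h3.const_mul c
    have h5 : MemLp (fun _ : K → ℝ => |f 0|) 2 (Measure.pi fun _ : K => ν) := memLp_const _
    exact h5.add h4
  refine h1.mono (continuous_of_sum_abs_bound hf).aestronglyMeasurable
    (Filter.Eventually.of_forall fun z => ?_)
  have h2 := hf z 0
  simp only [Pi.zero_apply, sub_zero] at h2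
  rw [Real.norm_eq_abs, Real.norm_eq_abs]
  refine le_trans ?_ (le_abs_self _)
  linarith [abs_sub_abs_le_abs_sub (f z) (f 0)]

lemma integral_sub_sq_le_fin (hν : MemLp (fun s : ℝ => s) 2 ν) {c : ℝ} (N : ℕ) :
    ∀ f : (Fin N → ℝ) → ℝ, (∀ z z', |f z - f z'| ≤ c * ∑ k, |z k - z' k|) →
    ∫ z, (f z - ∫ y, f y ∂(Measure.pi fun _ => ν)) ^ 2 ∂(Measure.pi fun _ => ν)
      ≤ c ^ 2 * N * ∫ s, s ^ 2 ∂ν := by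
  induction N with
  | zero =>
    intro f hf
    have : ∀ z, f z = f 0 := fun z => by rw [Subsingleton.elim z 0]
    simp_rw [this]
    simp
  | succ N ih =>
    intro f hf
    set e := MeasurableEquiv.piFinSuccAbove (fun _ : Fin (N + 1) => ℝ) 0
    have he := (measurePreserving_piFinSuccAbove (fun _ : Fin (N + 1) => ν) 0).symm
    have hf2 := memLp_of_sum_abs_bound hν hf
    set π := Measure.pi fun _ : Fin N => ν
    set F : ℝ → (Fin N → ℝ) → ℝ := fun s w => f (e.symm (s, w)) with hF
    have hlip : ∀ s w s' w', |F s w - F s' w'| ≤ c * (|s - s'| + ∑ k, |w k - w' k|) := by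
      intro s w s' w'
      refine (hf _ _).trans_eq ?_
      rw [Fin.sum_univ_succ]
      rfl
    have hlip1 : ∀ s w w', |F s w - F s w'| ≤ c * ∑ k, |w k - w' k| := fun s w w' => by
      simpa using hlip s w s w'
    have hFm : ∀ s, MemLp (F s) 2 π := fun s => memLp_of_sum_abs_bound hν (hlip1 s)
    have hFi : ∀ s, Integrable (F s) π := fun s => (hFm s).integrable (by norm_num)
    set Fb : ℝ → ℝ := fun s => ∫ w, F s w ∂π with hFb
    have hFblip : ∀ s s', |Fb s - Fb s'| ≤ c * |s - s'| := fun s s' => by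
      rw [hFb]
      simp only
      rw [← integral_sub (hFi s) (hFi s')]
      have := norm_integral_le_of_norm_le_const (μ := π) (C := c * |s - s'|)
        (f := fun w => F s w - F s' w)
        (Filter.Eventually.of_forall fun w => by simpa using hlip s w s' w)
      simpa using this
    have hFbm : MemLp Fb 2 ν := by
      have h0 : MemLp (fun s : ℝ => c * |s|) 2 ν := hν.abs.const_mul c
      have h00 : MemLp (fun _ : ℝ => |Fb 0|) 2 ν := memLp_const _
      have h1 : MemLp (fun s : ℝ => |Fb 0| + c * |s|) 2 ν := h00.add h0
      have hcont : Continuous Fb := by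
        refine continuous_iff_continuousAt.2 fun z => ?_
        rw [ContinuousAt, tendsto_iff_norm_sub_tendsto_zero]
        have h : Filter.Tendsto (fun z' : ℝ => c * |z' - z|) (nhds z) (nhds 0) := by
          have : Continuous fun z' : ℝ => c * |z' - z| := by fun_prop
          simpa using this.tendsto z
        exact squeeze_zero (fun _ => norm_nonneg _) (fun z' => hFblip z' z) h
      refine h1.mono hcont.aestronglyMeasurable (Filter.Eventually.of_forall fun z => ?_)
      have h2 := hFblip z 0
      rw [sub_zero] at h2
      rw [Real.norm_eq_abs, Real.norm_eq_abs]
      refine le_trans ?_ (le_abs_self _)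
      linarith [abs_sub_abs_le_abs_sub (Fb z) (Fb 0)]
    have hint : Integrable (fun q : ℝ × (Fin N → ℝ) => F q.1 q.2) (ν.prod π) :=
      he.integrable_comp_of_integrable (hf2.integrable (by norm_num))
    have hmean : ∫ y, f y ∂(Measure.pi fun _ => ν) = ∫ s, Fb s ∂ν := by
      rw [← he.integral_comp' f, integral_prod _ hint]
    set m := ∫ s, Fb s ∂ν with hm
    have hint2 : Integrable (fun q : ℝ × (Fin N → ℝ) => (F q.1 q.2 - m) ^ 2) (ν.prod π) :=
      he.integrable_comp_of_integrable (hf2.sub (memLp_const m)).integrable_sq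
    rw [hmean, ← he.integral_comp' (fun z => (f z - m) ^ 2)]
    have hint3 : Integrable (fun s => (Fb s - m) ^ 2) ν := (hFbm.sub (memLp_const m)).integrable_sq
    calc ∫ q, (F q.1 q.2 - m) ^ 2 ∂(ν.prod π)
        = ∫ s, (∫ w, (F s w - m) ^ 2 ∂π) ∂ν := integral_prod _ hint2
      _ ≤ ∫ s, (c ^ 2 * N * (∫ s, s ^ 2 ∂ν) + (Fb s - m) ^ 2) ∂ν := by
          refine integral_mono hint2.integral_prod_left
            ((integrable_const _).add hint3) fun s => ?_
          simp only
          rw [integral_sub_sq_eq (hFm s)]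
          have := ih (F s) (hlip1 s)
          gcongr
      _ = c ^ 2 * N * (∫ s, s ^ 2 ∂ν) + ∫ s, (Fb s - m) ^ 2 ∂ν := by
          rw [integral_add (integrable_const _) hint3]
          simp
      _ ≤ c ^ 2 * N * (∫ s, s ^ 2 ∂ν) + c ^ 2 * ∫ s, s ^ 2 ∂ν := by
          gcongr
          have h1 := integral_sub_sq_eq hFbm (Fb 0)
          have h2 : ∫ s, (Fb s - Fb 0) ^ 2 ∂ν ≤ ∫ s, c ^ 2 * s ^ 2 ∂ν := by
            refine integral_mono (hFbm.sub (memLp_const _)).integrable_sq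
              (hν.integrable_sq.const_mul _) fun s => ?_
            have := hFblip s 0
            rw [sub_zero] at this
            have h3 := pow_le_pow_left₀ (abs_nonneg _) this 2
            simpa only [mul_pow, sq_abs] using h3
          rw [integral_const_mul] at h2
          nlinarith [sq_nonneg (m - Fb 0)]
      _ = _ := by push_cast; ring

/-- Efron–Stein type bound: an `ℓ¹`-Lipschitz function of independent coordinates concentrates
around its mean. -/
lemma integral_abs_sub_integral_le (hν : MemLp (fun s : ℝ => s) 2 ν) {c : ℝ}
    {f : (K → ℝ) → ℝ} (hf : ∀ z z', |f z - f z'| ≤ c * ∑ k, |z k - z' k|) :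
    ∫ z, |f z - ∫ y, f y ∂(Measure.pi fun _ : K => ν)| ∂(Measure.pi fun _ : K => ν)
      ≤ Real.sqrt (c ^ 2 * Fintype.card K * ∫ s, s ^ 2 ∂ν) := by
  refine integral_abs_sub_le_sqrt (memLp_of_sum_abs_bound hν hf) _ ?_
  set e := (Fintype.equivFin K).symm
  have he := measurePreserving_piCongrLeft (fun _ : K => ν) e
  have h1 := integral_sub_sq_le_fin hν (c := c) (Fintype.card K)
    (fun z => f (MeasurableEquiv.piCongrLeft (fun _ : K => ℝ) e z)) (fun z z' => by
      refine (hf _ _).trans_eq ?_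
      rw [← e.sum_comp]
      congr 1
      refine Finset.sum_congr rfl fun k _ => ?_
      simp only [MeasurableEquiv.coe_piCongrLeft, Equiv.piCongrLeft_apply_apply])
  rw [he.integral_comp' f] at h1
  rwa [he.integral_comp' (fun z => (f z - ∫ y, f y ∂(Measure.pi fun _ : K => ν)) ^ 2)] at h1

end EfronStein

section SpikeModel

variable {P : Measure ℝ} [IsProbabilityMeasure P] {S : ℝ} {n : ℕ}

/-- Couplings of the rank-one matrix channel. -/
noncomputable def matrixCoupling (n : ℕ) (e : Fin n × Fin n) (x : Fin n → ℝ) : ℝ :=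
  if e.1 ≤ e.2 then x e.1 * x e.2 / Real.sqrt n else 0

/-- Couplings of the rank-one matrix channel combined with a decoupled scalar channel. -/
noncomputable def spikeCoupling (n : ℕ) : (Fin n × Fin n) ⊕ Fin n → (Fin n → ℝ) → ℝ :=
  Sum.elim (matrixCoupling n) (fun i x => x i)

/-- Trigonometric interpolation between the scalar channel and the matrix channel. -/
noncomputable def spikeAmplitude (n : ℕ) (q θ : ℝ) : (Fin n × Fin n) ⊕ Fin n → ℝ :=
  Sum.elim (fun _ => Real.sin θ) (fun _ => Real.sqrt q * Real.cos θ)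

/-- Derivative of the trigonometric interpolation. -/
noncomputable def spikeAmplitudeDeriv (n : ℕ) (q θ : ℝ) : (Fin n × Fin n) ⊕ Fin n → ℝ :=
  Sum.elim (fun _ => Real.cos θ) (fun _ => -(Real.sqrt q * Real.sin θ))

lemma measurable_matrixCoupling (e : Fin n × Fin n) : Measurable (matrixCoupling n e) := by
  unfold matrixCoupling
  split_ifs <;> fun_prop

lemma measurable_spikeCoupling (k : (Fin n × Fin n) ⊕ Fin n) : Measurable (spikeCoupling n k) := by
  rcases k with e | i
  · exact measurable_matrixCoupling e
  · exact measurable_pi_apply i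

lemma abs_matrixCoupling_le (hn : 0 < n) (e : Fin n × Fin n) {x : Fin n → ℝ}
    (hx : ∀ i, |x i| ≤ S) : |matrixCoupling n e x| ≤ S ^ 2 + S := by
  have hS : 0 ≤ S := (abs_nonneg _).trans (hx e.1)
  have h1 : 1 ≤ Real.sqrt n := Real.one_le_sqrt.2 (by exact_mod_cast hn)
  unfold matrixCoupling
  split_ifs
  · rw [abs_div, abs_mul, abs_of_pos (zero_lt_one.trans_le h1)]
    refine (div_le_self (by positivity) h1).trans ?_
    have := mul_le_mul (hx e.1) (hx e.2) (abs_nonneg _) hS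
    nlinarith
  · simp only [abs_zero]
    positivity

lemma abs_spikeCoupling_le (hn : 0 < n) {x : Fin n → ℝ}
    (hx : ∀ i, |x i| ≤ S) (k : (Fin n × Fin n) ⊕ Fin n) : |spikeCoupling n k x| ≤ S ^ 2 + S := by
  rcases k with e | i
  · exact abs_matrixCoupling_le hn e hx
  · have := hx i
    change |x i| ≤ _
    nlinarith

lemma ae_pi_abs_le (hP : ∀ᵐ x ∂P, |x| ≤ S) :
    ∀ᵐ x ∂(Measure.pi fun _ : Fin n => P), ∀ i, |x i| ≤ S :=
  Filter.eventually_all.2 fun i =>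
    (measurePreserving_eval (fun _ : Fin n => P) i).quasiMeasurePreserving.ae hP

lemma hasDerivAt_spikeAmplitude (q θ : ℝ) (k : (Fin n × Fin n) ⊕ Fin n) :
    HasDerivAt (fun θ => spikeAmplitude n q θ k) (spikeAmplitudeDeriv n q θ k) θ := by
  rcases k with e | i
  · exact Real.hasDerivAt_sin θ
  · refine ((Real.hasDerivAt_cos θ).const_mul (Real.sqrt q)).congr_deriv ?_
    simp [spikeAmplitudeDeriv]

lemma abs_spikeAmplitude_le (q θ : ℝ) (k : (Fin n × Fin n) ⊕ Fin n) :
    |spikeAmplitude n q θ k| ≤ 1 + Real.sqrt q ∧ |spikeAmplitudeDeriv n q θ k| ≤ 1 + Real.sqrt q := by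
  have hs := Real.sqrt_nonneg q
  rcases k with e | i
  · exact ⟨(Real.abs_sin_le_one θ).trans (by linarith), (Real.abs_cos_le_one θ).trans (by linarith)⟩
  · have h1 := mul_le_mul_of_nonneg_left (Real.abs_cos_le_one θ) hs
    have h2 := mul_le_mul_of_nonneg_left (Real.abs_sin_le_one θ) hs
    constructor
    · change |Real.sqrt q * Real.cos θ| ≤ _
      rw [abs_mul, abs_of_nonneg hs]
      linarith
    · change |-(Real.sqrt q * Real.sin θ)| ≤ _
      rw [abs_neg, abs_mul, abs_of_nonneg hs]
      linarith

lemma two_mul_sum_upper {T : Fin n → Fin n → ℝ} (hT : ∀ i j, T i j = T j i) :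
    2 * ∑ e : Fin n × Fin n, (if e.1 ≤ e.2 then T e.1 e.2 else 0)
      = ∑ i, ∑ j, T i j + ∑ i, T i i := by
  rw [Fintype.sum_prod_type, two_mul]
  nth_rw 2 [Finset.sum_comm]
  simp only
  rw [← Finset.sum_add_distrib, ← Finset.sum_add_distrib]
  refine Finset.sum_congr rfl fun i _ => ?_
  have : T i i = ∑ j, if i = j then T i j else 0 := by simp
  rw [this, ← Finset.sum_add_distrib, ← Finset.sum_add_distrib]
  refine Finset.sum_congr rfl fun j _ => ?_
  rcases lt_trichotomy i j with h | h | h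
  · simp [h.le, h.ne, not_le.2 h]
  · simp [h]
  · simp [h.le, h.ne', not_le.2 h, hT i j]

variable {μ : Measure (Fin n → ℝ)}

lemma gibbs_matrixCoupling {K : Type*} [Fintype K] {h : K → (Fin n → ℝ) → ℝ} (a p g : K → ℝ)
    (e : Fin n × Fin n) :
    gibbs μ h a p g (matrixCoupling n e)
      = if e.1 ≤ e.2 then gibbs μ h a p g (fun x => x e.1 * x e.2) / Real.sqrt n else 0 := by
  split_ifs with he
  · have : matrixCoupling n e = fun x => (Real.sqrt n)⁻¹ * (x e.1 * x e.2) := by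
      ext x
      rw [matrixCoupling, if_pos he]
      ring
    rw [this, gibbs_const_mul]
    ring
  · have : matrixCoupling n e = fun _ => 0 := by
      ext x
      rw [matrixCoupling, if_neg he]
    rw [this]
    simp [gibbs]

variable [IsFiniteMeasure μ]

/-- Replica quantities: the squared Frobenius norm of the Gibbs second moments dominates the fourth
power of the norm of the Gibbs mean, and quadratic forms of second moments are Gibbs averages. -/
lemma gibbs_second_moment {K : Type*} [Fintype K] {h : K → (Fin n → ℝ) → ℝ} {C : ℝ}
    (hm : ∀ k, Measurable (h k)) (hC : ∀ᵐ x ∂μ, ∀ k, |h k x| ≤ C)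
    (hS : ∀ᵐ x ∂μ, ∀ i, |x i| ≤ S) (a p g : K → ℝ) (v : Fin n → ℝ) :
    gibbs μ h a p g (fun x => ∑ i, v i * x i) = ∑ i, v i * gibbs μ h a p g (fun x => x i) ∧
    gibbs μ h a p g (fun x => (∑ i, v i * x i) ^ 2)
      = ∑ i, ∑ j, v i * v j * gibbs μ h a p g (fun x => x i * x j) := by
  have hi : ∀ i, ∀ᵐ x ∂μ, |x i| ≤ S := fun i => hS.mono fun x hx => hx i
  have hij : ∀ i j, ∀ᵐ x ∂μ, |v i * v j * (x i * x j)| ≤ |v i * v j| * (S * S) := fun i j =>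
    hS.mono fun x hx => by
      have h1 := hx i
      have h2 := hx j
      have : 0 ≤ S := (abs_nonneg _).trans h1
      rw [abs_mul, abs_mul (x i)]
      gcongr
  constructor
  · rw [gibbs_sum (f := fun i x => v i * x i) (F := fun i => |v i| * S) _ hm hC]
    · simp_rw [gibbs_const_mul]
    · intro i; fun_prop
    · intro i
      filter_upwards [hi i] with x hx
      rw [abs_mul]
      gcongr
  · have e : ∀ x : Fin n → ℝ, (∑ i, v i * x i) ^ 2 = ∑ i, ∑ j, v i * v j * (x i * x j) := fun x => by
      rw [sq, Finset.sum_mul_sum]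
      refine Finset.sum_congr rfl fun i _ => Finset.sum_congr rfl fun j _ => ?_
      ring
    simp_rw [e]
    rw [gibbs_sum (f := fun i x => ∑ j, v i * v j * (x i * x j))
      (F := fun i => ∑ j, |v i * v j| * (S * S)) _ hm hC]
    · refine Finset.sum_congr rfl fun i _ => ?_
      rw [gibbs_sum (f := fun j x => v i * v j * (x i * x j))
        (F := fun j => |v i * v j| * (S * S)) _ hm hC]
      · simp_rw [gibbs_const_mul]
      · intro j; fun_prop
      · exact hij i
    · intro i; fun_prop
    · intro i
      have : ∀ᵐ x ∂μ, ∀ j, |v i * v j * (x i * x j)| ≤ |v i * v j| * (S * S) :=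
        Filter.eventually_all.2 (hij i)
      filter_upwards [this] with x hx
      exact (Finset.abs_sum_le_sum_abs _ _).trans (Finset.sum_le_sum fun j _ => hx j)

lemma gibbs_mean_pow_four_le {K : Type*} [Fintype K] {h : K → (Fin n → ℝ) → ℝ} {C : ℝ}
    (hμ : μ ≠ 0) (hm : ∀ k, Measurable (h k)) (hC : ∀ᵐ x ∂μ, ∀ k, |h k x| ≤ C)
    (hS : ∀ᵐ x ∂μ, ∀ i, |x i| ≤ S) (a p g : K → ℝ) :
    (∑ i, gibbs μ h a p g (fun x => x i) ^ 2) ^ 2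
      ≤ ∑ i, ∑ j, gibbs μ h a p g (fun x => x i * x j) ^ 2 := by
  set b : Fin n → ℝ := fun i => gibbs μ h a p g (fun x => x i) with hb
  set M : Fin n → Fin n → ℝ := fun i j => gibbs μ h a p g (fun x => x i * x j)
  obtain ⟨h1, h2⟩ := gibbs_second_moment hm hC hS a p g b
  have h3 := sq_gibbs_le (f := fun x => ∑ i, b i * x i) (F := ∑ i, |b i| * S) hμ hm hC a p g
    (by fun_prop) (hS.mono fun x hx => (Finset.abs_sum_le_sum_abs _ _).trans
      (Finset.sum_le_sum fun i _ => by
        rw [abs_mul]; exact mul_le_mul_of_nonneg_left (hx i) (abs_nonneg _)))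
  rw [h1, h2] at h3
  have e1 : ∑ i, b i * b i = ∑ i, b i ^ 2 := Finset.sum_congr rfl fun i _ => (sq _).symm
  have e2 : (∑ i, b i ^ 2) ^ 2 = ∑ i, ∑ j, (b i * b j) ^ 2 := by
    rw [sq, Finset.sum_mul_sum]
    refine Finset.sum_congr rfl fun i _ => Finset.sum_congr rfl fun j _ => ?_
    ring
  have h4 : 0 ≤ ∑ i, ∑ j, (M i j - b i * b j) ^ 2 :=
    Finset.sum_nonneg fun i _ => Finset.sum_nonneg fun j _ => sq_nonneg _
  have h5 : ∑ i, ∑ j, (M i j - b i * b j) ^ 2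
      = ∑ i, ∑ j, M i j ^ 2 - 2 * ∑ i, ∑ j, b i * b j * M i j + ∑ i, ∑ j, (b i * b j) ^ 2 := by
    simp_rw [Finset.mul_sum, ← Finset.sum_sub_distrib, ← Finset.sum_add_distrib]
    refine Finset.sum_congr rfl fun i _ => Finset.sum_congr rfl fun j _ => ?_
    ring
  change (∑ i, b i * b i) ^ 2 ≤ ∑ i, ∑ j, b i * b j * M i j at h3
  rw [e1] at h3
  change (∑ i, b i ^ 2) ^ 2 ≤ ∑ i, ∑ j, M i j ^ 2
  linarith

end SpikeModel

section Marginals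

variable {E : Type*} [MeasurableSpace E] {μ : Measure E}
variable {K L : Type*} [Fintype K] [Fintype L]

lemma modelFreeEnergy_sum_inl (h₁ : K → E → ℝ) (h₂ : L → E → ℝ) (hm : ∀ k, Measurable (h₁ k))
    [IsFiniteMeasure μ] (a : K → ℝ) (p : K ⊕ L → ℝ) :
    modelFreeEnergy μ (Sum.elim h₁ h₂) (Sum.elim a fun _ => 0) p
      = modelFreeEnergy μ h₁ a (fun k => p (Sum.inl k)) := by
  have hpre := measurePreserving_fst.comp
    (measurePreserving_sumPiEquivProdPi (fun _ : K ⊕ L => stdGauss))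
  have e : ∀ g : K ⊕ L → ℝ, modelPartition μ (Sum.elim h₁ h₂) (Sum.elim a fun _ => 0) p g
      = modelPartition μ h₁ a (fun k => p (Sum.inl k)) (fun k => g (Sum.inl k)) := fun g => by
    simp [modelPartition, modelExponent, Fintype.sum_sum_type]
  unfold modelFreeEnergy
  simp_rw [e]
  rw [← hpre.map_eq, integral_map hpre.measurable.aemeasurable]
  · rfl
  · exact (measurable_modelPartition hm a measurable_const
      measurable_id).log.aestronglyMeasurable

lemma modelFreeEnergy_sum_inr (h₁ : K → E → ℝ) (h₂ : L → E → ℝ) (hm : ∀ k, Measurable (h₂ k))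
    [IsFiniteMeasure μ] (a : L → ℝ) (p : K ⊕ L → ℝ) :
    modelFreeEnergy μ (Sum.elim h₁ h₂) (Sum.elim (fun _ => 0) a) p
      = modelFreeEnergy μ h₂ a (fun k => p (Sum.inr k)) := by
  have hpre := measurePreserving_snd.comp
    (measurePreserving_sumPiEquivProdPi (fun _ : K ⊕ L => stdGauss))
  have e : ∀ g : K ⊕ L → ℝ, modelPartition μ (Sum.elim h₁ h₂) (Sum.elim (fun _ => 0) a) p g
      = modelPartition μ h₂ a (fun k => p (Sum.inr k)) (fun k => g (Sum.inr k)) := fun g => by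
    simp [modelPartition, modelExponent, Fintype.sum_sum_type]
  unfold modelFreeEnergy
  simp_rw [e]
  rw [← hpre.map_eq, integral_map hpre.measurable.aemeasurable]
  · rfl
  · exact (measurable_modelPartition hm a measurable_const
      measurable_id).log.aestronglyMeasurable

/-- Noise-averaged log-partition function of the scalar channel with amplitude `s` and planted
value `p`. -/
noncomputable def scalarFreeEnergy (P : Measure ℝ) (s p : ℝ) : ℝ :=
  modelFreeEnergy P (fun (_ : Unit) x => x) (fun _ => s) (fun _ => p)

variable {P : Measure ℝ} [IsProbabilityMeasure P] {S : ℝ}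

lemma integral_stdGauss_pi_eval (k : K) (f : ℝ → ℝ) (hf : Measurable f) :
    ∫ g, f (g k) ∂(Measure.pi fun _ : K => stdGauss) = ∫ z, f z ∂stdGauss := by
  have hpre := measurePreserving_eval (fun _ : K => stdGauss) k
  conv_rhs => rw [← hpre.map_eq]
  rw [integral_map hpre.measurable.aemeasurable hf.aestronglyMeasurable]

lemma measurable_scalarPartition (s p : ℝ) :
    Measurable fun z : ℝ => ∫ x, Real.exp (s * z * x + s ^ 2 * (p * x - x ^ 2 / 2)) ∂P := by
  have : Measurable fun q : ℝ × ℝ => Real.exp (s * q.1 * q.2 + s ^ 2 * (p * q.2 - q.2 ^ 2 / 2)) := by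
    fun_prop
  exact (this.stronglyMeasurable.integral_prod_right' (ν := P)).measurable

lemma scalarFreeEnergy_eq (s p : ℝ) :
    scalarFreeEnergy P s p
      = ∫ z, Real.log (∫ x, Real.exp (s * z * x + s ^ 2 * (p * x - x ^ 2 / 2)) ∂P) ∂stdGauss := by
  rw [← integral_stdGauss_pi_eval () _ (measurable_scalarPartition s p).log]
  simp [scalarFreeEnergy, modelFreeEnergy, modelPartition, modelExponent]

omit [IsProbabilityMeasure P] in
lemma scalar_bound (hP : ∀ᵐ x ∂P, |x| ≤ S) : ∀ᵐ x ∂P, ∀ _ : Unit, |x| ≤ S :=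
  hP.mono fun _ hx _ => hx

lemma modelFreeEnergy_coordinates (hP : ∀ᵐ x ∂P, |x| ≤ S) {n : ℕ} (s : ℝ) (p : Fin n → ℝ) :
    modelFreeEnergy (Measure.pi fun _ : Fin n => P) (fun i x => x i) (fun _ => s) p
      = ∑ i, scalarFreeEnergy P s (p i) := by
  have hpos : ∀ p z, 0 < ∫ x, Real.exp (s * z * x + s ^ 2 * (p * x - x ^ 2 / 2)) ∂P := fun p z => by
    have := modelPartition_pos (h := fun (_ : Unit) x => x) (NeZero.ne P) (fun _ => measurable_id)
      (scalar_bound hP) (fun _ => s) (fun _ => p) (fun _ => z)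
    simpa [modelPartition, modelExponent] using this
  have e : ∀ g : Fin n → ℝ,
      Real.log (modelPartition (Measure.pi fun _ : Fin n => P) (fun i x => x i) (fun _ => s) p g)
      = ∑ i, Real.log (∫ x, Real.exp (s * g i * x + s ^ 2 * (p i * x - x ^ 2 / 2)) ∂P) := fun g => by
    unfold modelPartition modelExponent
    simp_rw [Real.exp_sum]
    rw [integral_fintype_prod_eq_prod
      (f := fun i x => Real.exp (s * g i * x + s ^ 2 * (p i * x - x ^ 2 / 2))),
      Real.log_prod fun i _ => (hpos _ _).ne']
  unfold modelFreeEnergy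
  simp_rw [e]
  rw [integral_finsetSum]
  · refine Finset.sum_congr rfl fun i _ => ?_
    rw [scalarFreeEnergy_eq, ← integral_stdGauss_pi_eval i _ (measurable_scalarPartition s (p i)).log]
  · intro i _
    have h1 := integrable_log_modelPartition (h := fun (_ : Unit) x => x) (NeZero.ne P)
      (fun _ => measurable_id) (scalar_bound hP) (fun _ => s) (fun _ => p i)
    simp only [modelPartition, modelExponent, Finset.univ_unique, Finset.sum_singleton] at h1
    have hpre := measurePreserving_eval (fun _ : Unit => stdGauss) ()
    have h2 : Integrable
        (fun z => Real.log (∫ x, Real.exp (s * z * x + s ^ 2 * (p i * x - x ^ 2 / 2)) ∂P))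
        stdGauss := by
      rw [← hpre.map_eq]
      exact (integrable_map_measure (measurable_scalarPartition s (p i)).log.aestronglyMeasurable
        hpre.measurable.aemeasurable).2 h1
    exact (measurePreserving_eval (fun _ : Fin n => stdGauss) i).integrable_comp_of_integrable h2

omit [IsProbabilityMeasure P] in
lemma Zws_eq_modelPartition (n : ℕ) (X : Fin n → ℝ) (Z : Fin n × Fin n → ℝ) :
    Zws P n X Z = modelPartition (Measure.pi fun _ : Fin n => P) (matrixCoupling n) (fun _ => 1)
      (fun e => matrixCoupling n e X) Z := by
  unfold Zws modelPartition
  congr 1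
  ext x
  congr 1
  unfold Hws modelExponent
  rw [Fintype.sum_prod_type, ← Finset.sum_neg_distrib]
  refine Finset.sum_congr rfl fun i _ => ?_
  rw [Finset.sum_filter, ← Finset.sum_neg_distrib]
  refine Finset.sum_congr rfl fun j _ => ?_
  have hn : 0 < n := i.pos
  have hs : Real.sqrt n ^ 2 = n := Real.sq_sqrt (Nat.cast_nonneg n)
  have hs0 : Real.sqrt n ≠ 0 := by positivity
  unfold matrixCoupling
  simp only
  split_ifs
  · rw [← hs]
    rw [Real.sqrt_sq (Real.sqrt_nonneg _)]
    field_simp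
    ring
  · simp

omit [IsProbabilityMeasure P] in
lemma fws_eq (n : ℕ) : fws P n = -(1 / n) * ∫ X, modelFreeEnergy (Measure.pi fun _ : Fin n => P)
    (matrixCoupling n) (fun _ => 1) (fun e => matrixCoupling n e X)
      ∂(Measure.pi fun _ : Fin n => P) := by
  unfold fws modelFreeEnergy
  simp_rw [Zws_eq_modelPartition]

lemma fpotWS_eq {r : ℝ} (hr : 0 ≤ r) (q : ℝ) :
    fpotWS P q r = q * r / 2 - q ^ 2 / 4 - ∫ X, scalarFreeEnergy P (Real.sqrt r) X ∂P := by
  unfold fpotWS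
  congr 1
  refine integral_congr_ae (Filter.Eventually.of_forall fun X => ?_)
  simp only
  rw [scalarFreeEnergy_eq, Real.sq_sqrt hr]
  have : ∀ z x : ℝ, -(r * x ^ 2 / 2 - r * x * X - Real.sqrt r * x * z)
      = Real.sqrt r * z * x + r * (X * x - x ^ 2 / 2) := fun z x => by ring
  simp_rw [this]

end Marginals

section PlantedDerivative

variable {K E : Type*} [Fintype K] [MeasurableSpace E]
variable {μ : Measure E} {h : K → E → ℝ} {C : ℝ}

lemma measurable_integral_gibbs [IsFiniteMeasure μ] {Ω : Type*} [MeasurableSpace Ω]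
    (hm : ∀ k, Measurable (h k)) (a : K → ℝ)
    {p : Ω → K → ℝ} (hp : Measurable p) {f : E → ℝ} (hf : Measurable f) (φ : ℝ → ℝ)
    (hφ : Measurable φ) :
    Measurable fun ω => ∫ g, φ (gibbs μ h a (p ω) g f) ∂(Measure.pi fun _ : K => stdGauss) :=
  ((hφ.comp (measurable_gibbs (μ := μ) (Ω := Ω × (K → ℝ)) hm a (hp.comp measurable_fst)
    measurable_snd hf)).stronglyMeasurable.integral_prod_right'
      (ν := Measure.pi fun _ : K => stdGauss)).measurable

lemma abs_integral_pi_le {f : (K → ℝ) → ℝ} {B : ℝ} (hB : ∀ g, |f g| ≤ B) :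
    |∫ g, f g ∂(Measure.pi fun _ : K => stdGauss)| ≤ B := by
  simpa using norm_integral_le_of_norm_le_const (μ := Measure.pi fun _ : K => stdGauss)
    (f := f) (C := B) (Filter.Eventually.of_forall hB)

variable [IsProbabilityMeasure μ]

lemma integral_freeEnergyDerivative_planted (hm : ∀ k, Measurable (h k))
    (hC : ∀ᵐ x ∂μ, ∀ k, |h k x| ≤ C) (hC0 : 0 ≤ C) (a a' : K → ℝ) :
    ∫ X, freeEnergyDerivative μ h a a' (fun k => h k X) ∂μ
      = ∫ X, (∫ g, ∑ k, a k * a' k * gibbs μ h a (fun k => h k X) g (h k) ^ 2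
        ∂(Measure.pi fun _ : K => stdGauss)) ∂μ := by
  have hμ : μ ≠ 0 := NeZero.ne μ
  have hk : ∀ k, ∀ᵐ x ∂μ, |h k x| ≤ C := fun k => hC.mono fun x hx => hx k
  have hp : Measurable fun X k => h k X := measurable_pi_iff.2 hm
  have b1 : ∀ X k g, |gibbs μ h a (fun k => h k X) g (h k)| ≤ C := fun X k g =>
    abs_gibbs_le hμ hm hC a _ g (hk k)
  have b2 : ∀ X k g, |gibbs μ h a (fun k => h k X) g (h k) ^ 2| ≤ C ^ 2 := fun X k g => by
    rw [abs_pow]; exact pow_le_pow_left₀ (abs_nonneg _) (b1 X k g) 2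
  have m1 : ∀ X k, Measurable fun g => gibbs μ h a (fun k => h k X) g (h k) := fun X k =>
    measurable_gibbs hm a measurable_const measurable_id (hm k)
  have i1 : ∀ X k, Integrable (fun g => gibbs μ h a (fun k => h k X) g (h k))
      (Measure.pi fun _ : K => stdGauss) := fun X k => integrable_pi_of_bound (m1 X k) (b1 X k)
  have i2 : ∀ X k, Integrable (fun g => gibbs μ h a (fun k => h k X) g (h k) ^ 2)
      (Measure.pi fun _ : K => stdGauss) := fun X k =>
    integrable_pi_of_bound ((m1 X k).pow_const 2) (b2 X k)
  set G : K → E → ℝ := fun k X => ∫ g, gibbs μ h a (fun k => h k X) g (h k)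
    ∂(Measure.pi fun _ : K => stdGauss) with hG
  set Q : K → E → ℝ := fun k X => ∫ g, gibbs μ h a (fun k => h k X) g (h k) ^ 2
    ∂(Measure.pi fun _ : K => stdGauss) with hQ
  have mG : ∀ k, Measurable (G k) := fun k =>
    measurable_integral_gibbs hm a hp (hm k) id measurable_id
  have mQ : ∀ k, Measurable (Q k) := fun k =>
    measurable_integral_gibbs hm a hp (hm k) (fun t => t ^ 2) (by fun_prop)
  have iQ : ∀ k, Integrable (Q k) μ := fun k =>
    Integrable.of_bound (mQ k).aestronglyMeasurable (C ^ 2)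
      (Filter.Eventually.of_forall fun X => abs_integral_pi_le (b2 X k))
  have ihG : ∀ k, Integrable (fun X => h k X * G k X) μ := fun k =>
    Integrable.of_bound ((hm k).mul (mG k)).aestronglyMeasurable (C * C)
      ((hk k).mono fun X hX => by
        rw [norm_mul]
        exact mul_le_mul hX (abs_integral_pi_le (b1 X k)) (abs_nonneg _) hC0)
  have e1 : ∀ X, freeEnergyDerivative μ h a a' (fun k => h k X)
      = ∑ k, a k * a' k * (2 * (h k X * G k X) - Q k X) := fun X => by
    unfold freeEnergyDerivative
    have i3 : ∀ k, Integrable (fun g => a k * a' k * (2 * h k X *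
        gibbs μ h a (fun k => h k X) g (h k) - gibbs μ h a (fun k => h k X) g (h k) ^ 2))
        (Measure.pi fun _ : K => stdGauss) := fun k =>
      (((i1 X k).const_mul _).sub (i2 X k)).const_mul _
    rw [integral_finsetSum _ fun k _ => i3 k]
    refine Finset.sum_congr rfl fun k _ => ?_
    rw [integral_const_mul, integral_sub ((i1 X k).const_mul _) (i2 X k), integral_const_mul]
    simp only [hG, hQ]
    ring
  have e2 : ∀ X, (∫ g, ∑ k, a k * a' k * gibbs μ h a (fun k => h k X) g (h k) ^ 2
        ∂(Measure.pi fun _ : K => stdGauss)) = ∑ k, a k * a' k * Q k X := fun X => by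
    rw [integral_finsetSum _ fun k _ => (i2 X k).const_mul _]
    simp_rw [integral_const_mul]
    rfl
  simp_rw [e1, e2]
  have i4 : ∀ k, Integrable (fun X => a k * a' k * (2 * (h k X * G k X) - Q k X)) μ := fun k =>
    (((ihG k).const_mul 2).sub (iQ k)).const_mul _
  rw [integral_finsetSum _ fun k _ => i4 k,
    integral_finsetSum _ fun k _ => (iQ k).const_mul _]
  refine Finset.sum_congr rfl fun k _ => ?_
  rw [integral_const_mul, integral_const_mul, integral_sub ((ihG k).const_mul 2) (iQ k),
    integral_const_mul]
  have := nishimori hm hC hC0 a (hm k) (hk k)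
  change ∫ X, h k X * G k X ∂μ = ∫ X, Q k X ∂μ at this
  rw [this]
  ring

end PlantedDerivative

section TrigComparison

lemma le_add_of_deriv_le_sin_mul_cos {F D : ℝ → ℝ} {c : ℝ} (hF : ∀ θ, HasDerivAt F (D θ) θ)
    (hD : ∀ θ, 0 ≤ Real.sin θ * Real.cos θ → D θ ≤ Real.sin θ * Real.cos θ * c) :
    F (Real.pi / 2) ≤ F 0 + c / 2 := by
  have hd : ∀ θ, HasDerivAt (fun θ => F θ - Real.sin θ ^ 2 * (c / 2))
      (D θ - Real.sin θ * Real.cos θ * c) θ := fun θ => by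
    refine ((hF θ).sub (((Real.hasDerivAt_sin θ).pow 2).mul_const (c / 2))).congr_deriv ?_
    ring
  have hanti : AntitoneOn (fun θ => F θ - Real.sin θ ^ 2 * (c / 2)) (Set.Icc 0 (Real.pi / 2)) := by
    refine antitoneOn_of_deriv_nonpos (convex_Icc _ _)
      (fun θ _ => (hd θ).continuousAt.continuousWithinAt)
      (fun θ _ => (hd θ).differentiableAt.differentiableWithinAt) fun θ hθ => ?_
    rw [interior_Icc] at hθ
    rw [(hd θ).deriv]
    have h1 : 0 ≤ Real.sin θ := Real.sin_nonneg_of_nonneg_of_le_pi hθ.1.le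
      (by linarith [hθ.2, Real.pi_pos])
    have h2 : 0 ≤ Real.cos θ := Real.cos_nonneg_of_mem_Icc ⟨by linarith [hθ.1, Real.pi_pos], hθ.2.le⟩
    linarith [hD θ (mul_nonneg h1 h2)]
  have hpi : 0 ≤ Real.pi / 2 := by positivity
  have := hanti (Set.left_mem_Icc.2 hpi) (Set.right_mem_Icc.2 hpi) hpi
  simp only [Real.sin_pi_div_two, Real.sin_zero] at this
  linarith

lemma add_le_of_le_deriv_sin_mul_cos {F D : ℝ → ℝ} {c : ℝ} (hF : ∀ θ, HasDerivAt F (D θ) θ)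
    (hD : ∀ θ, 0 ≤ Real.sin θ * Real.cos θ → Real.sin θ * Real.cos θ * c ≤ D θ) :
    F 0 + c / 2 ≤ F (Real.pi / 2) := by
  have := le_add_of_deriv_le_sin_mul_cos (F := fun θ => -F θ) (D := fun θ => -D θ) (c := -c)
    (fun θ => (hF θ).neg) (fun θ h => by linarith [hD θ h])
  linarith

end TrigComparison

section Interpolation

variable {P : Measure ℝ} [IsProbabilityMeasure P] {S : ℝ} {n : ℕ}

lemma spikeAmplitude_pi_div_two (q : ℝ) :
    spikeAmplitude n q (Real.pi / 2) = Sum.elim (fun _ => 1) (fun _ => 0) := by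
  simp [spikeAmplitude]

lemma spikeAmplitude_zero (q : ℝ) :
    spikeAmplitude n q 0 = Sum.elim (fun _ => 0) (fun _ => Real.sqrt q) := by
  simp [spikeAmplitude]

lemma modelFreeEnergy_spike_pi_div_two {μ : Measure (Fin n → ℝ)} [IsFiniteMeasure μ] (q : ℝ)
    (p : (Fin n × Fin n) ⊕ Fin n → ℝ) :
    modelFreeEnergy μ (spikeCoupling n) (spikeAmplitude n q (Real.pi / 2)) p
      = modelFreeEnergy μ (matrixCoupling n) (fun _ => 1) (fun e => p (Sum.inl e)) := by
  rw [spikeAmplitude_pi_div_two]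
  exact modelFreeEnergy_sum_inl _ _ measurable_matrixCoupling _ _

lemma modelFreeEnergy_spike_zero {μ : Measure (Fin n → ℝ)} [IsFiniteMeasure μ] (q : ℝ)
    (p : (Fin n × Fin n) ⊕ Fin n → ℝ) :
    modelFreeEnergy μ (spikeCoupling n) (spikeAmplitude n q 0) p
      = modelFreeEnergy μ (fun i x => x i) (fun _ => Real.sqrt q) (fun i => p (Sum.inr i)) := by
  rw [spikeAmplitude_zero]
  exact modelFreeEnergy_sum_inr _ _ measurable_pi_apply _ _

lemma integrable_scalarFreeEnergy {Q : Measure ℝ} [IsProbabilityMeasure Q]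
    (hP : ∀ᵐ x ∂P, |x| ≤ S) (hQ : ∀ᵐ x ∂Q, |x| ≤ S) (hS : 0 ≤ S) (s : ℝ) :
    Integrable (fun X => scalarFreeEnergy P s X) Q :=
  integrable_modelFreeEnergy (NeZero.ne P) (fun _ => measurable_id) (scalar_bound hP) hS _
    (p := fun X _ => X) (measurable_pi_iff.2 fun _ => measurable_id) (scalar_bound hQ)

omit [IsProbabilityMeasure P] in
lemma le_integral_integral {E G : Type*} [MeasurableSpace E] [MeasurableSpace G] {μ : Measure E}
    [IsProbabilityMeasure μ] {ν : Measure G} [IsProbabilityMeasure ν] {Q : E → G → ℝ} {R c : ℝ}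
    (hQm : Measurable (Function.uncurry Q)) (hQb : ∀ X g, |Q X g| ≤ R) (hc : ∀ X g, c ≤ Q X g) :
    c ≤ ∫ X, (∫ g, Q X g ∂ν) ∂μ := by
  have h1 : ∀ X, c ≤ ∫ g, Q X g ∂ν := fun X => by
    have hi : Integrable (Q X) ν := Integrable.of_bound
      (hQm.comp measurable_prodMk_left).aestronglyMeasurable R (Filter.Eventually.of_forall (hQb X))
    simpa using integral_mono (integrable_const c) hi (hc X)
  have hi2 : Integrable (fun X => ∫ g, Q X g ∂ν) μ :=
    Integrable.of_bound (hQm.stronglyMeasurable.integral_prod_right').aestronglyMeasurable R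
      (Filter.Eventually.of_forall fun X => by
        simpa using norm_integral_le_of_norm_le_const (μ := ν) (f := Q X) (C := R)
          (Filter.Eventually.of_forall (hQb X)))
  simpa using integral_mono (integrable_const c) hi2 h1

/-- Interpolation bound: the scalar channels give a lower bound on the mean log-partition
function. -/
lemma le_integral_modelFreeEnergy_matrix (hP : ∀ᵐ x ∂P, |x| ≤ S) (hS : 0 ≤ S) (hn : 0 < n)
    {q : ℝ} (hq : 0 ≤ q) :
    n * (∫ X, scalarFreeEnergy P (Real.sqrt q) X ∂P) - n * q ^ 2 / 4
      ≤ ∫ X, modelFreeEnergy (Measure.pi fun _ : Fin n => P) (matrixCoupling n) (fun _ => 1)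
          (fun e => matrixCoupling n e X) ∂(Measure.pi fun _ : Fin n => P) := by
  set μ := Measure.pi fun _ : Fin n => P
  have hμ : μ ≠ 0 := NeZero.ne μ
  have hn' : (0 : ℝ) < n := by exact_mod_cast hn
  have hae : ∀ᵐ x ∂μ, ∀ i, |x i| ≤ S := ae_pi_abs_le hP
  have hC : ∀ᵐ x ∂μ, ∀ k, |spikeCoupling n k x| ≤ S ^ 2 + S :=
    hae.mono fun x hx => abs_spikeCoupling_le hn hx
  have hC0 : 0 ≤ S ^ 2 + S := by positivity
  have hm := measurable_spikeCoupling (n := n)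
  have hder := fun θ => hasDerivAt_integral_modelFreeEnergy (ν := μ) (μ := μ) hμ hm hC hC0
    (hasDerivAt_spikeAmplitude (n := n) q) θ (fun t _ k => abs_spikeAmplitude_le q t k)
    (p := fun X k => spikeCoupling n k X) (measurable_pi_iff.2 hm) hC
  have key := add_le_of_le_deriv_sin_mul_cos (c := -(n * q ^ 2 / 2)) hder fun θ hθ => ?_
  · simp_rw [modelFreeEnergy_spike_pi_div_two, modelFreeEnergy_spike_zero] at key
    have e1 : ∀ X : Fin n → ℝ, modelFreeEnergy μ (fun i x => x i) (fun _ => Real.sqrt q)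
        (fun i => spikeCoupling n (Sum.inr i) X)
        = ∑ i, scalarFreeEnergy P (Real.sqrt q) (X i) := fun X =>
      modelFreeEnergy_coordinates hP _ _
    have e2 : ∫ X, ∑ i, scalarFreeEnergy P (Real.sqrt q) (X i) ∂μ
        = n * ∫ X, scalarFreeEnergy P (Real.sqrt q) X ∂P := by
      have hi := integrable_scalarFreeEnergy hP hP hS (Real.sqrt q)
      have hpre := fun i => measurePreserving_eval (fun _ : Fin n => P) i
      have hi' : ∀ i, Integrable (fun X : Fin n → ℝ => scalarFreeEnergy P (Real.sqrt q) (X i)) μ :=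
        fun i => (hpre i).integrable_comp_of_integrable hi
      rw [integral_finsetSum _ fun i _ => hi' i]
      have : ∀ i, ∫ X, scalarFreeEnergy P (Real.sqrt q) (X i) ∂μ
          = ∫ X, scalarFreeEnergy P (Real.sqrt q) X ∂P := fun i =>
        integral_comp_eval (μ := fun _ : Fin n => P) (i := i) hi.aestronglyMeasurable
      simp [this]
    simp_rw [e1, e2] at key
    have e3 : ∀ X : Fin n → ℝ, (fun e => spikeCoupling n (Sum.inl e) X)
      = fun e => matrixCoupling n e X := fun X => rfl
    simp_rw [e3] at key
    linarith
  · rw [integral_freeEnergyDerivative_planted hm hC hC0]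
    have hpt : ∀ X g, Real.sin θ * Real.cos θ * -(n * q ^ 2 / 2)
        ≤ ∑ k, spikeAmplitude n q θ k * spikeAmplitudeDeriv n q θ k
          * gibbs μ (spikeCoupling n) (spikeAmplitude n q θ)
            (fun k => spikeCoupling n k X) g (spikeCoupling n k) ^ 2 := fun X g => by
      set a := spikeAmplitude n q θ
      set p : (Fin n × Fin n) ⊕ Fin n → ℝ := fun k => spikeCoupling n k X
      have h4 := gibbs_mean_pow_four_le hμ hm hC hae a p g
      set b : Fin n → ℝ := fun i => gibbs μ (spikeCoupling n) a p g (fun x => x i)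
      set M : Fin n → Fin n → ℝ := fun i j => gibbs μ (spikeCoupling n) a p g (fun x => x i * x j)
      have hsum : ∑ k, spikeAmplitude n q θ k * spikeAmplitudeDeriv n q θ k
          * gibbs μ (spikeCoupling n) a p g (spikeCoupling n k) ^ 2
          = Real.sin θ * Real.cos θ * (1 / n * (∑ e : Fin n × Fin n,
              if e.1 ≤ e.2 then M e.1 e.2 ^ 2 else 0) - q * ∑ i, b i ^ 2) := by
        rw [Fintype.sum_sum_type]
        have s1 : ∀ e : Fin n × Fin n, spikeAmplitude n q θ (Sum.inl e)
            * spikeAmplitudeDeriv n q θ (Sum.inl e)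
            * gibbs μ (spikeCoupling n) a p g (spikeCoupling n (Sum.inl e)) ^ 2
            = Real.sin θ * Real.cos θ * (1 / n * if e.1 ≤ e.2 then M e.1 e.2 ^ 2 else 0) := by
          intro e
          change Real.sin θ * Real.cos θ
            * gibbs μ (spikeCoupling n) a p g (matrixCoupling n e) ^ 2 = _
          rw [gibbs_matrixCoupling]
          split_ifs
          · rw [div_pow, Real.sq_sqrt hn'.le]
            ring
          · ring
        have s2 : ∀ i : Fin n, spikeAmplitude n q θ (Sum.inr i)
            * spikeAmplitudeDeriv n q θ (Sum.inr i)
            * gibbs μ (spikeCoupling n) a p g (spikeCoupling n (Sum.inr i)) ^ 2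
            = Real.sin θ * Real.cos θ * (-q * b i ^ 2) := by
          intro i
          change Real.sqrt q * Real.cos θ * -(Real.sqrt q * Real.sin θ) * b i ^ 2 = _
          linear_combination (-Real.cos θ * Real.sin θ * b i ^ 2) * Real.mul_self_sqrt hq
        simp_rw [s1, s2, ← Finset.mul_sum]
        ring
      rw [hsum]
      refine mul_le_mul_of_nonneg_left ?_ hθ
      have hsym := two_mul_sum_upper (T := fun i j => M i j ^ 2) fun i j => by
        have : M i j = M j i := by
          simp only [M]
          congr 1
          ext x
          ring
        rw [this]
      have hdiag : 0 ≤ ∑ i, M i i ^ 2 := Finset.sum_nonneg fun i _ => sq_nonneg _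
      set B := ∑ i, b i ^ 2
      set U := ∑ e : Fin n × Fin n, if e.1 ≤ e.2 then M e.1 e.2 ^ 2 else 0
      have hU : B ^ 2 ≤ 2 * U := by
        rw [hsym]
        linarith
      have : 0 ≤ (B - n * q) ^ 2 := sq_nonneg _
      rw [one_div, ← sub_nonneg]
      have e : (n : ℝ)⁻¹ * U - q * B - -(n * q ^ 2 / 2)
          = (n : ℝ)⁻¹ * (U - n * q * B + (n * q) ^ 2 / 2) := by
        field_simp
        ring
      rw [e]
      refine mul_nonneg (inv_nonneg.2 hn'.le) ?_
      nlinarith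
    refine le_integral_integral (R := ∑ k, |spikeAmplitude n q θ k * spikeAmplitudeDeriv n q θ k|
      * (S ^ 2 + S) ^ 2) (ν := Measure.pi fun _ => stdGauss) (Finset.measurable_sum _ fun k _ => ?_)
      (fun X g => (Finset.abs_sum_le_sum_abs _ _).trans (Finset.sum_le_sum fun k _ => ?_)) hpt
    · have hmeas : Measurable fun w : (Fin n → ℝ) × (((Fin n × Fin n) ⊕ Fin n) → ℝ) =>
          gibbs μ (spikeCoupling n) (spikeAmplitude n q θ) (fun k => spikeCoupling n k w.1) w.2
            (spikeCoupling n k) :=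
        measurable_gibbs hm _ (measurable_pi_iff.2 fun k => (hm k).comp measurable_fst)
          measurable_snd (hm k)
      exact (hmeas.pow_const 2).const_mul _
    · rw [abs_mul, abs_pow]
      have := abs_gibbs_le hμ hm hC (spikeAmplitude n q θ) (fun k => spikeCoupling n k X) g
        (hC.mono fun x hx => hx k)
      gcongr

end Interpolation

section RestrictedModel

variable {K E : Type*} [Fintype K] [MeasurableSpace E]
variable {μ : Measure E} [IsFiniteMeasure μ] {h : K → E → ℝ} {C : ℝ}

lemma modelPartition_restrict_le (hm : ∀ k, Measurable (h k))
    (hC : ∀ᵐ x ∂μ, ∀ k, |h k x| ≤ C) (a p g : K → ℝ) (B : Set E) :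
    modelPartition (μ.restrict B) h a p g ≤ modelPartition μ h a p g :=
  setIntegral_le_integral
    (integrable_exp_of_bound (measurable_modelExponent hm a p g) (modelExponent_bound hC a p g))
    (Filter.Eventually.of_forall fun _ => (Real.exp_pos _).le)

lemma modelFreeEnergy_restrict_le (hm : ∀ k, Measurable (h k))
    (hC : ∀ᵐ x ∂μ, ∀ k, |h k x| ≤ C) (a p : K → ℝ) {B : Set E} (hB : μ.restrict B ≠ 0) :
    modelFreeEnergy (μ.restrict B) h a p ≤ modelFreeEnergy μ h a p := by
  have hμ : μ ≠ 0 := by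
    rintro rfl
    simp at hB
  have hCB := ae_restrict_of_ae (s := B) hC
  exact integral_mono (integrable_log_modelPartition hB hm hCB a p)
    (integrable_log_modelPartition hμ hm hC a p) fun g =>
      Real.log_le_log (modelPartition_pos hB hm hCB a p g)
        (modelPartition_restrict_le hm hC a p g B)

end RestrictedModel

section FixedOverlap

variable {S : ℝ} {n : ℕ} {μ : Measure (Fin n → ℝ)} [IsFiniteMeasure μ]

lemma gibbs_sq_overlap_le {K : Type*} [Fintype K] {h : K → (Fin n → ℝ) → ℝ} {C : ℝ}
    (hμ : μ ≠ 0) (hm : ∀ k, Measurable (h k)) (hC : ∀ᵐ x ∂μ, ∀ k, |h k x| ≤ C)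
    (a p g : K → ℝ) {w : (Fin n → ℝ) → ℝ} (hw : Measurable w) {m ε : ℝ}
    (hR : ∀ᵐ x ∂μ, |w x - m| ≤ ε) :
    gibbs μ h a p g (fun x => w x ^ 2) ≤ ε ^ 2 + (2 * m * gibbs μ h a p g w - m ^ 2) := by
  have hwb : ∀ᵐ x ∂μ, |w x| ≤ |m| + ε := hR.mono fun x hx => by
    have := abs_add_le (w x - m) m
    rw [sub_add_cancel] at this
    linarith
  have hlin : gibbs μ h a p g (fun x => 2 * m * w x + (ε ^ 2 - m ^ 2))
      = 2 * m * gibbs μ h a p g w + (ε ^ 2 - m ^ 2) := by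
    rw [gibbs_add hm hC a p g (f := fun x => 2 * m * w x) (f' := fun _ => ε ^ 2 - m ^ 2)
      (F := |2 * m| * (|m| + ε)) (F' := |ε ^ 2 - m ^ 2|) (hw.const_mul _) measurable_const
      (hwb.mono fun x hx => by rw [abs_mul]; gcongr) (Filter.Eventually.of_forall fun _ => le_rfl),
      gibbs_const_mul, gibbs_const hμ hm hC]
  have hmono := gibbs_mono hμ hm hC a p g (f := fun x => w x ^ 2)
    (f' := fun x => 2 * m * w x + (ε ^ 2 - m ^ 2)) (F := (|m| + ε) ^ 2)
    (F' := |2 * m| * (|m| + ε) + |ε ^ 2 - m ^ 2|)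
    (hw.pow_const 2) ((hw.const_mul _).add_const _) (ae_abs_sq_le hwb)
    (hwb.mono fun x hx => (abs_add_le _ _).trans (by rw [abs_mul]; gcongr))
    (hR.mono fun x hx => by
      have := sq_le_sq' (abs_le.1 hx).1 (abs_le.1 hx).2
      nlinarith)
  rw [hlin] at hmono
  linarith

/-- Pointwise bound on the integrand of the derivative of the interpolating free energy when the
overlap is constrained. -/
lemma spike_sum_le (hn : 0 < n) {X : Fin n → ℝ} (hX : ∀ i, |X i| ≤ S) (hμ : μ ≠ 0)
    (hae : ∀ᵐ x ∂μ, ∀ i, |x i| ≤ S) {m ε : ℝ}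
    (hR : ∀ᵐ x ∂μ, |(∑ i, X i * x i) / n - m| ≤ ε) {q σ : ℝ} (hq : 0 ≤ q) (hσ : σ * q = m)
    (hσ2 : σ ^ 2 = 1) {θ : ℝ} (hθ : 0 ≤ Real.sin θ * Real.cos θ)
    (p g : (Fin n × Fin n) ⊕ Fin n → ℝ)
    (hp : p = Sum.elim (fun e => matrixCoupling n e X) (fun i => σ * X i)) :
    ∑ k, spikeAmplitude n q θ k * spikeAmplitudeDeriv n q θ k
        * (2 * p k * gibbs μ (spikeCoupling n) (spikeAmplitude n q θ) p g (spikeCoupling n k)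
          - gibbs μ (spikeCoupling n) (spikeAmplitude n q θ) p g (spikeCoupling n k) ^ 2)
      ≤ Real.sin θ * Real.cos θ * (n * ε ^ 2 - n * m ^ 2 / 2 + S ^ 4 / 2) := by
  have hn' : (0 : ℝ) < n := by exact_mod_cast hn
  have hC : ∀ᵐ x ∂μ, ∀ k, |spikeCoupling n k x| ≤ S ^ 2 + S :=
    hae.mono fun x hx => abs_spikeCoupling_le hn hx
  have hm := measurable_spikeCoupling (n := n)
  set a := spikeAmplitude n q θ with ha
  have h4 := gibbs_mean_pow_four_le hμ hm hC hae a p g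
  obtain ⟨hA1, hA2⟩ := gibbs_second_moment hm hC hae a p g X
  have hA := gibbs_sq_overlap_le hμ hm hC a p g (w := fun x => (∑ i, X i * x i) / n)
    (by fun_prop) hR
  set b : Fin n → ℝ := fun i => gibbs μ (spikeCoupling n) a p g (fun x => x i)
  set M : Fin n → Fin n → ℝ := fun i j => gibbs μ (spikeCoupling n) a p g (fun x => x i * x j)
  have hA1' : gibbs μ (spikeCoupling n) a p g (fun x => (∑ i, X i * x i) / n)
      = (n : ℝ)⁻¹ * ∑ i, X i * b i := by
    rw [← hA1, ← gibbs_const_mul]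
    congr 1
    ext x
    ring
  have hA2' : gibbs μ (spikeCoupling n) a p g (fun x => ((∑ i, X i * x i) / n) ^ 2)
      = ((n : ℝ)⁻¹) ^ 2 * ∑ i, ∑ j, X i * X j * M i j := by
    rw [← hA2, ← gibbs_const_mul]
    congr 1
    ext x
    ring
  rw [hA1', hA2'] at hA
  set T : Fin n → Fin n → ℝ := fun i j => 2 * (X i * X j) * M i j - M i j ^ 2 with hT
  have hsum : ∑ k, a k * spikeAmplitudeDeriv n q θ k
        * (2 * p k * gibbs μ (spikeCoupling n) a p g (spikeCoupling n k)
          - gibbs μ (spikeCoupling n) a p g (spikeCoupling n k) ^ 2)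
      = Real.sin θ * Real.cos θ * ((n : ℝ)⁻¹ * (∑ e : Fin n × Fin n,
          if e.1 ≤ e.2 then T e.1 e.2 else 0)
          - (2 * m * ∑ i, X i * b i - q * ∑ i, b i ^ 2)) := by
    rw [Fintype.sum_sum_type]
    have s1 : ∀ e : Fin n × Fin n, a (Sum.inl e) * spikeAmplitudeDeriv n q θ (Sum.inl e)
        * (2 * p (Sum.inl e) * gibbs μ (spikeCoupling n) a p g (spikeCoupling n (Sum.inl e))
          - gibbs μ (spikeCoupling n) a p g (spikeCoupling n (Sum.inl e)) ^ 2)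
        = Real.sin θ * Real.cos θ * ((n : ℝ)⁻¹ * if e.1 ≤ e.2 then T e.1 e.2 else 0) := by
      intro e
      have hpe : p (Sum.inl e) = matrixCoupling n e X := by rw [hp]; rfl
      rw [hpe]
      change Real.sin θ * Real.cos θ
        * (2 * matrixCoupling n e X * gibbs μ (spikeCoupling n) a p g (matrixCoupling n e)
          - gibbs μ (spikeCoupling n) a p g (matrixCoupling n e) ^ 2) = _
      rw [gibbs_matrixCoupling, matrixCoupling]
      split_ifs
      · change Real.sin θ * Real.cos θ * (2 * (X e.1 * X e.2 / Real.sqrt n)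
          * (M e.1 e.2 / Real.sqrt n) - (M e.1 e.2 / Real.sqrt n) ^ 2) = _
        have hs : Real.sqrt n ^ 2 = n := Real.sq_sqrt hn'.le
        have hs0 : Real.sqrt n ≠ 0 := (Real.sqrt_pos.2 hn').ne'
        simp only [hT]
        rw [show (n : ℝ)⁻¹ = (Real.sqrt n ^ 2)⁻¹ by rw [hs]]
        field_simp
      · ring
    have s2 : ∀ i : Fin n, a (Sum.inr i) * spikeAmplitudeDeriv n q θ (Sum.inr i)
        * (2 * p (Sum.inr i) * gibbs μ (spikeCoupling n) a p g (spikeCoupling n (Sum.inr i))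
          - gibbs μ (spikeCoupling n) a p g (spikeCoupling n (Sum.inr i)) ^ 2)
        = Real.sin θ * Real.cos θ * (-2 * m * (X i * b i) + q * b i ^ 2) := by
      intro i
      have hpe : p (Sum.inr i) = σ * X i := by rw [hp]; rfl
      rw [hpe, ← hσ]
      change Real.sqrt q * Real.cos θ * -(Real.sqrt q * Real.sin θ)
        * (2 * (σ * X i) * b i - b i ^ 2) = _
      linear_combination (-Real.cos θ * Real.sin θ * (2 * (σ * X i) * b i - b i ^ 2))
        * Real.mul_self_sqrt hq
    simp_rw [s1, s2, ← Finset.mul_sum, Finset.sum_add_distrib, ← Finset.mul_sum]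
    ring
  rw [hsum]
  refine mul_le_mul_of_nonneg_left ?_ hθ
  have hsym := two_mul_sum_upper (T := T) fun i j => by
    have : M i j = M j i := by
      simp only [M]
      congr 1
      ext x
      ring
    simp only [hT]
    rw [this]
    ring
  have hdiag : ∑ i, T i i ≤ n * S ^ 4 := by
    have : ∀ i ∈ (Finset.univ : Finset (Fin n)), T i i ≤ S ^ 4 := fun i _ => by
      have h1 : X i ^ 4 ≤ S ^ 4 := by
        have := pow_le_pow_left₀ (abs_nonneg _) (hX i) 4
        rwa [Even.pow_abs (by decide)] at this
      simp only [hT]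
      nlinarith [sq_nonneg (X i * X i - M i i)]
    have := Finset.sum_le_sum this
    simpa using this
  have hTT : ∑ i, ∑ j, T i j
      = 2 * ∑ i, ∑ j, X i * X j * M i j - ∑ i, ∑ j, M i j ^ 2 := by
    simp only [hT, Finset.sum_sub_distrib, Finset.mul_sum, mul_assoc]
  set B := ∑ i, b i ^ 2
  set A := ∑ i, X i * b i
  set Q := ∑ i, ∑ j, X i * X j * M i j
  set U := ∑ e : Fin n × Fin n, if e.1 ≤ e.2 then T e.1 e.2 else 0
  have hQ : Q ≤ n ^ 2 * ε ^ 2 + 2 * n * m * A - n ^ 2 * m ^ 2 := by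
    have := mul_le_mul_of_nonneg_left hA (sq_nonneg (n : ℝ))
    field_simp at this
    nlinarith
  have hU : 2 * U ≤ 2 * Q - B ^ 2 + n * S ^ 4 := by
    rw [hsym, hTT]
    linarith
  have hmq : m ^ 2 = q ^ 2 := by
    rw [← hσ, mul_pow, hσ2, one_mul]
  have hB : 0 ≤ (B - n * q) ^ 2 := sq_nonneg _
  rw [← sub_nonneg]
  have e : n * ε ^ 2 - n * m ^ 2 / 2 + S ^ 4 / 2 - ((n : ℝ)⁻¹ * U - (2 * m * A - q * B))
      = (n : ℝ)⁻¹ * (n ^ 2 * ε ^ 2 - n ^ 2 * m ^ 2 / 2 + n * S ^ 4 / 2 - U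
        + n * (2 * m * A - q * B)) := by
    field_simp
    ring
  rw [e]
  refine mul_nonneg (inv_nonneg.2 hn'.le) ?_
  have hmq' : (n : ℝ) ^ 2 * m ^ 2 = n ^ 2 * q ^ 2 := by rw [hmq]
  nlinarith

/-- Interpolation bound for a prior constrained to configurations of almost constant overlap. -/
lemma modelFreeEnergy_matrix_le_of_overlap (hn : 0 < n) (hS : 0 ≤ S) {X : Fin n → ℝ}
    (hX : ∀ i, |X i| ≤ S) (hμ : μ ≠ 0)
    (hae : ∀ᵐ x ∂μ, ∀ i, |x i| ≤ S) {m ε : ℝ}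
    (hR : ∀ᵐ x ∂μ, |(∑ i, X i * x i) / n - m| ≤ ε) {q σ : ℝ} (hq : 0 ≤ q) (hσ : σ * q = m)
    (hσ2 : σ ^ 2 = 1) :
    modelFreeEnergy μ (matrixCoupling n) (fun _ => 1) (fun e => matrixCoupling n e X)
      ≤ modelFreeEnergy μ (fun i x => x i) (fun _ => Real.sqrt q) (fun i => σ * X i)
        + (n * ε ^ 2 - n * m ^ 2 / 2 + S ^ 4 / 2) / 2 := by
  have hC : ∀ᵐ x ∂μ, ∀ k, |spikeCoupling n k x| ≤ S ^ 2 + S :=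
    hae.mono fun x hx => abs_spikeCoupling_le hn hx
  have hC0 : 0 ≤ S ^ 2 + S := by positivity
  have hm := measurable_spikeCoupling (n := n)
  set p : (Fin n × Fin n) ⊕ Fin n → ℝ :=
    Sum.elim (fun e => matrixCoupling n e X) (fun i => σ * X i) with hp
  have key := le_add_of_deriv_le_sin_mul_cos
    (F := fun θ => modelFreeEnergy μ (spikeCoupling n) (spikeAmplitude n q θ) p)
    (c := n * ε ^ 2 - n * m ^ 2 / 2 + S ^ 4 / 2)
    (fun θ => hasDerivAt_modelFreeEnergy hμ hm hC
    (hasDerivAt_spikeAmplitude (n := n) q) θ (fun t _ k => abs_spikeAmplitude_le q t k) p)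
    fun θ hθ => ?_
  · simp only [modelFreeEnergy_spike_pi_div_two, modelFreeEnergy_spike_zero] at key
    exact key
  · have m1 : ∀ k, Measurable fun g =>
        gibbs μ (spikeCoupling n) (spikeAmplitude n q θ) p g (spikeCoupling n k) := fun k =>
      measurable_gibbs hm _ measurable_const measurable_id (hm k)
    have b1 : ∀ k g,
        |gibbs μ (spikeCoupling n) (spikeAmplitude n q θ) p g (spikeCoupling n k)| ≤ S ^ 2 + S :=
      fun k g => abs_gibbs_le hμ hm hC _ _ g (hC.mono fun x hx => hx k)
    have i1 := fun k => integrable_pi_of_bound (m1 k) (b1 k)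
    have i2 := fun k => integrable_pi_of_bound (f := fun g =>
      gibbs μ (spikeCoupling n) (spikeAmplitude n q θ) p g (spikeCoupling n k) ^ 2)
      (B := (S ^ 2 + S) ^ 2) ((m1 k).pow_const 2) fun g => by
        rw [abs_pow]
        exact pow_le_pow_left₀ (abs_nonneg _) (b1 k g) 2
    unfold freeEnergyDerivative
    have := integral_mono (μ := Measure.pi fun _ : (Fin n × Fin n) ⊕ Fin n => stdGauss)
      (integrable_finsetSum Finset.univ fun k _ =>
        (((i1 k).const_mul (2 * p k)).sub (i2 k)).const_mul
          (spikeAmplitude n q θ k * spikeAmplitudeDeriv n q θ k))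
      (integrable_const (Real.sin θ * Real.cos θ * (n * ε ^ 2 - n * m ^ 2 / 2 + S ^ 4 / 2)))
      (fun g => ?_)
    · refine le_trans (le_of_eq ?_) (this.trans (le_of_eq (by simp)))
      simp only [Pi.sub_apply]
    · have := spike_sum_le hn hX hμ hae hR hq hσ hσ2 hθ p g hp
      simpa only [Finset.sum_apply, Pi.sub_apply] using this

end FixedOverlap

section LipschitzModel

variable {K E : Type*} [Fintype K] [MeasurableSpace E]
variable {μ : Measure E} [IsFiniteMeasure μ] {h : K → E → ℝ} {C : ℝ}

lemma abs_log_modelPartition_sub_le (hμ : μ ≠ 0) (hm : ∀ k, Measurable (h k))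
    (hC : ∀ᵐ x ∂μ, ∀ k, |h k x| ≤ C) (a p p' g g' : K → ℝ) :
    |Real.log (modelPartition μ h a p g) - Real.log (modelPartition μ h a p' g')|
      ≤ ∑ k, (|a k| * |g k - g' k| + a k ^ 2 * |p k - p' k|) * C := by
  refine abs_log_integral_exp_sub_le hμ (measurable_modelExponent hm a p g)
    (measurable_modelExponent hm a p' g') (modelExponent_bound hC a p g)
    (modelExponent_bound hC a p' g') (hC.mono fun x hx => ?_)
  unfold modelExponent
  rw [← Finset.sum_sub_distrib]
  refine (Finset.abs_sum_le_sum_abs _ _).trans (Finset.sum_le_sum fun k _ => ?_)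
  have e : a k * g k * h k x + a k ^ 2 * (p k * h k x - h k x ^ 2 / 2)
      - (a k * g' k * h k x + a k ^ 2 * (p' k * h k x - h k x ^ 2 / 2))
      = (a k * (g k - g' k) + a k ^ 2 * (p k - p' k)) * h k x := by ring
  rw [e, abs_mul]
  have h1 : |a k * (g k - g' k) + a k ^ 2 * (p k - p' k)|
      ≤ |a k| * |g k - g' k| + a k ^ 2 * |p k - p' k| := by
    refine (abs_add_le _ _).trans (le_of_eq ?_)
    rw [abs_mul, abs_mul, abs_of_nonneg (sq_nonneg (a k))]
  exact mul_le_mul h1 (hx k) (abs_nonneg _) (by positivity)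

lemma abs_modelFreeEnergy_sub_le (hμ : μ ≠ 0) (hm : ∀ k, Measurable (h k))
    (hC : ∀ᵐ x ∂μ, ∀ k, |h k x| ≤ C) (a p p' : K → ℝ) :
    |modelFreeEnergy μ h a p - modelFreeEnergy μ h a p'| ≤ ∑ k, a k ^ 2 * |p k - p' k| * C := by
  unfold modelFreeEnergy
  rw [← integral_sub (integrable_log_modelPartition hμ hm hC a p)
    (integrable_log_modelPartition hμ hm hC a p')]
  refine abs_integral_pi_le fun g => ?_
  simpa using abs_log_modelPartition_sub_le hμ hm hC a p p' g g

end LipschitzModel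

section PosteriorVariance

variable {K E : Type*} [Fintype K] [MeasurableSpace E]
variable {μ : Measure E} [IsProbabilityMeasure μ] {h : K → E → ℝ} {C : ℝ}

lemma integral_sq_gibbs_le (hm : ∀ k, Measurable (h k)) (hC : ∀ᵐ x ∂μ, ∀ k, |h k x| ≤ C)
    (hC0 : 0 ≤ C) (a : K → ℝ) {f : E → ℝ} (hf : Measurable f) {F : ℝ}
    (hfb : ∀ᵐ x ∂μ, |f x| ≤ F) :
    ∫ X, (∫ g, gibbs μ h a (fun k => h k X) g f ^ 2 ∂(Measure.pi fun _ : K => stdGauss)) ∂μ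
      ≤ ∫ X, f X ^ 2 ∂μ := by
  have hμ : μ ≠ 0 := NeZero.ne μ
  have hp : Measurable fun X k => h k X := measurable_pi_iff.2 hm
  have b1 : ∀ X g, |gibbs μ h a (fun k => h k X) g f| ≤ F := fun X g =>
    abs_gibbs_le hμ hm hC a _ g hfb
  have hF : 0 ≤ F := (abs_nonneg _).trans (b1 (Classical.choice (μ.nonempty_of_neZero)) 0)
  have b2 : ∀ X g, |gibbs μ h a (fun k => h k X) g f ^ 2| ≤ F ^ 2 := fun X g => by
    rw [abs_pow]; exact pow_le_pow_left₀ (abs_nonneg _) (b1 X g) 2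
  have m1 : ∀ X, Measurable fun g => gibbs μ h a (fun k => h k X) g f := fun X =>
    measurable_gibbs hm a measurable_const measurable_id hf
  have i1 := fun X => integrable_pi_of_bound (m1 X) (b1 X)
  have i2 := fun X => integrable_pi_of_bound ((m1 X).pow_const 2) (b2 X)
  set G : E → ℝ := fun X => ∫ g, gibbs μ h a (fun k => h k X) g f
    ∂(Measure.pi fun _ : K => stdGauss)
  set Q : E → ℝ := fun X => ∫ g, gibbs μ h a (fun k => h k X) g f ^ 2
    ∂(Measure.pi fun _ : K => stdGauss)
  have mG : Measurable G := measurable_integral_gibbs hm a hp hf id measurable_id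
  have mQ : Measurable Q := measurable_integral_gibbs hm a hp hf (fun t => t ^ 2) (by fun_prop)
  have iQ : Integrable Q μ := Integrable.of_bound mQ.aestronglyMeasurable (F ^ 2)
    (Filter.Eventually.of_forall fun X => abs_integral_pi_le (b2 X))
  have iG : Integrable (fun X => f X * G X) μ :=
    Integrable.of_bound (hf.mul mG).aestronglyMeasurable (F * F) (hfb.mono fun X hX => by
      rw [norm_mul]
      exact mul_le_mul hX (abs_integral_pi_le (b1 X)) (abs_nonneg _) hF)
  have i_f : Integrable (fun X => f X ^ 2) μ :=
    Integrable.of_bound (hf.pow_const 2).aestronglyMeasurable (F ^ 2) (ae_abs_sq_le hfb)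
  have hpt : ∀ X, 2 * (f X * G X) ≤ f X ^ 2 + Q X := fun X => by
    have i3 : Integrable (fun g => 2 * f X * gibbs μ h a (fun k => h k X) g f)
      (Measure.pi fun _ : K => stdGauss) := (i1 X).const_mul _
    have i4 : Integrable (fun g => f X ^ 2 + gibbs μ h a (fun k => h k X) g f ^ 2)
      (Measure.pi fun _ : K => stdGauss) := (integrable_const _).add (i2 X)
    have := integral_mono i3 i4 fun g => two_mul_le_add_sq _ _
    rw [integral_const_mul, integral_add (integrable_const _) (i2 X)] at this
    simp only [integral_const, probReal_univ, one_smul] at this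
    rw [← mul_assoc]
    exact this
  have i5 : Integrable (fun X => f X ^ 2 + Q X) μ := i_f.add iQ
  have := integral_mono (iG.const_mul 2) i5 hpt
  rw [integral_const_mul, integral_add i_f iQ] at this
  have hN := nishimori hm hC hC0 a hf hfb
  change ∫ X, f X * G X ∂μ = ∫ X, Q X ∂μ at hN
  rw [hN] at this
  linarith

end PosteriorVariance

section Scalar

variable {P : Measure ℝ} [IsProbabilityMeasure P] {S : ℝ}

lemma abs_scalarFreeEnergy_sub_le (hP : ∀ᵐ x ∂P, |x| ≤ S) (s p p' : ℝ) :
    |scalarFreeEnergy P s p - scalarFreeEnergy P s p'| ≤ s ^ 2 * S * |p - p'| := by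
  have := abs_modelFreeEnergy_sub_le (NeZero.ne P) (h := fun (_ : Unit) x => x)
    (fun _ => measurable_id) (scalar_bound hP) (fun _ => s) (fun _ => p) (fun _ => p')
  refine this.trans (le_of_eq ?_)
  simp
  ring

lemma integral_scalarFreeEnergy_neg_le (hP : ∀ᵐ x ∂P, |x| ≤ S) (hS : 0 ≤ S) (s : ℝ) :
    ∫ X, scalarFreeEnergy P s (-X) ∂P ≤ ∫ X, scalarFreeEnergy P s X ∂P :=
  integral_modelFreeEnergy_neg_le (h := fun (_ : Unit) x => x)
    (fun _ => measurable_id) (scalar_bound hP) hS fun _ => s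

/-- The mean scalar free energy grows at most linearly in the signal-to-noise ratio, with slope half
the second moment. -/
lemma integral_scalarFreeEnergy_le (hP : ∀ᵐ x ∂P, |x| ≤ S) (hS : 0 ≤ S) {s t : ℝ} (hs : 0 ≤ s)
    (hst : s ≤ t) :
    ∫ X, scalarFreeEnergy P t X ∂P
      ≤ ∫ X, scalarFreeEnergy P s X ∂P + (t ^ 2 - s ^ 2) / 2 * ∫ x, x ^ 2 ∂P := by
  set ρ := ∫ x, x ^ 2 ∂P
  have hm : ∀ _ : Unit, Measurable fun x : ℝ => x := fun _ => measurable_id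
  have hder : ∀ u, HasDerivAt (fun u => ∫ X, scalarFreeEnergy P u X ∂P)
      (∫ X, freeEnergyDerivative P (fun (_ : Unit) x => x) (fun _ => u) (fun _ => 1) (fun _ => X) ∂P)
      u := fun u => hasDerivAt_integral_modelFreeEnergy (ν := P) (NeZero.ne P) hm
        (scalar_bound hP) hS (a := fun u _ => u) (a' := fun _ _ => 1) (A := |u| + 4)
        (fun t _ => hasDerivAt_id t) u (fun t ht _ => by
          rw [Metric.mem_ball, Real.dist_eq] at ht
          have := abs_add_le (t - u) u
          rw [sub_add_cancel] at this
          refine ⟨by linarith, ?_⟩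
          rw [abs_one]
          linarith [abs_nonneg u]) (p := fun X _ => X) (measurable_pi_iff.2 hm) (scalar_bound hP)
  have hD : ∀ u, 0 ≤ u →
      ∫ X, freeEnergyDerivative P (fun (_ : Unit) x => x) (fun _ => u) (fun _ => 1) (fun _ => X) ∂P
        ≤ u * ρ := fun u hu => by
    have e := integral_freeEnergyDerivative_planted hm (scalar_bound hP) hS (fun _ => u) fun _ => 1
    rw [e]
    simp only [Finset.univ_unique, Finset.sum_singleton, mul_one, integral_const_mul]
    exact mul_le_mul_of_nonneg_left (integral_sq_gibbs_le hm (scalar_bound hP) hS (fun _ => u)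
      measurable_id hP) hu
  have hd : ∀ u, HasDerivAt (fun u => ∫ X, scalarFreeEnergy P u X ∂P - u ^ 2 / 2 * ρ)
      ((∫ X, freeEnergyDerivative P (fun (_ : Unit) x => x) (fun _ => u) (fun _ => 1)
        (fun _ => X) ∂P) - u * ρ) u := fun u => by
    refine ((hder u).sub ((((hasDerivAt_id u).pow 2).div_const 2).mul_const ρ)).congr_deriv ?_
    simp
  have hanti : AntitoneOn (fun u => ∫ X, scalarFreeEnergy P u X ∂P - u ^ 2 / 2 * ρ)
      (Set.Ici 0) := by
    refine antitoneOn_of_deriv_nonpos (convex_Ici _)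
      (fun u _ => (hd u).continuousAt.continuousWithinAt)
      (fun u _ => (hd u).differentiableAt.differentiableWithinAt) fun u hu => ?_
    rw [interior_Ici] at hu
    rw [(hd u).deriv]
    linarith [hD u (le_of_lt hu)]
  have := hanti (Set.mem_Ici.2 hs) (Set.mem_Ici.2 (hs.trans hst)) hst
  simp only at this
  linarith

/-- The replica-symmetric potential with the inner supremum carried out. -/
noncomputable def reducedPotential (P : Measure ℝ) (r : ℝ) : ℝ :=
  r ^ 2 / 4 - ∫ X, scalarFreeEnergy P (Real.sqrt r) X ∂P

lemma sSup_fpotWS_eq {ρ r : ℝ} (hr : r ∈ Set.Icc 0 ρ) :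
    sSup ((fun q => fpotWS P q r) '' Set.Icc 0 ρ) = reducedPotential P r := by
  refine IsGreatest.csSup_eq ⟨⟨r, hr, ?_⟩, ?_⟩
  · simp only [fpotWS_eq hr.1, reducedPotential]
    ring
  · rintro _ ⟨q, -, rfl⟩
    simp only [fpotWS_eq hr.1, reducedPotential]
    nlinarith [sq_nonneg (q - r)]

lemma fws_le_reducedPotential (hP : ∀ᵐ x ∂P, |x| ≤ S) (hS : 0 ≤ S) {n : ℕ} (hn : 0 < n) {r : ℝ}
    (hr : 0 ≤ r) : fws P n ≤ reducedPotential P r := by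
  have hn' : (0 : ℝ) < n := by exact_mod_cast hn
  have := mul_le_mul_of_nonneg_left (le_integral_modelFreeEnergy_matrix hP hS hn hr)
    (one_div_pos.2 hn').le
  rw [fws_eq, reducedPotential]
  have e : 1 / (n : ℝ) * (n * (∫ X, scalarFreeEnergy P (Real.sqrt r) X ∂P) - n * r ^ 2 / 4)
      = (∫ X, scalarFreeEnergy P (Real.sqrt r) X ∂P) - r ^ 2 / 4 := by
    field_simp
  rw [e] at this
  linarith

lemma bddBelow_reducedPotential (hP : ∀ᵐ x ∂P, |x| ≤ S) (hS : 0 ≤ S) (ρ : ℝ) :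
    BddBelow (reducedPotential P '' Set.Icc 0 ρ) := by
  refine ⟨fws P 1, ?_⟩
  rintro _ ⟨r, hr, rfl⟩
  exact fws_le_reducedPotential hP hS one_pos hr.1

lemma sInf_reducedPotential_le (hP : ∀ᵐ x ∂P, |x| ≤ S) (hS : 0 ≤ S) {r : ℝ} (hr : 0 ≤ r) :
    sInf (reducedPotential P '' Set.Icc 0 (∫ x, x ^ 2 ∂P)) ≤ reducedPotential P r := by
  set ρ := ∫ x, x ^ 2 ∂P with hρ
  have hρ0 : 0 ≤ ρ := integral_nonneg fun x => sq_nonneg x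
  have hb := bddBelow_reducedPotential hP hS ρ
  rcases le_total r ρ with h | h
  · exact csInf_le hb ⟨r, ⟨hr, h⟩, rfl⟩
  · refine (csInf_le hb ⟨ρ, ⟨hρ0, le_rfl⟩, rfl⟩).trans ?_
    have := integral_scalarFreeEnergy_le hP hS (Real.sqrt_nonneg ρ) (Real.sqrt_le_sqrt h)
    rw [Real.sq_sqrt hr, Real.sq_sqrt hρ0, ← hρ] at this
    unfold reducedPotential
    nlinarith [sq_nonneg (r - ρ)]

/-- Constraining the overlap to any value, of either sign, costs at least the replica-symmetric
free energy. -/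
lemma integral_scalarFreeEnergy_signed_le (hP : ∀ᵐ x ∂P, |x| ≤ S) (hS : 0 ≤ S) {σ q : ℝ}
    (hσ : σ = 1 ∨ σ = -1) (hq : 0 ≤ q) :
    ∫ X, scalarFreeEnergy P (Real.sqrt q) (σ * X) ∂P - q ^ 2 / 4
      ≤ -sInf (reducedPotential P '' Set.Icc 0 (∫ x, x ^ 2 ∂P)) := by
  have h := sInf_reducedPotential_le hP hS hq
  have h2 := integral_scalarFreeEnergy_neg_le hP hS (Real.sqrt q)
  unfold reducedPotential at h ⊢
  rcases hσ with rfl | rfl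
  · simp only [one_mul]
    linarith
  · simp only [neg_one_mul]
    linarith

end Scalar

section Binning

variable {K E : Type*} [Fintype K] [MeasurableSpace E]
variable {μ : Measure E} [IsFiniteMeasure μ] {h : K → E → ℝ} {C : ℝ}

/-- Splitting configuration space into finitely many level sets, one of them carries the partition
function up to a factor equal to their number. -/
lemma exists_log_modelPartition_le (hμ : μ ≠ 0) (hm : ∀ k, Measurable (h k))
    (hC : ∀ᵐ x ∂μ, ∀ k, |h k x| ≤ C) (a p g : K → ℝ) {φ : E → ℤ} (hφ : Measurable φ)
    {L : Finset ℤ} (hL : ∀ᵐ x ∂μ, φ x ∈ L) :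
    ∃ l ∈ L, μ.restrict (φ ⁻¹' {l}) ≠ 0 ∧ Real.log (modelPartition μ h a p g)
      ≤ Real.log L.card + Real.log (modelPartition (μ.restrict (φ ⁻¹' {l})) h a p g) := by
  have hpos := modelPartition_pos hμ hm hC a p g
  have hsum : modelPartition μ h a p g
      = ∑ l ∈ L, modelPartition (μ.restrict (φ ⁻¹' {l})) h a p g := by
    have hi : Integrable (fun x => Real.exp (modelExponent h a p g x)) μ :=
      integrable_exp_of_bound (measurable_modelExponent hm a p g) (modelExponent_bound hC a p g)
    have hU : μ.restrict (⋃ l ∈ L, φ ⁻¹' {l}) = μ :=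
      Measure.restrict_eq_self_of_ae_mem (hL.mono fun x hx => by simpa using hx)
    have := integral_biUnion_finset (μ := μ) (f := fun x => Real.exp (modelExponent h a p g x)) L
      (s := fun l => φ ⁻¹' {l}) (fun l _ => hφ (measurableSet_singleton l))
      (fun l _ l' _ hne => Disjoint.preimage φ (by simpa using hne))
      (fun l _ => hi.integrableOn)
    rw [hU] at this
    exact this
  have hne : L.Nonempty := by
    rw [Finset.nonempty_iff_ne_empty]
    rintro rfl
    simp [hsum] at hpos
  obtain ⟨l, hl, hmax⟩ := Finset.exists_max_image L
    (fun l => modelPartition (μ.restrict (φ ⁻¹' {l})) h a p g) hne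
  have hle : modelPartition μ h a p g
      ≤ L.card * modelPartition (μ.restrict (φ ⁻¹' {l})) h a p g := by
    rw [hsum]
    refine (Finset.sum_le_card_nsmul L _ _ hmax).trans (le_of_eq ?_)
    rw [nsmul_eq_mul]
  have hcard : (0 : ℝ) < L.card := by exact_mod_cast hne.card_pos
  have hlpos : 0 < modelPartition (μ.restrict (φ ⁻¹' {l})) h a p g :=
    pos_of_mul_pos_right (hpos.trans_le hle) hcard.le
  refine ⟨l, hl, fun h0 => ?_, ?_⟩
  · rw [h0] at hlpos
    simp [modelPartition] at hlpos
  · rw [← Real.log_mul hcard.ne' hlpos.ne']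
    exact Real.log_le_log hpos hle

end Binning

section Fluctuations

variable {P : Measure ℝ} [IsProbabilityMeasure P] {S : ℝ} {n : ℕ}

lemma integral_sq_stdGauss : ∫ s, s ^ 2 ∂stdGauss = 1 := by
  have h := variance_fun_id_gaussianReal (μ := 0) (v := 1)
  rw [variance_eq_integral measurable_id'.aemeasurable] at h
  simpa [stdGauss] using h

lemma abs_matrixCoupling_le_div_sqrt (e : Fin n × Fin n) {x : Fin n → ℝ}
    (hx : ∀ i, |x i| ≤ S) : |matrixCoupling n e x| ≤ S ^ 2 / Real.sqrt n := by
  have hS : 0 ≤ S := (abs_nonneg _).trans (hx e.1)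
  unfold matrixCoupling
  split_ifs
  · rw [abs_div, abs_mul, abs_of_nonneg (Real.sqrt_nonneg _), sq]
    exact div_le_div_of_nonneg_right (mul_le_mul (hx e.1) (hx e.2) (abs_nonneg _) hS)
      (Real.sqrt_nonneg _)
  · rw [abs_zero]
    positivity

lemma noise_fluctuation {μ : Measure (Fin n → ℝ)} [IsFiniteMeasure μ] (hn : 0 < n)
    (hae : ∀ᵐ x ∂μ, ∀ i, |x i| ≤ S) (p : Fin n × Fin n → ℝ) :
    Integrable (fun g => |Real.log (modelPartition μ (matrixCoupling n) (fun _ => 1) p g)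
        - modelFreeEnergy μ (matrixCoupling n) (fun _ => 1) p|)
        (Measure.pi fun _ : Fin n × Fin n => stdGauss) ∧
    ∫ g, |Real.log (modelPartition μ (matrixCoupling n) (fun _ => 1) p g)
        - modelFreeEnergy μ (matrixCoupling n) (fun _ => 1) p|
        ∂(Measure.pi fun _ : Fin n × Fin n => stdGauss) ≤ S ^ 2 * Real.sqrt n := by
  rcases eq_or_ne μ 0 with rfl | hμ
  · simp only [modelFreeEnergy, modelPartition, integral_zero_measure, Real.log_zero,
      integral_zero, sub_zero, abs_zero]
    exact ⟨integrable_zero _ _ _, by positivity⟩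
  have hC : ∀ᵐ x ∂μ, ∀ e, |matrixCoupling n e x| ≤ S ^ 2 / Real.sqrt n :=
    hae.mono fun x hx e => abs_matrixCoupling_le_div_sqrt e hx
  have hm := measurable_matrixCoupling (n := n)
  refine ⟨((integrable_log_modelPartition hμ hm hC _ p).sub (integrable_const _)).abs, ?_⟩
  refine (integral_abs_sub_integral_le (ν := stdGauss) (c := S ^ 2 / Real.sqrt n)
    (memLp_id_stdGauss 2)
    (f := fun g => Real.log (modelPartition μ (matrixCoupling n) (fun _ => 1) p g))
    fun z z' => ?_).trans (le_of_eq ?_)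
  · refine (abs_log_modelPartition_sub_le hμ hm hC _ p p z z').trans (le_of_eq ?_)
    rw [Finset.mul_sum]
    refine Finset.sum_congr rfl fun k _ => ?_
    simp
    ring
  · rw [integral_sq_stdGauss, Fintype.card_prod, Fintype.card_fin]
    have hn' : (0 : ℝ) < n := by exact_mod_cast hn
    have e : (S ^ 2 / Real.sqrt n) ^ 2 * ((n * n : ℕ) : ℝ) * 1 = (S ^ 2 * Real.sqrt n) ^ 2 := by
      rw [div_pow, mul_pow, Real.sq_sqrt hn'.le]
      push_cast
      field_simp
    rw [e, Real.sqrt_sq (by positivity)]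

/-- Scalar free energy with side information of signal-to-noise ratio `|m|` planted at the signal
multiplied by the sign of `m`. -/
noncomputable def signedFreeEnergy (P : Measure ℝ) (m X : ℝ) : ℝ :=
  scalarFreeEnergy P (Real.sqrt |m|) ((if 0 ≤ m then 1 else -1) * X)

lemma signal_fluctuation (hP : ∀ᵐ x ∂P, |x| ≤ S) (m : ℝ) :
    Integrable (fun X : Fin n → ℝ => |∑ i, signedFreeEnergy P m (X i)
        - ∫ Y, ∑ i, signedFreeEnergy P m (Y i) ∂(Measure.pi fun _ : Fin n => P)|)
        (Measure.pi fun _ : Fin n => P) ∧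
    ∫ X, |∑ i, signedFreeEnergy P m (X i)
        - ∫ Y, ∑ i, signedFreeEnergy P m (Y i) ∂(Measure.pi fun _ : Fin n => P)|
        ∂(Measure.pi fun _ : Fin n => P)
      ≤ Real.sqrt ((|m| * S) ^ 2 * ∫ s, s ^ 2 ∂P) * Real.sqrt n := by
  have hν : MemLp (fun s : ℝ => s) 2 P :=
    MemLp.of_bound measurable_id.aestronglyMeasurable S hP
  have hf : ∀ z z' : Fin n → ℝ, |∑ i, signedFreeEnergy P m (z i) - ∑ i, signedFreeEnergy P m (z' i)|
      ≤ |m| * S * ∑ k, |z k - z' k| := fun z z' => by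
    rw [← Finset.sum_sub_distrib, Finset.mul_sum]
    refine (Finset.abs_sum_le_sum_abs _ _).trans (Finset.sum_le_sum fun i _ => ?_)
    have := abs_scalarFreeEnergy_sub_le hP (Real.sqrt |m|) ((if 0 ≤ m then 1 else -1) * z i)
      ((if 0 ≤ m then 1 else -1) * z' i)
    rw [Real.sq_sqrt (abs_nonneg _), ← mul_sub, abs_mul (if 0 ≤ m then (1 : ℝ) else -1)] at this
    have h1 : |if 0 ≤ m then (1 : ℝ) else -1| = 1 := by split_ifs <;> simp
    rwa [h1, one_mul] at this
  refine ⟨((memLp_of_sum_abs_bound hν hf).integrable (by norm_num)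
    |>.sub (integrable_const _)).abs, ?_⟩
  refine (integral_abs_sub_integral_le hν hf).trans (le_of_eq ?_)
  rw [Fintype.card_fin, mul_right_comm, Real.sqrt_mul (by positivity)]

lemma integral_sum_signedFreeEnergy (hP : ∀ᵐ x ∂P, |x| ≤ S) (hS : 0 ≤ S) (m : ℝ) :
    ∫ Y, ∑ i, signedFreeEnergy P m (Y i) ∂(Measure.pi fun _ : Fin n => P) - n * m ^ 2 / 4
      ≤ -(n * sInf (reducedPotential P '' Set.Icc 0 (∫ x, x ^ 2 ∂P))) := by
  have hm : Measurable fun X => signedFreeEnergy P m X :=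
    measurable_modelFreeEnergy (fun _ => measurable_id) _
      (p := fun X (_ : Unit) => (if 0 ≤ m then 1 else -1) * X)
      (measurable_pi_iff.2 fun _ => measurable_id.const_mul _)
  have hi : Integrable (fun X => signedFreeEnergy P m X) P :=
    integrable_modelFreeEnergy (NeZero.ne P) (fun _ => measurable_id) (scalar_bound hP) hS _
      (p := fun X (_ : Unit) => (if 0 ≤ m then 1 else -1) * X)
      (measurable_pi_iff.2 fun _ => measurable_id.const_mul _) (P := S)
      (hP.mono fun x hx _ => by split_ifs <;> simpa using hx)
  have hi' : ∀ i, Integrable (fun X : Fin n → ℝ => signedFreeEnergy P m (X i))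
      (Measure.pi fun _ : Fin n => P) := fun i =>
    (measurePreserving_eval (fun _ : Fin n => P) i).integrable_comp_of_integrable hi
  rw [integral_finsetSum _ fun i _ => hi' i]
  have : ∀ i, ∫ X, signedFreeEnergy P m (X i) ∂(Measure.pi fun _ : Fin n => P)
      = ∫ X, signedFreeEnergy P m X ∂P := fun i =>
    integral_comp_eval (μ := fun _ : Fin n => P) (i := i) hi.aestronglyMeasurable
  simp only [this, Finset.sum_const, Finset.card_univ, Fintype.card_fin, nsmul_eq_mul]
  have h := integral_scalarFreeEnergy_signed_le hP hS (σ := if 0 ≤ m then 1 else -1)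
    (by split_ifs <;> simp) (abs_nonneg m)
  rw [sq_abs] at h
  change ∫ X, signedFreeEnergy P m X ∂P - m ^ 2 / 4 ≤ _ at h
  have := mul_le_mul_of_nonneg_left h (Nat.cast_nonneg (α := ℝ) n)
  linarith

end Fluctuations

section UpperBound

variable {P : Measure ℝ} [IsProbabilityMeasure P] {S : ℝ} {n : ℕ}

/-- Contribution of a single overlap bin to the mean log-partition function. -/
lemma modelFreeEnergy_bin_le (hP : ∀ᵐ x ∂P, |x| ≤ S) (hS : 0 ≤ S) (hn : 0 < n) {X : Fin n → ℝ}
    (hX : ∀ i, |X i| ≤ S) {B : Set (Fin n → ℝ)} (hBm : MeasurableSet B)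
    (hB : (Measure.pi fun _ : Fin n => P).restrict B ≠ 0) {m ε : ℝ}
    (hR : ∀ x ∈ B, |(∑ i, X i * x i) / n - m| ≤ ε) :
    modelFreeEnergy ((Measure.pi fun _ : Fin n => P).restrict B) (matrixCoupling n) (fun _ => 1)
        (fun e => matrixCoupling n e X)
      ≤ -(n * sInf (reducedPotential P '' Set.Icc 0 (∫ x, x ^ 2 ∂P)))
        + (n * ε ^ 2 / 2 + S ^ 4 / 4) + |∑ i, signedFreeEnergy P m (X i)
        - ∫ Y, ∑ i, signedFreeEnergy P m (Y i) ∂(Measure.pi fun _ : Fin n => P)| := by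
  have hae := ae_pi_abs_le (n := n) hP
  have h1 := modelFreeEnergy_matrix_le_of_overlap (σ := if 0 ≤ m then 1 else -1) (q := |m|) hn hS hX
    hB (ae_restrict_of_ae hae) ((ae_restrict_mem hBm).mono hR) (abs_nonneg m) (by
      split_ifs with h
      · rw [abs_of_nonneg h, one_mul]
      · rw [abs_of_neg (not_le.1 h), neg_mul_neg, one_mul]) (by split_ifs <;> simp)
  have h2 := modelFreeEnergy_restrict_le (h := fun (i : Fin n) x => x i) measurable_pi_apply hae
    (fun _ => Real.sqrt |m|) (fun i => (if 0 ≤ m then 1 else -1) * X i) hB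
  rw [modelFreeEnergy_coordinates hP] at h2
  change _ ≤ ∑ i, signedFreeEnergy P m (X i) at h2
  have h3 := integral_sum_signedFreeEnergy (n := n) hP hS m
  have h4 := le_abs_self (∑ i, signedFreeEnergy P m (X i)
        - ∫ Y, ∑ i, signedFreeEnergy P m (Y i) ∂(Measure.pi fun _ : Fin n => P))
  linarith

lemma abs_overlap_le (hn : 0 < n) {X x : Fin n → ℝ} (hX : ∀ i, |X i| ≤ S) (hx : ∀ i, |x i| ≤ S) :
    |(∑ i, X i * x i) / n| ≤ S ^ 2 := by
  have hn' : (0 : ℝ) < n := by exact_mod_cast hn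
  rw [abs_div, abs_of_pos hn', div_le_iff₀ hn']
  refine (Finset.abs_sum_le_sum_abs _ _).trans ?_
  have : ∀ i ∈ (Finset.univ : Finset (Fin n)), |X i * x i| ≤ S ^ 2 := fun i _ => by
    rw [abs_mul, sq]
    exact mul_le_mul (hX i) (hx i) (abs_nonneg _) ((abs_nonneg _).trans (hX i))
  refine (Finset.sum_le_card_nsmul _ _ _ this).trans (le_of_eq ?_)
  simp [mul_comm]

/-- Upper bound on the mean log-partition function for a fixed signal. -/
lemma modelFreeEnergy_matrix_le (hP : ∀ᵐ x ∂P, |x| ≤ S) (hS : 0 ≤ S) (hn : 0 < n) {X : Fin n → ℝ}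
    (hX : ∀ i, |X i| ≤ S) {ε : ℝ} (hε : 0 < ε) {L : Finset ℤ}
    (hL : ∀ t : ℝ, |t| ≤ S ^ 2 → ⌊t / ε⌋ ∈ L) :
    modelFreeEnergy (Measure.pi fun _ : Fin n => P) (matrixCoupling n) (fun _ => 1)
        (fun e => matrixCoupling n e X)
      ≤ (Real.log L.card - n * sInf (reducedPotential P '' Set.Icc 0 (∫ x, x ^ 2 ∂P))
        + (n * ε ^ 2 / 2 + S ^ 4 / 4) + L.card * (S ^ 2 * Real.sqrt n))
        + ∑ l ∈ L, |∑ i, signedFreeEnergy P (l * ε) (X i)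
        - ∫ Y, ∑ i, signedFreeEnergy P (l * ε) (Y i) ∂(Measure.pi fun _ : Fin n => P)| := by
  set μ := Measure.pi fun _ : Fin n => P with hμdef
  set V := sInf (reducedPotential P '' Set.Icc 0 (∫ x, x ^ 2 ∂P))
  set D : ℤ → ℝ := fun l => |∑ i, signedFreeEnergy P (l * ε) (X i)
        - ∫ Y, ∑ i, signedFreeEnergy P (l * ε) (Y i) ∂(Measure.pi fun _ : Fin n => P)| with hD
  set p : Fin n × Fin n → ℝ := fun e => matrixCoupling n e X
  set φ : (Fin n → ℝ) → ℤ := fun x => ⌊(∑ i, X i * x i) / n / ε⌋ with hφdef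
  have hμ : μ ≠ 0 := NeZero.ne μ
  have hae : ∀ᵐ x ∂μ, ∀ i, |x i| ≤ S := ae_pi_abs_le hP
  have hC : ∀ᵐ x ∂μ, ∀ e, |matrixCoupling n e x| ≤ S ^ 2 + S :=
    hae.mono fun x hx e => abs_matrixCoupling_le hn e hx
  have hm := measurable_matrixCoupling (n := n)
  have hφ : Measurable φ := Int.measurable_floor.comp (by fun_prop)
  have hφL : ∀ᵐ x ∂μ, φ x ∈ L := hae.mono fun x hx => hL _ (abs_overlap_le hn hX hx)
  have hbin : ∀ l : ℤ, ∀ x ∈ φ ⁻¹' {l}, |(∑ i, X i * x i) / n - l * ε| ≤ ε := fun l x hx => by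
    have hx' : ⌊(∑ i, X i * x i) / n / ε⌋ = l := hx
    rw [Int.floor_eq_iff, le_div_iff₀ hε, div_lt_iff₀ hε] at hx'
    rw [abs_le]
    constructor <;> nlinarith [hx'.1, hx'.2]
  set J : ℤ → (Fin n × Fin n → ℝ) → ℝ := fun l g =>
    |Real.log (modelPartition (μ.restrict (φ ⁻¹' {l})) (matrixCoupling n) (fun _ => 1) p g)
      - modelFreeEnergy (μ.restrict (φ ⁻¹' {l})) (matrixCoupling n) (fun _ => 1) p| with hJ
  have hnoise : ∀ l, Integrable (J l) (Measure.pi fun _ => stdGauss) ∧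
      ∫ g, J l g ∂(Measure.pi fun _ => stdGauss) ≤ S ^ 2 * Real.sqrt n := fun l =>
    noise_fluctuation hn (ae_restrict_of_ae hae) p
  set c := Real.log L.card - n * V + (n * ε ^ 2 / 2 + S ^ 4 / 4) + ∑ l ∈ L, D l with hc
  have hpt : ∀ g, Real.log (modelPartition μ (matrixCoupling n) (fun _ => 1) p g)
      ≤ c + ∑ l ∈ L, J l g := fun g => by
    obtain ⟨l, hl, hB, hlog⟩ := exists_log_modelPartition_le hμ hm hC (fun _ => 1) p g hφ hφL
    have h1 := modelFreeEnergy_bin_le hP hS hn hX (hφ (measurableSet_singleton l)) hB (hbin l)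
    have h2 : J l g ≤ ∑ l ∈ L, J l g :=
      Finset.single_le_sum (f := fun l => J l g) (fun l _ => abs_nonneg _) hl
    have h3 : D l ≤ ∑ l ∈ L, D l :=
      Finset.single_le_sum (f := fun l => D l) (fun l _ => abs_nonneg _) hl
    have h4 := le_abs_self
      (Real.log (modelPartition (μ.restrict (φ ⁻¹' {l})) (matrixCoupling n) (fun _ => 1) p g)
      - modelFreeEnergy (μ.restrict (φ ⁻¹' {l})) (matrixCoupling n) (fun _ => 1) p)
    simp only [hJ, hD] at h2 h3
    simp only [hc, hJ, hD]
    linarith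
  have iJ : Integrable (fun g => ∑ l ∈ L, J l g) (Measure.pi fun _ => stdGauss) :=
    integrable_finsetSum _ fun l _ => (hnoise l).1
  have hint := integral_mono (integrable_log_modelPartition hμ hm hC (fun _ => 1) p)
    ((integrable_const c).add iJ) hpt
  have e : ∫ g, (c + ∑ l ∈ L, J l g) ∂(Measure.pi fun _ : Fin n × Fin n => stdGauss)
      = c + ∑ l ∈ L, ∫ g, J l g ∂(Measure.pi fun _ => stdGauss) := by
    rw [integral_add (integrable_const c) iJ, integral_finsetSum _ fun l _ => (hnoise l).1]
    simp
  have hsum : ∑ l ∈ L, ∫ g, J l g ∂(Measure.pi fun _ => stdGauss)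
      ≤ L.card * (S ^ 2 * Real.sqrt n) := by
    refine (Finset.sum_le_card_nsmul L _ _ fun l _ => (hnoise l).2).trans (le_of_eq ?_)
    rw [nsmul_eq_mul]
  have hfin : modelFreeEnergy μ (matrixCoupling n) (fun _ => 1) p
      ≤ ∫ g, (c + ∑ l ∈ L, J l g) ∂(Measure.pi fun _ : Fin n × Fin n => stdGauss) := hint
  rw [e] at hfin
  linarith

lemma exists_le_fws (hP : ∀ᵐ x ∂P, |x| ≤ S) (hS : 0 ≤ S) {ε : ℝ} (hε : 0 < ε) :
    ∃ C, ∀ n : ℕ, 0 < n → sInf (reducedPotential P '' Set.Icc 0 (∫ x, x ^ 2 ∂P)) - ε ^ 2 / 2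
      - C / Real.sqrt n ≤ fws P n := by
  set V := sInf (reducedPotential P '' Set.Icc 0 (∫ x, x ^ 2 ∂P))
  set L : Finset ℤ := Finset.Icc ⌊-S ^ 2 / ε⌋ ⌊S ^ 2 / ε⌋ with hLdef
  have hL : ∀ t : ℝ, |t| ≤ S ^ 2 → ⌊t / ε⌋ ∈ L := fun t ht => by
    rw [hLdef, Finset.mem_Icc]
    have := abs_le.1 ht
    exact ⟨Int.floor_le_floor (div_le_div_of_nonneg_right (by linarith) hε.le),
      Int.floor_le_floor (div_le_div_of_nonneg_right this.2 hε.le)⟩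
  set A := |Real.log L.card| + S ^ 4 / 4
  set B := L.card * S ^ 2
    + ∑ l ∈ L, Real.sqrt ((|l * ε| * S) ^ 2 * ∫ s, s ^ 2 ∂P)
  refine ⟨A + B, fun n hn => ?_⟩
  have hn' : (0 : ℝ) < n := by exact_mod_cast hn
  have hs : 1 ≤ Real.sqrt n := Real.one_le_sqrt.2 (by exact_mod_cast hn)
  have hs2 : Real.sqrt n ^ 2 = n := Real.sq_sqrt hn'.le
  have hA : 0 ≤ A := by positivity
  set μ := Measure.pi fun _ : Fin n => P
  have hμ : μ ≠ 0 := NeZero.ne μ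
  have hae : ∀ᵐ x ∂μ, ∀ i, |x i| ≤ S := ae_pi_abs_le hP
  have hC : ∀ᵐ x ∂μ, ∀ e, |matrixCoupling n e x| ≤ S ^ 2 + S :=
    hae.mono fun x hx e => abs_matrixCoupling_le hn e hx
  have hm := measurable_matrixCoupling (n := n)
  have hfl := fun l : ℤ => signal_fluctuation (n := n) hP (l * ε)
  set D : ℤ → (Fin n → ℝ) → ℝ := fun l X => |∑ i, signedFreeEnergy P (l * ε) (X i)
        - ∫ Y, ∑ i, signedFreeEnergy P (l * ε) (Y i) ∂(Measure.pi fun _ : Fin n => P)|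
  set c := Real.log L.card - n * V + (n * ε ^ 2 / 2 + S ^ 4 / 4) + L.card * (S ^ 2 * Real.sqrt n)
    with hc
  have iD : Integrable (fun X => ∑ l ∈ L, D l X) μ := integrable_finsetSum _ fun l _ => (hfl l).1
  have icD : Integrable (fun X => c + ∑ l ∈ L, D l X) μ := (integrable_const c).add iD
  have hint : ∫ X, modelFreeEnergy μ (matrixCoupling n) (fun _ => 1)
        (fun e => matrixCoupling n e X) ∂μ ≤ ∫ X, (c + ∑ l ∈ L, D l X) ∂μ :=
    integral_mono_ae (integrable_modelFreeEnergy hμ hm hC (by positivity) (fun _ => 1)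
      (p := fun X e => matrixCoupling n e X) (measurable_pi_iff.2 hm) hC) icD
      (hae.mono fun X hX => modelFreeEnergy_matrix_le hP hS hn hX hε hL)
  have e : ∫ X, (c + ∑ l ∈ L, D l X) ∂μ = c + ∑ l ∈ L, ∫ X, D l X ∂μ := by
    rw [integral_add (integrable_const c) iD, integral_finsetSum _ fun l _ => (hfl l).1]
    simp
    rfl
  have hsum : ∑ l ∈ L, ∫ X, D l X ∂μ
      ≤ (∑ l ∈ L, Real.sqrt ((|l * ε| * S) ^ 2 * ∫ s, s ^ 2 ∂P)) * Real.sqrt n := by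
    rw [Finset.sum_mul]
    exact Finset.sum_le_sum fun l _ => (hfl l).2
  rw [e] at hint
  have htot : ∫ X, modelFreeEnergy μ (matrixCoupling n) (fun _ => 1)
      (fun e => matrixCoupling n e X) ∂μ ≤ -(n * (V - ε ^ 2 / 2)) + (A + B) * Real.sqrt n := by
    have h1 : A ≤ A * Real.sqrt n := le_mul_of_one_le_right hA hs
    have h2 := le_abs_self (Real.log L.card)
    simp only [hc, A, B] at *
    linarith
  rw [fws_eq]
  have := mul_le_mul_of_nonneg_left htot (one_div_pos.2 hn').le
  have e2 : 1 / (n : ℝ) * (-(n * (V - ε ^ 2 / 2)) + (A + B) * Real.sqrt n)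
      = -(V - ε ^ 2 / 2) + (A + B) / Real.sqrt n := by
    rw [← hs2]
    have : Real.sqrt n ≠ 0 := by positivity
    rw [Real.sqrt_sq (Real.sqrt_nonneg _)]
    field_simp
  rw [e2] at this
  linarith

lemma tendsto_fws (hP : ∀ᵐ x ∂P, |x| ≤ S) (hS : 0 ≤ S) :
    Filter.Tendsto (fun n : ℕ => fws P n) Filter.atTop
      (nhds (sInf (reducedPotential P '' Set.Icc 0 (∫ x, x ^ 2 ∂P)))) := by
  have hρ : 0 ≤ ∫ x, x ^ 2 ∂P := integral_nonneg fun x => sq_nonneg x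
  rw [Metric.tendsto_atTop']
  intro δ hδ
  obtain ⟨C, hC⟩ := exists_le_fws hP hS (ε := Real.sqrt δ) (Real.sqrt_pos.2 hδ)
  have hlim : Filter.Tendsto (fun n : ℕ => C / Real.sqrt n) Filter.atTop (nhds 0) :=
    (Real.tendsto_sqrt_atTop.comp tendsto_natCast_atTop_atTop).const_div_atTop C
  obtain ⟨N, hN⟩ := Filter.eventually_atTop.1 (hlim.eventually_lt_const (half_pos hδ))
  refine ⟨N, fun n hn => ?_⟩
  have hn0 : 0 < n := (Nat.zero_le N).trans_lt hn
  have hlow := hC n hn0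
  have hup : fws P n ≤ sInf (reducedPotential P '' Set.Icc 0 (∫ x, x ^ 2 ∂P)) := by
    refine le_csInf ⟨_, 0, ⟨le_rfl, hρ⟩, rfl⟩ ?_
    rintro _ ⟨r, hr, rfl⟩
    exact fws_le_reducedPotential hP hS hn0 hr.1
  rw [Real.sq_sqrt hδ.le] at hlow
  rw [Real.dist_eq, abs_lt]
  constructor <;> linarith [hN n hn.le]

end UpperBound

/-- Replica-symmetric formula for the Wigner spike model:
`lim_{n→∞} f_n^ws = inf_{r∈[0,ρ]} sup_{q∈[0,ρ]} f^pot(q,r)`. -/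
theorem wignerSpike_replica_formula (S : ℝ) (hS : 0 < S)
    (P0 : Measure ℝ) [IsProbabilityMeasure P0]
    (hsupp : ∀ᵐ x ∂P0, x ∈ Set.Icc (-S) S)
    (ρ : ℝ) (hρ : ρ = ∫ x, x ^ 2 ∂P0) :
    Filter.Tendsto (fun n : ℕ => fws P0 n) Filter.atTop
      (nhds (sInf ((fun r => sSup ((fun q => fpotWS P0 q r) '' Set.Icc 0 ρ))
        '' Set.Icc 0 ρ))) := by
  have hP : ∀ᵐ x ∂P0, |x| ≤ S := hsupp.mono fun x hx => abs_le.2 hx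
  rw [Set.image_congr fun r hr => sSup_fpotWS_eq (P := P0) hr, hρ]
  exact tendsto_fws hP hS.le
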